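/- arXiv:2408.09693 — 3 statements merged into one kernel-verified Lean document; each statement's English description precedes it below -/
import Mathlib

section
/- For every initial condition γ₀ ∈ (0, γ_max], there exists exactly one continuous admissible control h* : [0,∞) → [0, h_max] with J(h*; γ₀) = v(γ₀); i.e. the continuous optimal control of the reduced deterministic control problem is unique. -/
namespace RC

open MeasureTheory Filter Topology Set

/-- `w` is absolutely continuous on every `[0,T]` with a.e. derivative `φ` on `(0,∞)`. -/
structure Prim (w φ : ℝ → ℝ) : Prop where
  ac : ∀ T, 0 ≤ T → AbsolutelyContinuousOnInterval w 0 T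
  der : ∀ᵐ t, 0 < t → HasDerivAt w (φ t) t

theorem ac_comp {w g : ℝ → ℝ} {a b : ℝ} (hw : AbsolutelyContinuousOnInterval w a b)
    (hg : ContDiffOn ℝ 1 g (w '' uIcc a b)) :
    AbsolutelyContinuousOnInterval (fun t => g (w t)) a b := by
  have hc := hw.continuousOn
  have hcomp : IsCompact (w '' uIcc a b) := isCompact_uIcc.image_of_continuousOn hc
  have hconv : Convex ℝ (w '' uIcc a b) := by
    have : IsPreconnected (w '' uIcc a b) := isPreconnected_uIcc.image _ hc
    exact this.ordConnected.convex
  obtain ⟨K, hK⟩ := hg.exists_lipschitzOnWith (by decide) hconv hcomp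
  rw [absolutelyContinuousOnInterval_iff] at hw ⊢
  intro ε hε
  obtain ⟨d, hd, h⟩ := hw (ε / (K + 1)) (by positivity)
  refine ⟨d, hd, fun E hE hs => ?_⟩
  have h1 := h E hE hs
  calc _ ≤ ∑ i ∈ Finset.range E.1, K * dist (w (E.2 i).1) (w (E.2 i).2) := by
        apply Finset.sum_le_sum
        intro i hi
        exact hK.dist_le_mul _ (mem_image_of_mem _ (hE.left i hi).left) _
          (mem_image_of_mem _ (hE.left i hi).right)
    _ = K * ∑ i ∈ Finset.range E.1, dist (w (E.2 i).1) (w (E.2 i).2) := by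
        rw [Finset.mul_sum]
    _ ≤ K * (ε / (K + 1)) := by gcongr
    _ < (K + 1) * (ε / (K + 1)) := by gcongr; linarith
    _ = ε := by field

theorem ac_congr {w w2 : ℝ → ℝ} {a b : ℝ} (hw : AbsolutelyContinuousOnInterval w a b)
    (h : EqOn w2 w (uIcc a b)) : AbsolutelyContinuousOnInterval w2 a b := by
  rw [absolutelyContinuousOnInterval_iff] at hw ⊢
  intro ε hε
  obtain ⟨d, hd, h1⟩ := hw ε hε
  refine ⟨d, hd, fun E hE hs => ?_⟩
  refine lt_of_eq_of_lt ?_ (h1 E hE hs)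
  apply Finset.sum_congr rfl
  intro i hi
  rw [h (hE.left i hi).left, h (hE.left i hi).right]

theorem Prim.mul {w φ w2 φ2 : ℝ → ℝ} (h : Prim w φ) (h2 : Prim w2 φ2) :
    Prim (fun t => w t * w2 t) (fun t => φ t * w2 t + w t * φ2 t) where
  ac T hT := (h.ac T hT).mul (h2.ac T hT)
  der := by
    filter_upwards [h.der, h2.der] with t a b ht
    exact (a ht).mul (b ht)

theorem Prim.add {w φ w2 φ2 : ℝ → ℝ} (h : Prim w φ) (h2 : Prim w2 φ2) :
    Prim (fun t => w t + w2 t) (fun t => φ t + φ2 t) where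
  ac T hT := (h.ac T hT).add (h2.ac T hT)
  der := by
    filter_upwards [h.der, h2.der] with t a b ht
    exact (a ht).add (b ht)

theorem Prim.sub {w φ w2 φ2 : ℝ → ℝ} (h : Prim w φ) (h2 : Prim w2 φ2) :
    Prim (fun t => w t - w2 t) (fun t => φ t - φ2 t) where
  ac T hT := (h.ac T hT).sub (h2.ac T hT)
  der := by
    filter_upwards [h.der, h2.der] with t a b ht
    exact (a ht).sub (b ht)

theorem Prim.const_mul {w φ : ℝ → ℝ} (h : Prim w φ) (c : ℝ) :
    Prim (fun t => c * w t) (fun t => c * φ t) where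
  ac T hT := (h.ac T hT).const_mul c
  der := by
    filter_upwards [h.der] with t a ht
    exact (a ht).const_mul c

theorem Prim.exp {w φ : ℝ → ℝ} (h : Prim w φ) :
    Prim (fun t => Real.exp (w t)) (fun t => Real.exp (w t) * φ t) where
  ac T hT := ac_comp (h.ac T hT) Real.contDiff_exp.contDiffOn
  der := by
    filter_upwards [h.der] with t a ht
    exact (a ht).exp

theorem Prim.inv {w φ : ℝ → ℝ} (h : Prim w φ) (h0 : ∀ t, 0 ≤ t → 0 < w t) :
    Prim (fun t => (w t)⁻¹) (fun t => - φ t / (w t) ^ 2) where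
  ac T hT := by
    refine ac_comp (g := fun x => x⁻¹) (h.ac T hT) ?_
    refine contDiffOn_id.inv ?_
    rintro x ⟨t, ht, rfl⟩
    rw [uIcc_of_le hT] at ht
    exact (h0 t ht.1).ne'
  der := by
    filter_upwards [h.der] with t a ht
    exact (a ht).inv (h0 t ht.le).ne'

theorem Prim.congr {w φ φ2 : ℝ → ℝ} (h : Prim w φ) (h2 : ∀ t, 0 < t → φ t = φ2 t) :
    Prim w φ2 where
  ac := h.ac
  der := by
    filter_upwards [h.der] with t a ht
    rw [← h2 t ht]; exact a ht

theorem Prim.ftc {w φ : ℝ → ℝ} (h : Prim w φ) {T : ℝ} (hT : 0 ≤ T) :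
    w T = w 0 + ∫ t in (0:ℝ)..T, φ t := by
  have h1 := (h.ac T hT).integral_deriv_eq_sub
  have h2 : ∫ t in (0:ℝ)..T, deriv w t = ∫ t in (0:ℝ)..T, φ t := by
    apply intervalIntegral.integral_congr_ae
    filter_upwards [h.der] with t a ht
    rw [uIoc_of_le hT] at ht
    exact (a ht.1).deriv
  linarith

theorem intable {φ : ℝ → ℝ} {C : ℝ} (hm : Measurable φ) (hC : ∀ t, |φ t| ≤ C) (a b : ℝ) :
    IntervalIntegrable φ volume a b := by
  rw [intervalIntegrable_iff]
  refine Measure.integrableOn_of_bounded (M := C) ?_ hm.aestronglyMeasurable ?_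
  · simp [uIoc]
  · exact ae_of_all _ (fun t => hC t)

theorem Prim.of_integral {w φ : ℝ → ℝ} {C w0 : ℝ} (hm : Measurable φ) (hC : ∀ t, |φ t| ≤ C)
    (hw : ∀ t, 0 ≤ t → w t = w0 + ∫ s in (0:ℝ)..t, φ s) : Prim w φ where
  ac T hT := by
    have h1 := (intable hm hC 0 T).absolutelyContinuousOnInterval_intervalIntegral
      (c := 0) (by simp)
    have h0 : AbsolutelyContinuousOnInterval (fun _ : ℝ => w0) 0 T :=
      (contDiffOn_const).absolutelyContinuousOnInterval
    refine ac_congr (h0.add h1) ?_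
    intro t ht
    rw [uIcc_of_le hT] at ht
    exact hw t ht.1
  der := by
    have hl : LocallyIntegrable φ volume := by
      have : IsLocallyFiniteMeasure (volume : Measure ℝ) := inferInstance
      refine (locallyIntegrable_iff).2 fun K hK => ?_
      refine Measure.integrableOn_of_bounded (M := C) hK.measure_lt_top.ne
        hm.aestronglyMeasurable ?_
      exact ae_of_all _ (fun t => hC t)
    filter_upwards [_root_.LocallyIntegrable.ae_hasDerivAt_integral hl] with t h ht
    have h1 := (h 0).const_add w0
    refine h1.congr_of_eventuallyEq ?_
    filter_upwards [lt_mem_nhds ht] with x hx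
    exact hw x hx.le

theorem Prim.integral {φ : ℝ → ℝ} {C : ℝ} (hm : Measurable φ) (hC : ∀ t, |φ t| ≤ C) :
    Prim (fun t => ∫ s in (0:ℝ)..t, φ s) φ :=
  Prim.of_integral (w0 := 0) hm hC (fun t _ => by simp)

theorem linear {w a b : ℝ → ℝ} {C : ℝ} (hm : Measurable a) (hC : ∀ t, |a t| ≤ C)
    (hw : Prim w (fun t => - a t * w t + b t)) {T : ℝ} (hT : 0 ≤ T) :
    Real.exp (∫ s in (0:ℝ)..T, a s) * w T
      = w 0 + ∫ t in (0:ℝ)..T, Real.exp (∫ s in (0:ℝ)..t, a s) * b t := by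
  have h1 := ((Prim.integral hm hC).exp.mul hw).congr
    (φ2 := fun t => Real.exp (∫ s in (0:ℝ)..t, a s) * b t) (fun t _ => by ring)
  have := h1.ftc hT
  simpa using this

theorem linear_ge {w a b : ℝ → ℝ} {C : ℝ} (hm : Measurable a) (hC : ∀ t, |a t| ≤ C)
    (hw : Prim w (fun t => - a t * w t + b t)) (hb : ∀ t, 0 ≤ t → 0 ≤ b t) {T : ℝ} (hT : 0 ≤ T) :
    w 0 ≤ Real.exp (∫ s in (0:ℝ)..T, a s) * w T := by
  rw [linear hm hC hw hT]
  have : 0 ≤ ∫ t in (0:ℝ)..T, Real.exp (∫ s in (0:ℝ)..t, a s) * b t :=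
    intervalIntegral.integral_nonneg hT (fun t ht => mul_nonneg (Real.exp_pos _).le (hb t ht.1))
  linarith

theorem linear_abs {w a b d : ℝ → ℝ} {C D : ℝ} (hm : Measurable a) (hC : ∀ t, |a t| ≤ C)
    (ha : ∀ t, 0 ≤ a t) (hdm : Measurable d) (hD : ∀ t, |d t| ≤ D)
    (hw : Prim w (fun t => - a t * w t + b t)) (h0 : w 0 = 0) (hb : ∀ t, 0 ≤ t → |b t| ≤ d t)
    {T : ℝ} (hT : 0 ≤ T) :
    |w T| ≤ ∫ t in (0:ℝ)..T, d t := by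
  have h := linear hm hC hw hT
  rw [h0, zero_add] at h
  set A := fun t => ∫ s in (0:ℝ)..t, a s with hA
  have hmono : ∀ t, t ≤ T → A t ≤ A T := by
    intro t ht
    have : A T - A t = ∫ s in t..T, a s :=
      intervalIntegral.integral_interval_sub_left (intable hm hC _ _) (intable hm hC _ _)
    have h2 : 0 ≤ ∫ s in t..T, a s := intervalIntegral.integral_nonneg ht (fun s _ => ha s)
    linarith
  have h3 : |∫ t in (0:ℝ)..T, Real.exp (A t) * b t| ≤ ∫ t in (0:ℝ)..T, Real.exp (A T) * d t := by
    have := intervalIntegral.norm_integral_le_of_norm_le (μ := volume) (a := 0) (b := T)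
      (f := fun t => Real.exp (A t) * b t) (g := fun t => Real.exp (A T) * d t) hT ?_
      ((intable hdm hD _ _).const_mul _)
    · simpa using this
    · refine ae_of_all _ fun t ht => ?_
      rw [Real.norm_eq_abs, abs_mul, abs_of_pos (Real.exp_pos _)]
      have := hmono t ht.2
      have := hb t ht.1.le
      gcongr
  have h4 : Real.exp (A T) * |w T| ≤ Real.exp (A T) * ∫ t in (0:ℝ)..T, d t := by
    rw [← intervalIntegral.integral_const_mul]
    refine le_trans (le_of_eq ?_) h3
    rw [← h, abs_mul, abs_of_pos (Real.exp_pos _)]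
  exact le_of_mul_le_mul_left h4 (Real.exp_pos _)

/-- right-hand side of the Riccati equation -/
def rhs (k l s x h : ℝ) : ℝ := -(k + h) * x ^ 2 - 2 * l * x + s

/-- admissible controls -/
def Ad (H : ℝ) (h : ℝ → ℝ) : Prop := Measurable h ∧ ∀ t, h t ∈ Icc 0 H

/-- trajectories -/
structure Traj (k l s G g0 : ℝ) (h γ : ℝ → ℝ) : Prop where
  cont : Continuous γ
  mem : ∀ t, γ t ∈ Icc 0 G
  eqn : ∀ t, 0 ≤ t → γ t = g0 + ∫ u in (0:ℝ)..t, rhs k l s (γ u) (h u)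

section
variable {k l s G H g0 : ℝ} (hk : 0 ≤ k) (hl : 0 ≤ l) (hs : 0 ≤ s) (hg0 : 0 < g0) (hG : 0 ≤ G)

theorem Traj.zero {h γ : ℝ → ℝ} (T : Traj k l s G g0 h γ) : γ 0 = g0 := by
  have := T.eqn 0 le_rfl
  simpa using this

include hk hl hs hG in
theorem Traj.prim {h γ : ℝ → ℝ} (T : Traj k l s G g0 h γ) (hh : Ad H h) :
    Prim γ (fun t => rhs k l s (γ t) (h t)) := by
  refine Prim.of_integral (w0 := g0) (C := (k + H) * G ^ 2 + 2 * l * G + s) ?_ ?_ T.eqn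
  · have := hh.1
    have := T.cont.measurable
    unfold rhs
    fun_prop
  · intro t
    obtain ⟨a1, a2⟩ := T.mem t
    obtain ⟨b1, b2⟩ := hh.2 t
    have hH : 0 ≤ H := b1.trans b2
    unfold rhs
    have e1 : (k + h t) * γ t ^ 2 ≤ (k + H) * G ^ 2 := by gcongr
    have e2 : 2 * l * γ t ≤ 2 * l * G := by gcongr
    have e3 : 0 ≤ (k + h t) * γ t ^ 2 := by positivity
    have e4 : 0 ≤ 2 * l * γ t := by positivity
    rw [abs_le]; constructor <;> linarith

include hk hl hs hG hg0 in
theorem Traj.pos {h γ : ℝ → ℝ} (T : Traj k l s G g0 h γ) (hh : Ad H h) {t : ℝ} (ht : 0 ≤ t) :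
    0 < γ t := by
  have hp := (T.prim hk hl hs hG hh).congr
    (φ2 := fun t => - ((k + h t) * γ t + 2 * l) * γ t + s) (fun t _ => by unfold rhs; ring)
  have hm1 := hh.1
  have hm2 := T.cont.measurable
  have := linear_ge (a := fun t => (k + h t) * γ t + 2 * l) (b := fun _ => s)
    (C := (k + H) * G + 2 * l) (by fun_prop) ?_ hp (fun _ _ => hs) ht
  · rw [T.zero] at this
    have h2 := lt_of_lt_of_le hg0 this
    exact (pos_iff_pos_of_mul_pos h2).1 (Real.exp_pos _)
  · intro t
    obtain ⟨a1, a2⟩ := T.mem t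
    obtain ⟨b1, b2⟩ := hh.2 t
    have hH : 0 ≤ H := b1.trans b2
    rw [abs_of_nonneg (by positivity)]
    gcongr

include hk hl hs hG in
theorem Traj.diff {h1 γ1 h2 γ2 : ℝ → ℝ} (T1 : Traj k l s G g0 h1 γ1) (hh1 : Ad H h1)
    (T2 : Traj k l s G g0 h2 γ2) (hh2 : Ad H h2) {t : ℝ} (ht : 0 ≤ t) :
    |γ1 t - γ2 t| ≤ ∫ u in (0:ℝ)..t, G ^ 2 * |h1 u - h2 u| := by
  have hm1 := hh1.1
  have hm2 := hh2.1
  have hm3 := T1.cont.measurable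
  have hm4 := T2.cont.measurable
  have hp := ((T1.prim hk hl hs hG hh1).sub (T2.prim hk hl hs hG hh2)).congr
    (φ2 := fun t => - ((k + h1 t) * (γ1 t + γ2 t) + 2 * l) * (γ1 t - γ2 t)
      + (-(h1 t - h2 t) * γ2 t ^ 2)) (fun t _ => by unfold rhs; ring)
  refine linear_abs (w := fun t => γ1 t - γ2 t)
    (a := fun t => (k + h1 t) * (γ1 t + γ2 t) + 2 * l)
    (C := (k + H) * (G + G) + 2 * l) (D := G ^ 2 * H) (by fun_prop) ?_ ?_ ?_ ?_ hp ?_ ?_ ht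
  · intro t
    obtain ⟨a1, a2⟩ := T1.mem t
    obtain ⟨c1, c2⟩ := T2.mem t
    obtain ⟨b1, b2⟩ := hh1.2 t
    have hH : 0 ≤ H := b1.trans b2
    rw [abs_of_nonneg (by positivity)]
    gcongr
  · intro t
    obtain ⟨a1, a2⟩ := T1.mem t
    obtain ⟨c1, c2⟩ := T2.mem t
    obtain ⟨b1, b2⟩ := hh1.2 t
    have hH : 0 ≤ H := b1.trans b2
    positivity
  · simp only [← Real.norm_eq_abs]; fun_prop
  · intro t
    obtain ⟨b1, b2⟩ := hh1.2 t
    have hH : 0 ≤ H := b1.trans b2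
    obtain ⟨c1, c2⟩ := hh2.2 t
    rw [abs_of_nonneg (by positivity)]
    gcongr
    rw [abs_le]; constructor <;> linarith
  · simp only [T1.zero, T2.zero, sub_self]
  · intro t _
    obtain ⟨c1, c2⟩ := T2.mem t
    rw [abs_mul, abs_neg, mul_comm, abs_of_nonneg (sq_nonneg _)]
    gcongr

include hk hl hs hG hg0 in
/-- Convexity in the coordinate `1/γ`. -/
theorem Traj.convex {h1 γ1 h2 γ2 : ℝ → ℝ} (T1 : Traj k l s G g0 h1 γ1) (hh1 : Ad H h1)
    (T2 : Traj k l s G g0 h2 γ2) (hh2 : Ad H h2) :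
    ∃ h3, Ad H h3 ∧ (∀ t, h3 t ≤ (h1 t + h2 t) / 2) ∧
      ∀ γ3, Traj k l s G g0 h3 γ3 → ∀ t, 0 ≤ t → γ3 t ≤ (γ1 t + γ2 t) / 2 := by
  have hm1 := hh1.1
  have hm2 := hh2.1
  have hm3 := T1.cont.measurable
  have hm4 := T2.cont.measurable
  set ht : ℝ → ℝ := fun t => (h1 t + h2 t) / 2 - s * ((γ1 t)⁻¹ - (γ2 t)⁻¹) ^ 2 / 4 with hht
  have hle : ∀ t, ht t ≤ (h1 t + h2 t) / 2 := by
    intro t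
    have : 0 ≤ s * ((γ1 t)⁻¹ - (γ2 t)⁻¹) ^ 2 / 4 := by positivity
    simp only [hht]; linarith
  have hm5 : Measurable ht := by fun_prop
  have hav : ∀ t, 0 ≤ (h1 t + h2 t) / 2 ∧ (h1 t + h2 t) / 2 ≤ H := by
    intro t
    obtain ⟨b1, b2⟩ := hh1.2 t
    have hH : 0 ≤ H := b1.trans b2
    obtain ⟨c1, c2⟩ := hh2.2 t
    constructor <;> linarith
  have hle3 : ∀ t, max (ht t) 0 ≤ (h1 t + h2 t) / 2 := fun t => max_le (hle t) (hav t).1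
  have hAd : Ad H (fun t => max (ht t) 0) :=
    ⟨by fun_prop, fun t => ⟨le_max_right _ _, (hle3 t).trans (hav t).2⟩⟩
  refine ⟨fun t => max (ht t) 0, hAd, hle3, fun γ3 T3 => ?_⟩
  have p1 := fun t (h : 0 ≤ t) => T1.pos hk hl hs hg0 hG hh1 h
  have p2 := fun t (h : 0 ≤ t) => T2.pos hk hl hs hg0 hG hh2 h
  set g : ℝ → ℝ := fun t => 2 * (γ1 t * γ2 t * (γ1 t + γ2 t)⁻¹) with hg
  have hgle : ∀ t, g t ≤ (γ1 t + γ2 t) / 2 := by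
    intro t
    obtain ⟨a1, a2⟩ := T1.mem t
    obtain ⟨c1, c2⟩ := T2.mem t
    rcases (add_nonneg a1 c1).eq_or_lt with h | h
    · simp [hg, ← h]
    · simp only [hg]
      rw [← div_eq_mul_inv, ← mul_div_assoc, div_le_div_iff₀ h two_pos]
      nlinarith [sq_nonneg (γ1 t - γ2 t)]
  have hg0' : ∀ t, 0 ≤ g t := by
    intro t
    obtain ⟨a1, a2⟩ := T1.mem t
    obtain ⟨c1, c2⟩ := T2.mem t
    simp only [hg]; positivity
  have hgG : ∀ t, g t ≤ G := by
    intro t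
    obtain ⟨a1, a2⟩ := T1.mem t
    obtain ⟨c1, c2⟩ := T2.mem t
    linarith [hgle t]
  have P1 := T1.prim hk hl hs hG hh1
  have P2 := T2.prim hk hl hs hG hh2
  have P3 := T3.prim hk hl hs hG hAd
  have Pg : Prim g (fun t => rhs k l s (g t) (ht t)) := by
    refine (((P1.mul P2).mul ((P1.add P2).inv ?_)).const_mul 2).congr ?_
    · intro t h
      exact add_pos (p1 t h) (p2 t h)
    · intro t h
      have q1 := (p1 t h.le).ne'
      have q2 := (p2 t h.le).ne'
      have q3 := (add_pos (p1 t h.le) (p2 t h.le)).ne'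
      simp only [hg, hht, rhs]
      field_simp
      ring
  have hp := (Pg.sub P3).congr
    (φ2 := fun t => - ((k + max (ht t) 0) * (g t + γ3 t) + 2 * l) * (g t - γ3 t)
      + ((max (ht t) 0 - ht t) * g t ^ 2)) (fun t _ => by unfold rhs; ring)
  intro t h
  have hm6 := T3.cont.measurable
  have key := linear_ge (w := fun t => g t - γ3 t)
    (a := fun t => (k + max (ht t) 0) * (g t + γ3 t) + 2 * l)
    (C := (k + H) * (G + G) + 2 * l) (by fun_prop) ?_ hp ?_ h
  · have z : g 0 - γ3 0 = 0 := by
      simp only [hg, T1.zero, T2.zero, T3.zero]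
      field_simp; ring
    simp only [z] at key
    have := nonneg_of_mul_nonneg_right key (Real.exp_pos _)
    linarith [hgle t]
  · intro t
    obtain ⟨a1, a2⟩ := T3.mem t
    obtain ⟨b1, b2⟩ := hAd.2 t
    have hH : 0 ≤ H := b1.trans b2
    have := hg0' t
    have := hgG t
    rw [abs_of_nonneg (by positivity)]
    gcongr
  · intro t _
    have : ht t ≤ max (ht t) 0 := le_max_left _ _
    exact mul_nonneg (by linarith) (sq_nonneg _)
end

theorem exp_int {δ C : ℝ} (hδ : 0 < δ) {u : ℝ → ℝ} (hm : Measurable u)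
    (hC : ∀ t, 0 < t → |u t| ≤ C) :
    IntegrableOn (fun t => Real.exp (-δ * t) * u t) (Ioi 0) := by
  have h1 := (exp_neg_integrableOn_Ioi 0 hδ).mul_const C
  refine Integrable.mono' h1 (by fun_prop) ?_
  refine (ae_restrict_iff' measurableSet_Ioi).2 (ae_of_all _ fun t ht => ?_)
  rw [Real.norm_eq_abs, abs_mul, abs_of_pos (Real.exp_pos _)]
  have := hC t ht
  gcongr

theorem exists_lim {δ H : ℝ} (hδ : 0 < δ) (hH : 0 ≤ H) {h : ℕ → ℝ → ℝ} (hh : ∀ n, Ad H (h n))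
    (hc : ∀ ε > 0, ∃ N, ∀ m ≥ N, ∀ n ≥ N,
      ∫ t in Ioi (0:ℝ), Real.exp (-δ * t) * |h m t - h n t| ≤ ε) :
    ∃ hb, Ad H hb ∧ ∃ ns : ℕ → ℕ, StrictMono ns ∧
      ∀ᵐ t ∂(volume.restrict (Ioi (0:ℝ))), Tendsto (fun i => h (ns i) t) atTop (𝓝 (hb t)) := by
  have hi : ∀ n, Integrable (fun t => Real.exp (-δ * t) * h n t) (volume.restrict (Ioi (0:ℝ))) :=
    fun n => exp_int (C := H) hδ (hh n).1 (fun t _ => by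
      rw [abs_of_nonneg ((hh n).2 t).1]; exact ((hh n).2 t).2)
  set F := fun n => (hi n).toL1 with hF
  have hcs : CauchySeq F := by
    rw [Metric.cauchySeq_iff]
    intro ε hε
    obtain ⟨N, hN⟩ := hc (ε / 2) (by positivity)
    refine ⟨N, fun m hm n hn => ?_⟩
    have h1 := hN m hm n hn
    have : dist (F m) (F n) = ∫ t in Ioi (0:ℝ), Real.exp (-δ * t) * |h m t - h n t| := by
      rw [dist_eq_norm, hF, ← Integrable.toL1_sub, L1.norm_of_fun_eq_integral_norm]
      congr 1
      ext t
      rw [Pi.sub_apply, ← mul_sub, Real.norm_eq_abs, abs_mul, abs_of_pos (Real.exp_pos _)]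
    rw [this]; linarith
  obtain ⟨L, hL⟩ := cauchySeq_tendsto_of_complete hcs
  obtain ⟨ns, hns, hae⟩ := (tendstoInMeasure_of_tendsto_Lp hL).exists_seq_tendsto_ae
  have hall : ∀ᵐ t ∂(volume.restrict (Ioi (0:ℝ))), ∀ n, F n t = Real.exp (-δ * t) * h n t :=
    ae_all_iff.2 fun n => (hi n).coeFn_toL1
  have hLm : Measurable L := (Lp.stronglyMeasurable L).measurable
  refine ⟨fun t => max 0 (min H (Real.exp (δ * t) * L t)), ⟨by fun_prop, fun t =>
    ⟨le_max_left _ _, max_le hH (min_le_left _ _)⟩⟩, ns, hns, ?_⟩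
  filter_upwards [hae, hall] with t h1 h2
  simp only [h2] at h1
  have h3 : Tendsto (fun i => max 0 (min H (Real.exp (δ * t) *
      (Real.exp (-δ * t) * h (ns i) t)))) atTop
      (𝓝 (max 0 (min H (Real.exp (δ * t) * L t)))) :=
    tendsto_const_nhds.max (tendsto_const_nhds.min (h1.const_mul _))
  refine h3.congr fun i => ?_
  rw [← mul_assoc, ← Real.exp_add]
  simp [((hh (ns i)).2 t).1, ((hh (ns i)).2 t).2]

/-- midpoint convexity gap -/
noncomputable def gap (c : ℝ → ℝ) (x y : ℝ) : ℝ := (c x + c y) / 2 - c ((x + y) / 2)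

theorem gap_pos {c : ℝ → ℝ} (hsc : StrictConvexOn ℝ (Ici 0) c) {x y : ℝ} (hx : 0 ≤ x)
    (hy : 0 ≤ y) (hxy : x ≠ y) : 0 < gap c x y := by
  have := hsc.2 (mem_Ici.2 hx) (mem_Ici.2 hy) hxy (show (0:ℝ) < 1 / 2 by norm_num)
    (show (0:ℝ) < 1 / 2 by norm_num) (by norm_num)
  simp only [smul_eq_mul] at this
  unfold gap
  rw [show (x + y) / 2 = 1 / 2 * x + 1 / 2 * y by ring]
  linarith

theorem gap_nonneg {c : ℝ → ℝ} (hsc : StrictConvexOn ℝ (Ici 0) c) {x y : ℝ} (hx : 0 ≤ x)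
    (hy : 0 ≤ y) : 0 ≤ gap c x y := by
  by_cases h : x = y
  · subst h; unfold gap; rw [add_self_div_two, add_self_div_two, sub_self]
  · exact (gap_pos hsc hx hy h).le

theorem gap_mod {c : ℝ → ℝ} (hcc : Continuous c) (hsc : StrictConvexOn ℝ (Ici 0) c) {H : ℝ}
    (hH : 0 ≤ H) {ε : ℝ} (hε : 0 < ε) :
    ∃ C, 0 ≤ C ∧ ∀ x ∈ Icc 0 H, ∀ y ∈ Icc 0 H, |x - y| ≤ ε + C * gap c x y := by
  set K : Set (ℝ × ℝ) := (Icc 0 H ×ˢ Icc 0 H) ∩ {p | ε ≤ |p.1 - p.2|} with hK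
  have hKc : IsCompact K := (isCompact_Icc.prod isCompact_Icc).inter_right
    (isClosed_le continuous_const (by fun_prop))
  have hbd : ∀ x ∈ Icc 0 H, ∀ y ∈ Icc 0 H, |x - y| ≤ H := by
    intro x hx y hy
    rw [abs_le]; constructor <;> linarith [hx.1, hx.2, hy.1, hy.2]
  have hm : ∃ m, 0 < m ∧ ∀ p ∈ K, m ≤ gap c p.1 p.2 := by
    rcases K.eq_empty_or_nonempty with h | h
    · exact ⟨1, one_pos, by simp [h]⟩
    · obtain ⟨p, hp, hmin⟩ := hKc.exists_isMinOn (f := fun p : ℝ × ℝ => gap c p.1 p.2) h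
        (by unfold gap; fun_prop)
      refine ⟨gap c p.1 p.2, gap_pos hsc hp.1.1.1 hp.1.2.1 ?_, fun q hq => hmin hq⟩
      intro e
      have := hp.2
      simp only [mem_ofPred_eq, e, sub_self, abs_zero] at this
      linarith
  obtain ⟨m, hm0, hm⟩ := hm
  refine ⟨H / m, by positivity, fun x hx y hy => ?_⟩
  have g0 := gap_nonneg hsc hx.1 hy.1
  rcases lt_or_ge (|x - y|) ε with h | h
  · have : 0 ≤ H / m * gap c x y := by positivity
    linarith
  · have h1 := hm (x, y) ⟨⟨hx, hy⟩, h⟩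
    have h2 : H / m * m ≤ H / m * gap c x y := by simp only at h1; gcongr
    rw [div_mul_cancel₀ _ hm0.ne'] at h2
    linarith [hbd x hx y hy]

theorem argmin {c : ℝ → ℝ} (hcc : Continuous c) (hsc : StrictConvexOn ℝ (Ici 0) c) {H : ℝ}
    (hH : 0 ≤ H) :
    ∃ K : ℝ → ℝ, Continuous K ∧ (∀ m, K m ∈ Icc 0 H) ∧
      ∀ m, ∀ x ∈ Icc 0 H, x ≠ K m → c (K m) - m * K m < c x - m * x := by
  have h1 : ∀ m : ℝ, ∃ z ∈ Icc 0 H, ∀ x ∈ Icc 0 H, c z - m * z ≤ c x - m * x := by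
    intro m
    obtain ⟨z, hz, hmin⟩ := isCompact_Icc.exists_isMinOn (f := fun x => c x - m * x)
      (nonempty_Icc.2 hH) (by fun_prop)
    exact ⟨z, hz, fun x hx => hmin hx⟩
  choose K hK hmin using h1
  have hstrict : ∀ m, ∀ x ∈ Icc 0 H, x ≠ K m → c (K m) - m * K m < c x - m * x := by
    intro m x hx hne
    refine lt_of_le_of_ne (hmin m x hx) fun e => ?_
    have g := gap_pos hsc hx.1 (hK m).1 hne
    have := hmin m ((x + K m) / 2) ⟨by linarith [hx.1, (hK m).1], by linarith [hx.2, (hK m).2]⟩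
    unfold gap at g
    nlinarith
  refine ⟨K, ?_, hK, hstrict⟩
  rw [continuous_iff_continuousAt]
  intro m
  refine isCompact_Icc.tendsto_nhds_of_unique_mapClusterPt (s := Icc 0 H)
    (Eventually.of_forall hK) ?_
  intro x hx hcl
  by_contra hne
  have hlt := hstrict m x hx hne
  -- near `(m, x)` the inequality persists
  have hev : ∀ᶠ p : ℝ × ℝ in 𝓝 (m, x), c (K m) - p.1 * K m < c p.2 - p.1 * p.2 := by
    have : IsOpen {p : ℝ × ℝ | c (K m) - p.1 * K m < c p.2 - p.1 * p.2} :=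
      isOpen_lt (by fun_prop) (by fun_prop)
    exact this.mem_nhds hlt
  rw [nhds_prod_eq] at hev
  obtain ⟨U, hU, V, hV, hUV⟩ := eventually_prod_iff.1 hev
  have hf := hcl.frequently hV
  obtain ⟨n, hn1, hn2⟩ := (hf.and_eventually hU).exists
  have := hUV hn2 hn1
  have := hmin n (K m) (hK m)
  simp only at *
  linarith

theorem cbound {c : ℝ → ℝ} (hcc : Continuous c) (H : ℝ) :
    ∃ C, 0 ≤ C ∧ ∀ x ∈ Icc 0 H, |c x| ≤ C := by
  obtain ⟨C, hC⟩ := isCompact_Icc.exists_bound_of_continuousOn (s := Icc 0 H) hcc.continuousOn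
  exact ⟨max C 0, le_max_right _ _, fun x hx => (hC x hx).trans (le_max_left _ _)⟩

/-- the cost functional -/
noncomputable def Jf (δ ab : ℝ) (c γ h : ℝ → ℝ) : ℝ :=
  ∫ t in Ioi (0:ℝ), Real.exp (-δ * t) * (ab * γ t + c (h t))

section
variable {k l s G H g0 δ ab : ℝ} (hk : 0 ≤ k) (hl : 0 ≤ l) (hs : 0 ≤ s) (hg0 : 0 < g0)
  (hG : 0 ≤ G) (hH : 0 ≤ H) (hδ : 0 < δ) (hab : 0 < ab) {c : ℝ → ℝ} (hcc : Continuous c)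
  (hmono : MonotoneOn c (Ici 0)) (hsc : StrictConvexOn ℝ (Ici 0) c)

include hδ hab hcc in
theorem J_int {h γ : ℝ → ℝ} (T : Traj k l s G g0 h γ) (hh : Ad H h) :
    IntegrableOn (fun t => Real.exp (-δ * t) * (ab * γ t + c (h t))) (Ioi 0) := by
  obtain ⟨C, hC0, hC⟩ := cbound hcc H
  have hm1 := hh.1
  have hm2 := T.cont.measurable
  have hm3 := hcc.measurable
  refine exp_int (C := ab * G + C) hδ (by fun_prop) fun t _ => ?_
  refine (abs_add_le _ _).trans (add_le_add ?_ (hC _ (hh.2 t)))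
  rw [abs_of_nonneg (mul_nonneg hab.le (T.mem t).1)]
  have := (T.mem t).2
  gcongr

include hδ hcc in
theorem gap_int {h1 h2 : ℝ → ℝ} (hh1 : Ad H h1) (hh2 : Ad H h2) :
    IntegrableOn (fun t => Real.exp (-δ * t) * gap c (h1 t) (h2 t)) (Ioi 0) := by
  obtain ⟨C, hC0, hC⟩ := cbound hcc H
  have hm1 := hh1.1
  have hm2 := hh2.1
  have hm3 := hcc.measurable
  refine exp_int (C := 2 * C) hδ (by unfold gap; fun_prop) fun t _ => ?_
  have b1 := abs_le.1 (hC _ (hh1.2 t))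
  have b2 := abs_le.1 (hC _ (hh2.2 t))
  have b3 := abs_le.1 (hC ((h1 t + h2 t) / 2)
    ⟨by linarith [(hh1.2 t).1, (hh2.2 t).1], by linarith [(hh1.2 t).2, (hh2.2 t).2]⟩)
  unfold gap
  rw [abs_le]; constructor <;> linarith

include hk hl hs hG hg0 hδ hab hcc hmono in
/-- Key inequality. -/
theorem key {h1 γ1 h2 γ2 : ℝ → ℝ} (T1 : Traj k l s G g0 h1 γ1) (hh1 : Ad H h1)
    (T2 : Traj k l s G g0 h2 γ2) (hh2 : Ad H h2) :
    ∃ h3, Ad H h3 ∧ ∀ γ3, Traj k l s G g0 h3 γ3 →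
      Jf δ ab c γ3 h3 + ∫ t in Ioi (0:ℝ), Real.exp (-δ * t) * gap c (h1 t) (h2 t)
        ≤ (Jf δ ab c γ1 h1 + Jf δ ab c γ2 h2) / 2 := by
  obtain ⟨h3, hh3, hle, H3⟩ := T1.convex hk hl hs hg0 hG hh1 T2 hh2
  refine ⟨h3, hh3, fun γ3 T3 => ?_⟩
  have i1 := J_int hδ hab hcc T1 hh1
  have i2 := J_int hδ hab hcc T2 hh2
  have i3 := J_int hδ hab hcc T3 hh3
  have ig := gap_int hδ hcc hh1 hh2
  unfold Jf
  rw [← integral_add i3 ig, ← integral_add i1 i2, ← integral_div]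
  refine setIntegral_mono_on (i3.add ig) ((i1.add i2).div_const 2) measurableSet_Ioi ?_
  intro t ht
  have ht : 0 < t := ht
  have e1 := H3 γ3 T3 t ht.le
  have e2 : c (h3 t) ≤ c ((h1 t + h2 t) / 2) :=
    hmono (hh3.2 t).1 (by rw [mem_Ici]; linarith [(hh1.2 t).1, (hh2.2 t).1]) (hle t)
  have e3 : ab * γ3 t ≤ ab * ((γ1 t + γ2 t) / 2) := by gcongr
  have e4 : ab * γ3 t + c (h3 t) + gap c (h1 t) (h2 t)
    ≤ (ab * γ1 t + c (h1 t) + (ab * γ2 t + c (h2 t))) / 2 := by unfold gap; linarith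
  have := mul_le_mul_of_nonneg_left e4 (Real.exp_pos (-δ * t)).le
  linarith

variable {S : (ℝ → ℝ) → ℝ → ℝ} (hS : ∀ h, Ad H h → Traj k l s G g0 h (S h))

include hk hl hs hG hg0 hδ hab hcc hmono hsc hS in
/-- a.e. uniqueness -/
theorem ae_unique {h1 h2 : ℝ → ℝ} (hh1 : Ad H h1) (hh2 : Ad H h2)
    (o1 : ∀ h, Ad H h → Jf δ ab c (S h1) h1 ≤ Jf δ ab c (S h) h)
    (o2 : Jf δ ab c (S h2) h2 ≤ Jf δ ab c (S h1) h1) :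
    h2 =ᵐ[volume.restrict (Ioi (0:ℝ))] h1 := by
  obtain ⟨h3, hh3, H3⟩ := key hk hl hs hg0 hG hδ hab hcc hmono (hS h1 hh1) hh1 (hS h2 hh2) hh2
  have e := H3 _ (hS h3 hh3)
  have e2 := o1 h3 hh3
  have ig := gap_int hδ hcc hh1 hh2
  have hnn : ∀ t, 0 ≤ Real.exp (-δ * t) * gap c (h1 t) (h2 t) := fun t =>
    mul_nonneg (Real.exp_pos _).le (gap_nonneg hsc (hh1.2 t).1 (hh2.2 t).1)
  have hz : ∫ t in Ioi (0:ℝ), Real.exp (-δ * t) * gap c (h1 t) (h2 t) = 0 :=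
    le_antisymm (by linarith) (integral_nonneg hnn)
  rw [integral_eq_zero_iff_of_nonneg hnn ig] at hz
  filter_upwards [hz] with t ht
  by_contra hne
  have := gap_pos hsc (hh1.2 t).1 (hh2.2 t).1 (Ne.symm hne)
  have := mul_pos (Real.exp_pos (-δ * t)) this
  simp only [Pi.zero_apply] at ht
  linarith

include hk hl hs hG hδ hab hcc hS in
theorem J_lim {h : ℕ → ℝ → ℝ} {hb : ℝ → ℝ} (hh : ∀ n, Ad H (h n)) (hhb : Ad H hb)
    (hae : ∀ᵐ t ∂(volume.restrict (Ioi (0:ℝ))), Tendsto (fun i => h i t) atTop (𝓝 (hb t))) :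
    Tendsto (fun n => Jf δ ab c (S (h n)) (h n)) atTop (𝓝 (Jf δ ab c (S hb) hb)) := by
  obtain ⟨C, hC0, hC⟩ := cbound hcc H
  have hγ : ∀ t, 0 ≤ t → Tendsto (fun n => S (h n) t) atTop (𝓝 (S hb t)) := by
    intro t ht
    rw [tendsto_iff_dist_tendsto_zero]
    have hd : Tendsto (fun n => ∫ u in (0:ℝ)..t, G ^ 2 * |h n u - hb u|) atTop
        (𝓝 (∫ u in (0:ℝ)..t, (0:ℝ))) := by
      refine intervalIntegral.tendsto_integral_filter_of_dominated_convergence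
        (fun _ => G ^ 2 * H) ?_ ?_ ?_ ?_
      · refine Eventually.of_forall fun n => ?_
        have := (hh n).1
        have := hhb.1
        simp only [← Real.norm_eq_abs]
        exact Measurable.aestronglyMeasurable (by fun_prop)
      · refine Eventually.of_forall fun n => ae_of_all _ fun u _ => ?_
        rw [Real.norm_eq_abs, abs_of_nonneg (by positivity)]
        gcongr
        have a := (hh n).2 u
        have b := hhb.2 u
        rw [abs_le]; constructor <;> linarith [a.1, a.2, b.1, b.2]
      · exact intervalIntegrable_const
      · have := (ae_restrict_iff' measurableSet_Ioi).1 hae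
        filter_upwards [this] with u hu hu2
        rw [uIoc_of_le ht] at hu2
        have h1 := ((hu hu2.1).sub_const (hb u)).abs.const_mul (G ^ 2)
        simpa using h1
    rw [intervalIntegral.integral_zero] at hd
    refine squeeze_zero (fun _ => dist_nonneg) (fun n => ?_) hd
    rw [Real.dist_eq]
    exact (hS _ (hh n)).diff hk hl hs hG (hh n) (hS _ hhb) hhb ht
  refine tendsto_integral_of_dominated_convergence
    (fun t => Real.exp (-δ * t) * (ab * G + C)) ?_ ?_ ?_ ?_
  · intro n
    exact (J_int hδ hab hcc (hS _ (hh n)) (hh n)).1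
  · exact exp_int (C := |ab * G + C|) hδ measurable_const fun t _ => le_rfl
  · intro n
    refine ae_of_all _ fun t => ?_
    rw [Real.norm_eq_abs, abs_mul, abs_of_pos (Real.exp_pos _)]
    gcongr
    refine (abs_add_le _ _).trans (add_le_add ?_ (hC _ ((hh n).2 t)))
    have := (hS _ (hh n)).mem t
    rw [abs_of_nonneg (mul_nonneg hab.le this.1)]
    have := this.2
    gcongr
  · have h0 : ∀ᵐ t ∂(volume.restrict (Ioi (0:ℝ))), 0 < t :=
      ae_restrict_mem measurableSet_Ioi
    filter_upwards [hae, h0] with t h1 h2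
    exact (((hγ t h2.le).const_mul ab).add ((hcc.tendsto _).comp h1)).const_mul _

include hk hl hs hG hg0 hH hδ hab hcc hmono hsc hS in
theorem exists_opt : ∃ hb, Ad H hb ∧ ∀ h, Ad H h → Jf δ ab c (S hb) hb ≤ Jf δ ab c (S h) h := by
  set V : Set ℝ := (fun h => Jf δ ab c (S h) h) '' {h | Ad H h} with hV
  have hne : V.Nonempty := ⟨_, _, (⟨measurable_const, fun _ => ⟨le_rfl, hH⟩⟩ : Ad H fun _ => 0), rfl⟩
  obtain ⟨C, hC0, hC⟩ := cbound hcc H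
  have hbdd : BddBelow V := by
    refine ⟨∫ t in Ioi (0:ℝ), Real.exp (-δ * t) * (-C), ?_⟩
    rintro _ ⟨h, hh, rfl⟩
    have hh : Ad H h := hh
    refine setIntegral_mono_on (exp_int (C := |-C|) hδ measurable_const fun t _ => le_rfl)
      (J_int hδ hab hcc (hS h hh) hh) measurableSet_Ioi ?_
    intro t _
    gcongr
    have := mul_nonneg hab.le ((hS h hh).mem t).1
    linarith [(abs_le.1 (hC _ (hh.2 t))).1]
  set v := sInf V with hv
  have hvle : ∀ h, Ad H h → v ≤ Jf δ ab c (S h) h := fun h hh => csInf_le hbdd ⟨h, hh, rfl⟩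
  obtain ⟨u, -, hu, huV⟩ := exists_seq_tendsto_sInf hne hbdd
  choose h hh hJ using huV
  have hh : ∀ n, Ad H (h n) := hh
  have hJ : ∀ n, Jf δ ab c (S (h n)) (h n) = u n := hJ
  have hcauchy : ∀ ε > 0, ∃ N, ∀ m ≥ N, ∀ n ≥ N,
      ∫ t in Ioi (0:ℝ), Real.exp (-δ * t) * |h m t - h n t| ≤ ε := by
    intro ε hε
    set I := ∫ t in Ioi (0:ℝ), Real.exp (-δ * t) with hI
    have hI0 : 0 ≤ I := integral_nonneg fun t => (Real.exp_pos _).le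
    set ε1 := ε / (2 * (I + 1)) with hε1
    have hε1p : 0 < ε1 := by positivity
    obtain ⟨K, hK0, hK⟩ := gap_mod hcc hsc hH hε1p
    set ε2 := ε / (2 * (K + 1)) with hε2
    have hε2p : 0 < ε2 := by positivity
    obtain ⟨N, hN⟩ := eventually_atTop.1 (hu.eventually (gt_mem_nhds (show v < v + ε2 by linarith)))
    refine ⟨N, fun m hm n hn => ?_⟩
    obtain ⟨h3, hh3, H3⟩ := key hk hl hs hg0 hG hδ hab hcc hmono (hS _ (hh m)) (hh m)
      (hS _ (hh n)) (hh n)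
    have e := H3 _ (hS h3 hh3)
    have e2 := hvle h3 hh3
    have e3 := hN m hm
    have e4 := hN n hn
    rw [hJ, hJ] at e
    have ig := gap_int hδ hcc (hh m) (hh n)
    have hgle : ∫ t in Ioi (0:ℝ), Real.exp (-δ * t) * gap c (h m t) (h n t) ≤ ε2 := by linarith
    have iexp : IntegrableOn (fun t => Real.exp (-δ * t)) (Ioi 0) := exp_neg_integrableOn_Ioi 0 hδ
    have step : ∫ t in Ioi (0:ℝ), Real.exp (-δ * t) * |h m t - h n t|
        ≤ ∫ t in Ioi (0:ℝ), (ε1 * Real.exp (-δ * t)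
          + K * (Real.exp (-δ * t) * gap c (h m t) (h n t))) := by
      refine integral_mono_of_nonneg (ae_of_all _ fun t => by positivity)
        ((iexp.const_mul ε1).add (ig.const_mul K)) (ae_of_all _ fun t => ?_)
      have := mul_le_mul_of_nonneg_left (hK _ ((hh m).2 t) _ ((hh n).2 t))
        (Real.exp_pos (-δ * t)).le
      simp only
      linarith
    rw [integral_add (iexp.const_mul ε1) (ig.const_mul K), integral_const_mul,
      integral_const_mul] at step
    have f1 : ε1 * I ≤ ε / 2 := by
      rw [hε1, div_mul_eq_mul_div, div_le_div_iff₀ (by positivity) two_pos]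
      nlinarith
    have f2 : K * ε2 ≤ ε / 2 := by
      rw [hε2, mul_div_assoc', div_le_div_iff₀ (by positivity) two_pos]
      nlinarith
    have f3 := mul_le_mul_of_nonneg_left hgle hK0
    linarith
  obtain ⟨hb, hhb, ns, hns, hae⟩ := exists_lim hδ hH hh hcauchy
  have hlim := J_lim hk hl hs hG hδ hab hcc hS (fun n => hh (ns n)) hhb hae
  have hlim2 : Tendsto (fun n => Jf δ ab c (S (h (ns n))) (h (ns n))) atTop (𝓝 v) := by
    simp only [hJ]
    exact hu.comp hns.tendsto_atTop
  have := tendsto_nhds_unique hlim hlim2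
  exact ⟨hb, hhb, fun h hh => this ▸ hvle h hh⟩

include hk hl hs hG hH hδ hab in
/-- The adjoint function. -/
theorem adjoint {h γ : ℝ → ℝ} (T : Traj k l s G g0 h γ) (hh : Ad H h) :
    ∃ N : ℝ → ℝ, Continuous N ∧ (∀ t, 0 ≤ t → 0 ≤ N t ∧ N t ≤ ab / δ * Real.exp (-δ * t)) ∧
      Prim N (fun t => (2 * (k + h t) * γ t + 2 * l) * N t - ab * Real.exp (-δ * t)) := by
  set a : ℝ → ℝ := fun t => 2 * (k + h t) * γ t + 2 * l with ha
  have hm1 := hh.1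
  have hm2 := T.cont.measurable
  have hma : Measurable a := by fun_prop
  have ha0 : ∀ t, 0 ≤ a t := by
    intro t
    have := (T.mem t).1
    have := (hh.2 t).1
    positivity
  have haC : ∀ t, |a t| ≤ 2 * (k + H) * G + 2 * l := by
    intro t
    rw [abs_of_nonneg (ha0 t)]
    have := T.mem t
    have := hh.2 t
    have h1 := this.1
    have h2 := this.2
    have h3 := (T.mem t).1
    have h4 := (T.mem t).2
    simp only [ha]
    gcongr
  set A : ℝ → ℝ := fun t => ∫ u in (0:ℝ)..t, a u with hA
  have hAc : Continuous A := intervalIntegral.continuous_primitive (intable hma haC) 0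
  have hAm : ∀ x y, x ≤ y → A x ≤ A y := by
    intro x y hxy
    have e : A y - A x = ∫ u in x..y, a u :=
      intervalIntegral.integral_interval_sub_left (intable hma haC _ _) (intable hma haC _ _)
    have h2 : 0 ≤ ∫ u in x..y, a u := intervalIntegral.integral_nonneg hxy (fun u _ => ha0 u)
    linarith
  have hA0 : A 0 = 0 := by simp [hA]
  set q : ℝ → ℝ := fun t => Real.exp (-δ * max t 0) * Real.exp (-A (max t 0)) with hq
  have hqc : Continuous q := by fun_prop
  have hq0 : ∀ t, 0 < q t := fun t => by positivity
  have hq1 : ∀ t, q t ≤ 1 := by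
    intro t
    have h1 : 0 ≤ max t 0 := le_max_right _ _
    have h2 : 0 ≤ A (max t 0) := by linarith [hAm 0 _ h1]
    have h3 : Real.exp (-δ * max t 0) ≤ 1 := Real.exp_le_one_iff.2 (by nlinarith)
    have h4 : Real.exp (-A (max t 0)) ≤ 1 := Real.exp_le_one_iff.2 (by linarith)
    exact mul_le_one₀ h3 (Real.exp_pos _).le h4
  have hqe : ∀ x, 0 ≤ x → ∀ t, x ≤ t → q t ≤ Real.exp (-A x) * Real.exp (-δ * t) := by
    intro x hx t ht
    simp only [hq, max_eq_left (hx.trans ht)]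
    rw [mul_comm]
    have := hAm x t ht
    gcongr
  have hqi : ∀ x, 0 ≤ x → IntegrableOn q (Ioi x) := by
    intro x hx
    refine Integrable.mono' ((exp_neg_integrableOn_Ioi x hδ).const_mul (Real.exp (-A x)))
      hqc.aestronglyMeasurable ?_
    refine (ae_restrict_iff' measurableSet_Ioi).2 (ae_of_all _ fun t ht => ?_)
    rw [Real.norm_eq_abs, abs_of_pos (hq0 t)]
    exact hqe x hx t (le_of_lt ht)
  have hqii : ∀ x y, IntervalIntegrable q volume x y := fun x y => hqc.intervalIntegrable x y
  set R : ℝ → ℝ := fun x => (∫ t in Ioi (0:ℝ), q t) + ∫ t in (0:ℝ)..x, -q t with hR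
  have hRe : ∀ x, 0 ≤ x → R x = ∫ t in Ioi x, q t := by
    intro x hx
    have := intervalIntegral.integral_interval_add_Ioi (hqi 0 le_rfl) (hqi x hx)
    simp only [hR, intervalIntegral.integral_neg]
    linarith
  have hRP : Prim R (fun t => - q t) :=
    Prim.of_integral (C := 1) (w0 := ∫ t in Ioi (0:ℝ), q t) (by fun_prop)
      (fun t => by rw [abs_neg, abs_of_pos (hq0 t)]; exact hq1 t) (fun t _ => rfl)
  have hRc : Continuous R := continuous_const.add
    (intervalIntegral.continuous_primitive (fun x y => (hqii x y).neg) 0)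
  refine ⟨fun t => ab * (Real.exp (A t) * R t), by fun_prop, ?_, ?_⟩
  · intro x hx
    have r0 : 0 ≤ R x := by
      rw [hRe x hx]
      exact integral_nonneg fun t => (hq0 t).le
    have r1 : R x ≤ Real.exp (-A x) * (Real.exp (-δ * x) / δ) := by
      rw [hRe x hx]
      calc ∫ t in Ioi x, q t ≤ ∫ t in Ioi x, Real.exp (-A x) * Real.exp (-δ * t) :=
            setIntegral_mono_on (hqi x hx)
              ((exp_neg_integrableOn_Ioi x hδ).const_mul (Real.exp (-A x))) measurableSet_Ioi
              (fun t ht => hqe x hx t (le_of_lt ht))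
        _ = _ := by
            rw [integral_const_mul, integral_exp_mul_Ioi (by linarith) x]
            rw [neg_div_neg_eq]
    refine ⟨by positivity, ?_⟩
    calc ab * (Real.exp (A x) * R x)
        ≤ ab * (Real.exp (A x) * (Real.exp (-A x) * (Real.exp (-δ * x) / δ))) := by gcongr
      _ = ab * ((Real.exp (A x) * Real.exp (-A x)) * (Real.exp (-δ * x) / δ)) := by ring
      _ = _ := by rw [← Real.exp_add, add_neg_cancel, Real.exp_zero]; ring
  · refine (((Prim.integral hma haC).exp.mul hRP).const_mul ab).congr fun t ht => ?_
    simp only [hq, max_eq_left ht.le]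
    have : Real.exp (A t) * Real.exp (-A t) = 1 := by
      rw [← Real.exp_add, add_neg_cancel, Real.exp_zero]
    change ab * (Real.exp (A t) * a t * R t + Real.exp (A t) *
      -(Real.exp (-δ * t) * Real.exp (-A t))) = a t * (ab * (Real.exp (A t) * R t))
        - ab * Real.exp (-δ * t)
    linear_combination (-ab * Real.exp (-δ * t)) * this

include hk hl hs hG hH hδ hab hcc hsc hS in
theorem variation {hb kk N : ℝ → ℝ} (hhb : Ad H hb) (hkk : Ad H kk) (hNc : Continuous N)
    (hNb : ∀ t, 0 ≤ t → 0 ≤ N t ∧ N t ≤ ab / δ * Real.exp (-δ * t))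
    (hNP : Prim N (fun t => (2 * (k + hb t) * S hb t + 2 * l) * N t - ab * Real.exp (-δ * t)))
    (hopt : ∀ h, Ad H h → Jf δ ab c (S hb) hb ≤ Jf δ ab c (S h) h) :
    IntegrableOn (fun t => Real.exp (-δ * t) * (c (kk t) - c (hb t))
      - N t * S hb t ^ 2 * (kk t - hb t)) (Ioi 0) ∧
    0 ≤ ∫ t in Ioi (0:ℝ), (Real.exp (-δ * t) * (c (kk t) - c (hb t))
      - N t * S hb t ^ 2 * (kk t - hb t)) := by
  obtain ⟨C, hC0, hC⟩ := cbound hcc H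
  have T := hS hb hhb
  set γ := S hb with hγ
  have hm1 := hhb.1
  have hm2 := hkk.1
  have hm3 := hcc.measurable
  have hm4 := T.cont.measurable
  have hm5 := hNc.measurable
  have hee : ∀ t, Real.exp (-δ * t) * Real.exp (δ * t) = 1 := by
    intro t; rw [← Real.exp_add]; simp
  have hNe : ∀ t, 0 ≤ t → |Real.exp (δ * t) * N t| ≤ ab / δ := by
    intro t ht
    obtain ⟨n1, n2⟩ := hNb t ht
    rw [abs_of_nonneg (by positivity)]
    calc Real.exp (δ * t) * N t ≤ Real.exp (δ * t) * (ab / δ * Real.exp (-δ * t)) := by gcongr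
      _ = ab / δ * (Real.exp (-δ * t) * Real.exp (δ * t)) := by ring
      _ = _ := by rw [hee, mul_one]
  have hDb : ∀ t, |kk t - hb t| ≤ H := by
    intro t
    have a := hhb.2 t
    have b := hkk.2 t
    rw [abs_le]; constructor <;> linarith [a.1, a.2, b.1, b.2]
  have hg2 : ∀ t, |γ t ^ 2| ≤ G ^ 2 := by
    intro t
    rw [abs_of_nonneg (sq_nonneg _)]
    have h3 := (T.mem t).1
    have h4 := (T.mem t).2
    gcongr
  have i1 : IntegrableOn (fun t => Real.exp (-δ * t) * (c (kk t) - c (hb t))) (Ioi 0) := by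
    refine exp_int (C := 2 * C) hδ (by fun_prop) fun t _ => ?_
    have b1 := abs_le.1 (hC _ (hhb.2 t))
    have b2 := abs_le.1 (hC _ (hkk.2 t))
    rw [abs_le]; constructor <;> linarith
  have i2 : IntegrableOn (fun t => N t * γ t ^ 2 * (kk t - hb t)) (Ioi 0) := by
    have : (fun t => N t * γ t ^ 2 * (kk t - hb t)) = fun t => Real.exp (-δ * t) *
        (Real.exp (δ * t) * N t * γ t ^ 2 * (kk t - hb t)) := by
      ext t
      linear_combination (- N t * γ t ^ 2 * (kk t - hb t)) * hee t
    rw [this]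
    refine exp_int (C := ab / δ * G ^ 2 * H) hδ (by fun_prop) fun t ht => ?_
    rw [abs_mul, abs_mul]
    have := hNe t ht.le
    have := hg2 t
    have := hDb t
    gcongr
  refine ⟨i1.sub i2, ?_⟩
  set ψ : ℝ → ℝ := fun t => Real.exp (-δ * t) * (c (kk t) - c (hb t))
      - N t * γ t ^ 2 * (kk t - hb t) with hψ
  have iψ : IntegrableOn ψ (Ioi 0) := i1.sub i2
  set B1 : ℝ := G ^ 2 * H * (4 / δ) with hB1
  set B2 : ℝ := (k + H) * B1 ^ 2 + 2 * H * G * B1 with hB2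
  set B3 : ℝ := ab / δ * B2 with hB3
  set I2 : ℝ := ∫ t in Ioi (0:ℝ), Real.exp (-(δ / 2) * t) with hI2
  have iexp : IntegrableOn (fun t => Real.exp (-(δ / 2) * t)) (Ioi 0) :=
    exp_neg_integrableOn_Ioi 0 (half_pos hδ)
  have hB1p : 0 ≤ B1 := by positivity
  have hB2p : 0 ≤ B2 := by positivity
  have main : ∀ ε : ℝ, 0 < ε → ε ≤ 1 → 0 ≤ ε * (∫ t in Ioi (0:ℝ), ψ t) + ε ^ 2 * B3 * I2 := by
    intro ε hε0 hε1
    set he : ℝ → ℝ := fun t => hb t + ε * (kk t - hb t) with hhe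
    have hhe' : Ad H he := by
      refine ⟨by fun_prop, fun t => ?_⟩
      have a := hhb.2 t
      have b := hkk.2 t
      have : he t = (1 - ε) * hb t + ε * kk t := by simp only [hhe]; ring
      rw [this]
      have e0 : 0 ≤ 1 - ε := by linarith
      constructor
      · have := a.1
        have := b.1
        positivity
      · nlinarith [a.2, b.2]
    have Te := hS he hhe'
    set γe := S he with hγe
    have hm6 := hhe'.1
    have hm7 := Te.cont.measurable
    set w : ℝ → ℝ := fun t => γe t - γ t with hw
    have hwm : Measurable w := by fun_prop
    have hwb : ∀ t, 0 ≤ t → |w t| ≤ ε * B1 * Real.exp (δ / 4 * t) := by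
      intro t ht
      have h1 := Te.diff hk hl hs hG hhe' T hhb ht
      have h2 : ∫ u in (0:ℝ)..t, G ^ 2 * |he u - hb u| ≤ ∫ u in (0:ℝ)..t, G ^ 2 * (ε * H) := by
        refine intervalIntegral.integral_mono_on ht ?_ intervalIntegrable_const ?_
        · refine intable (C := G ^ 2 * H) ?_ ?_ 0 t
          · simp only [← Real.norm_eq_abs]; fun_prop
          · intro u
            rw [abs_of_nonneg (by positivity)]
            gcongr
            have a := hhb.2 u
            have b := hhe'.2 u
            rw [abs_le]; constructor <;> linarith [a.1, a.2, b.1, b.2]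
        · intro u _
          gcongr
          simp only [hhe, add_sub_cancel_left]
          rw [abs_mul, abs_of_pos hε0]
          have := hDb u
          gcongr
      have h3 : δ / 4 * t ≤ Real.exp (δ / 4 * t) := by
        linarith [Real.add_one_le_exp (δ / 4 * t)]
      have h4 : ∫ u in (0:ℝ)..t, G ^ 2 * (ε * H) = ε * B1 * (δ / 4 * t) := by
        rw [intervalIntegral.integral_const, hB1]
        simp only [sub_zero, smul_eq_mul]
        field_simp
      calc |w t| ≤ ε * B1 * (δ / 4 * t) := by rw [← h4]; exact h1.trans h2
        _ ≤ _ := by gcongr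
    set r : ℝ → ℝ := fun t => -(k + he t) * w t ^ 2 - 2 * (ε * (kk t - hb t)) * γ t * w t with hr
    have hrb : ∀ t, 0 ≤ t → |r t| ≤ ε ^ 2 * B2 * Real.exp (δ / 2 * t) := by
      intro t ht
      have w1 := hwb t ht
      have x1 : Real.exp (δ / 4 * t) ^ 2 = Real.exp (δ / 2 * t) := by
        rw [← Real.exp_nat_mul]; congr 1; push_cast; ring
      have x2 : Real.exp (δ / 4 * t) ≤ Real.exp (δ / 2 * t) :=
        Real.exp_le_exp.2 (by nlinarith)
      have w2 : w t ^ 2 ≤ (ε * B1) ^ 2 * Real.exp (δ / 2 * t) := by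
        rw [← sq_abs, ← x1, ← mul_pow]
        gcongr
      have w3 : |w t| ≤ ε * B1 * Real.exp (δ / 2 * t) := w1.trans (by gcongr)
      have a := hhe'.2 t
      have a1 := a.1
      have a2 := a.2
      have d1 := hDb t
      have g1 := (T.mem t).1
      have g2 := (T.mem t).2
      calc |r t| ≤ |-(k + he t) * w t ^ 2| + |2 * (ε * (kk t - hb t)) * γ t * w t| := abs_sub _ _
        _ = (k + he t) * w t ^ 2 + 2 * (ε * |kk t - hb t|) * γ t * |w t| := by
            rw [abs_mul, abs_neg, abs_of_nonneg (show 0 ≤ k + he t by linarith),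
              abs_of_nonneg (sq_nonneg _), abs_mul, abs_mul, abs_mul, abs_mul, abs_of_pos hε0,
              abs_of_nonneg g1, abs_two]
        _ ≤ (k + H) * ((ε * B1) ^ 2 * Real.exp (δ / 2 * t))
            + 2 * (ε * H) * G * (ε * B1 * Real.exp (δ / 2 * t)) := by gcongr
        _ = _ := by rw [hB2]; ring
    have hNr : ∀ t, 0 ≤ t → |N t * r t| ≤ ε ^ 2 * B3 * Real.exp (-(δ / 2) * t) := by
      intro t ht
      obtain ⟨n1, n2⟩ := hNb t ht
      rw [abs_mul, abs_of_nonneg n1]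
      have e1 : Real.exp (-(δ / 2) * t) = Real.exp (-δ * t) * Real.exp (δ / 2 * t) := by
        rw [← Real.exp_add]; congr 1; ring
      calc N t * |r t| ≤ (ab / δ * Real.exp (-δ * t)) * (ε ^ 2 * B2 * Real.exp (δ / 2 * t)) := by
            have := hrb t ht
            gcongr
        _ = _ := by rw [hB3, e1]; ring
    have hrm : Measurable r := by fun_prop
    have iNr : IntegrableOn (fun t => N t * r t) (Ioi 0) := by
      refine Integrable.mono' (iexp.const_mul (ε ^ 2 * B3)) (by fun_prop) ?_
      refine (ae_restrict_iff' measurableSet_Ioi).2 (ae_of_all _ fun t ht => ?_)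
      exact hNr t (le_of_lt ht)
    have hwG : ∀ t, |w t| ≤ G := by
      intro t
      have a := T.mem t
      have b := Te.mem t
      rw [abs_le]; simp only [hw]; constructor <;> linarith [a.1, a.2, b.1, b.2]
    have iw : IntegrableOn (fun t => Real.exp (-δ * t) * (ab * w t)) (Ioi 0) := by
      refine exp_int (C := ab * G) hδ (by fun_prop) fun t _ => ?_
      rw [abs_mul, abs_of_pos hab]
      have := hwG t
      gcongr
    set Φ : ℝ → ℝ := fun t => N t * r t - Real.exp (-δ * t) * (ab * w t)
      - ε * (N t * γ t ^ 2 * (kk t - hb t)) with hΦ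
    have iΦ : IntegrableOn Φ (Ioi 0) := (iNr.sub iw).sub (i2.const_mul ε)
    have PΦ : Prim (fun t => N t * w t) Φ := by
      refine (hNP.mul ((Te.prim hk hl hs hG hhe').sub (T.prim hk hl hs hG hhb))).congr
        fun t _ => ?_
      simp only [hΦ, hr, hw, hhe, rhs]
      ring
    have zΦ : ∫ t in Ioi (0:ℝ), Φ t = 0 := by
      have t1 := intervalIntegral_tendsto_integral_Ioi 0 iΦ tendsto_id
      have t2 : Tendsto (fun x : ℝ => ∫ t in (0:ℝ)..x, Φ t) atTop (𝓝 0) := by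
        have hz : Tendsto (fun x : ℝ => ab / δ * Real.exp (-δ * x) * G) atTop (𝓝 0) := by
          have : Tendsto (fun x : ℝ => Real.exp (-δ * x)) atTop (𝓝 0) := by
            refine Real.tendsto_exp_atBot.comp ?_
            exact tendsto_id.const_mul_atTop_of_neg (by linarith)
          simpa using (this.const_mul (ab / δ)).mul_const G
        refine squeeze_zero_norm' ?_ hz
        filter_upwards [eventually_ge_atTop 0] with x hx
        have f := PΦ.ftc hx
        have w0 : w 0 = 0 := by simp only [hw, Te.zero, T.zero, sub_self]
        rw [w0, mul_zero, zero_add] at f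
        rw [← f, Real.norm_eq_abs, abs_mul]
        obtain ⟨n1, n2⟩ := hNb x hx
        rw [abs_of_nonneg n1]
        have := hwG x
        gcongr
      exact tendsto_nhds_unique t1 t2
    have j1 := J_int hδ hab hcc Te hhe'
    have j2 := J_int hδ hab hcc T hhb
    have o : 0 ≤ Jf δ ab c γe he - Jf δ ab c γ hb := by linarith [hopt he hhe']
    unfold Jf at o
    rw [← integral_sub j1 j2] at o
    have fin : ∫ t in Ioi (0:ℝ), (Real.exp (-δ * t) * (ab * γe t + c (he t))
          - Real.exp (-δ * t) * (ab * γ t + c (hb t)))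
        ≤ ∫ t in Ioi (0:ℝ), (ε * ψ t + ε ^ 2 * B3 * Real.exp (-(δ / 2) * t) - Φ t) := by
      refine setIntegral_mono_on (j1.sub j2)
        (((iψ.const_mul ε).add (iexp.const_mul (ε ^ 2 * B3))).sub iΦ) measurableSet_Ioi ?_
      intro t ht
      have ht : 0 < t := ht
      have n1 := (abs_le.1 (hNr t ht.le)).2
      have cv : c (he t) ≤ (1 - ε) * c (hb t) + ε * c (kk t) := by
        have := hsc.convexOn.2 (mem_Ici.2 (hhb.2 t).1) (mem_Ici.2 (hkk.2 t).1)
          (show 0 ≤ 1 - ε by linarith) hε0.le (by ring)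
        simp only [smul_eq_mul] at this
        rw [show he t = (1 - ε) * hb t + ε * kk t by simp only [hhe]; ring]
        exact this
      have cv2 := mul_le_mul_of_nonneg_left cv (Real.exp_pos (-δ * t)).le
      simp only [hψ, hΦ, hw]
      linarith
    have isum : IntegrableOn (fun t => ε * ψ t + ε ^ 2 * B3 * Real.exp (-(δ / 2) * t)) (Ioi 0) :=
      (iψ.const_mul ε).add (iexp.const_mul (ε ^ 2 * B3))
    rw [integral_sub isum iΦ,
      integral_add (iψ.const_mul ε) (iexp.const_mul (ε ^ 2 * B3)), zΦ,
      integral_const_mul, integral_const_mul] at fin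
    linarith
  set P := ∫ t in Ioi (0:ℝ), ψ t with hP
  have hI0 : 0 ≤ I2 := integral_nonneg fun t => (Real.exp_pos _).le
  have hB3p : 0 ≤ B3 := by positivity
  by_contra hneg
  have hneg : P < 0 := not_le.1 hneg
  set M := B3 * I2 + 1 with hM
  have hMp : 0 < M := by positivity
  have hML : B3 * I2 < M := by linarith
  set ε := min 1 (-P / M) with hε
  have ε0 : 0 < ε := lt_min one_pos (div_pos (by linarith) hMp)
  have e1 := main ε ε0 (min_le_left _ _)
  have e2 : ε * M ≤ -P := by
    have := min_le_right 1 (-P / M)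
    rw [← le_div_iff₀ hMp]; exact this
  have e3 : 0 ≤ ε * (P + ε * (B3 * I2)) := by nlinarith
  have e4 := nonneg_of_mul_nonneg_right e3 ε0
  nlinarith

include hk hl hs hG hH hδ hab hcc hsc hS in
theorem opt_cont {hb : ℝ → ℝ} (hhb : Ad H hb)
    (hopt : ∀ h, Ad H h → Jf δ ab c (S hb) hb ≤ Jf δ ab c (S h) h) :
    ∃ kk, Continuous kk ∧ Ad H kk ∧ hb =ᵐ[volume.restrict (Ioi (0:ℝ))] kk := by
  have T := hS hb hhb
  obtain ⟨N, hNc, hNb, hNP⟩ := adjoint hk hl hs hG hH hδ hab T hhb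
  obtain ⟨K, hKc, hKm, hK⟩ := argmin hcc hsc hH
  have hγc := T.cont
  set m : ℝ → ℝ := fun t => Real.exp (δ * t) * N t * S hb t ^ 2 with hm
  have hmc : Continuous m := by fun_prop
  have hkc : Continuous (fun t => K (m t)) := hKc.comp hmc
  have hkk : Ad H (fun t => K (m t)) := ⟨hkc.measurable, fun t => hKm _⟩
  refine ⟨fun t => K (m t), hkc, hkk, ?_⟩
  obtain ⟨i, v⟩ := variation hk hl hs hG hH hδ hab hcc hsc hS hhb hkk hNc hNb hNP hopt
  have hee : ∀ t, Real.exp (-δ * t) * Real.exp (δ * t) = 1 := by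
    intro t; rw [← Real.exp_add]; simp
  have eq : ∀ t, Real.exp (-δ * t) * (c (K (m t)) - c (hb t))
      - N t * S hb t ^ 2 * (K (m t) - hb t) = - (Real.exp (-δ * t) *
        ((c (hb t) - m t * hb t) - (c (K (m t)) - m t * K (m t)))) := by
    intro t
    simp only [hm]
    linear_combination (N t * S hb t ^ 2 * (K (m t) - hb t)) * hee t
  simp only [eq] at i v
  rw [integral_neg] at v
  have i' := i.neg
  simp only [Pi.neg_def, neg_neg] at i'
  have hnn : ∀ t, 0 ≤ Real.exp (-δ * t) *
      ((c (hb t) - m t * hb t) - (c (K (m t)) - m t * K (m t))) := by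
    intro t
    refine mul_nonneg (Real.exp_pos _).le ?_
    by_cases h : hb t = K (m t)
    · rw [h, sub_self]
    · linarith [hK (m t) (hb t) (hhb.2 t) h]
  have hz : ∫ t in Ioi (0:ℝ), Real.exp (-δ * t) *
      ((c (hb t) - m t * hb t) - (c (K (m t)) - m t * K (m t))) = 0 :=
    le_antisymm (by linarith) (integral_nonneg hnn)
  rw [integral_eq_zero_iff_of_nonneg hnn i'] at hz
  filter_upwards [hz] with t ht
  by_contra hne
  have h1 := hK (m t) (hb t) (hhb.2 t) hne
  have h2 := mul_pos (Real.exp_pos (-δ * t)) (sub_pos.2 h1)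
  simp only [Pi.zero_apply] at ht
  linarith

include hk hl hs hG hg0 hH hδ hab hcc hmono hsc hS in
theorem core : ∃ hb, Continuous hb ∧ Ad H hb ∧
    (∀ h, Ad H h → Jf δ ab c (S hb) hb ≤ Jf δ ab c (S h) h) ∧
    ∀ h2, Ad H h2 → Jf δ ab c (S h2) h2 ≤ Jf δ ab c (S hb) hb →
      h2 =ᵐ[volume.restrict (Ioi (0:ℝ))] hb := by
  obtain ⟨h0, hh0, hopt⟩ := exists_opt hk hl hs hg0 hG hH hδ hab hcc hmono hsc hS
  obtain ⟨kk, hkc, hkk, hae⟩ := opt_cont hk hl hs hG hH hδ hab hcc hsc hS hh0 hopt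
  have hlim := J_lim hk hl hs hG hδ hab hcc hS (h := fun _ => h0) (fun _ => hh0) hkk (by
    filter_upwards [hae] with t ht
    rw [ht]; exact tendsto_const_nhds)
  have heq := tendsto_nhds_unique hlim tendsto_const_nhds
  have hopt' : ∀ h, Ad H h → Jf δ ab c (S kk) kk ≤ Jf δ ab c (S h) h := by
    rw [heq]; exact hopt
  exact ⟨kk, hkc, hkk, hopt', fun h2 hh2 ho =>
    ae_unique hk hl hs hg0 hG hδ hab hcc hmono hsc hS hkk hh2 hopt' ho⟩
end

end RC


/-- For every initial condition γ₀ ∈ (0, γ_max], there exists exactly one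
continuous admissible control h* with J(h*; γ₀) = v(γ₀) (uniqueness as functions on
[0,∞)). -/
theorem stmt_12
    (σ₁ σ₂ lam δ abar γmax hmax : ℝ)
    (hσ₁ : 0 < σ₁) (hσ₂ : 0 ≤ σ₂) (hlam : 0 ≤ lam) (hδ : 0 < δ) (habar : 0 < abar)
    (f : ℝ → ℝ → ℝ)
    (hf : ∀ γ h : ℝ, f γ h = -(1 / σ₁ ^ 2 + h) * γ ^ 2 - 2 * lam * γ + σ₂ ^ 2)
    (γinf : ℝ)
    (hγinf : γinf = -lam * σ₁ ^ 2 + Real.sqrt (lam ^ 2 * σ₁ ^ 4 + σ₁ ^ 2 * σ₂ ^ 2))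
    (hγmax : γinf < γmax)
    (c c' : ℝ → ℝ)
    (hc_nonneg : ∀ x : ℝ, 0 ≤ x → 0 ≤ c x)
    (hc_conv : StrictConvexOn ℝ (Set.Ici 0) c)
    (hc_mono : StrictMonoOn c (Set.Ici 0))
    (hc_smooth : ContDiffOn ℝ 2 c (Set.Ici 0))
    (hc_deriv : ∀ x ∈ Set.Ici (0 : ℝ), HasDerivWithinAt c (c' x) (Set.Ici 0) x)
    (hhmax : 0 < hmax) (hc_hmax : c' hmax = γmax ^ 2 * (abar / δ))
    (Adm : (ℝ → ℝ) → Prop)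
    (hAdm : ∀ h : ℝ → ℝ, Adm h ↔ Measurable h ∧ ∀ t : ℝ, h t ∈ Set.Icc 0 hmax)
    (sol : (ℝ → ℝ) → ℝ → ℝ → ℝ)
    (hsol : ∀ h : ℝ → ℝ, Adm h → ∀ γ₀ ∈ Set.Icc (0 : ℝ) γmax,
      sol h γ₀ 0 = γ₀ ∧
      ContinuousOn (sol h γ₀) (Set.Ici 0) ∧
      (∀ t ∈ Set.Ici (0 : ℝ), sol h γ₀ t ∈ Set.Icc 0 γmax) ∧
      (∀ t ∈ Set.Ici (0 : ℝ),
        sol h γ₀ t = γ₀ + ∫ s in (0 : ℝ)..t, f (sol h γ₀ s) (h s)))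
    (J : (ℝ → ℝ) → ℝ → ℝ)
    (hJ : ∀ (h : ℝ → ℝ) (γ₀ : ℝ), J h γ₀ =
      ∫ t in Set.Ioi (0 : ℝ), Real.exp (-δ * t) * (abar * sol h γ₀ t + c (h t)))
    (v : ℝ → ℝ)
    (hv : ∀ γ₀ ∈ Set.Icc (0 : ℝ) γmax,
      v γ₀ = sInf ((fun h => J h γ₀) '' {h : ℝ → ℝ | Adm h}))
    (γ₀ : ℝ) (hγ₀ : γ₀ ∈ Set.Ioc (0 : ℝ) γmax) :
    ∃ hstar : ℝ → ℝ,
      (ContinuousOn hstar (Set.Ici 0) ∧ Adm hstar ∧ J hstar γ₀ = v γ₀) ∧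
      ∀ h2 : ℝ → ℝ, ContinuousOn h2 (Set.Ici 0) → Adm h2 → J h2 γ₀ = v γ₀ →
        Set.EqOn h2 hstar (Set.Ici 0) := by
  have hmem : γ₀ ∈ Set.Icc (0:ℝ) γmax := ⟨hγ₀.1.le, hγ₀.2⟩
  have hAd : ∀ h, RC.Ad hmax h → Adm h := fun h hh => (hAdm h).2 hh
  have hmaxm : ∀ t : ℝ, max t 0 ∈ Set.Ici (0:ℝ) := fun t => Set.mem_Ici.2 (le_max_right t 0)
  have hS : ∀ h, RC.Ad hmax h → RC.Traj (1 / σ₁ ^ 2) lam (σ₂ ^ 2) γmax γ₀ h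
      (fun t => sol h γ₀ (max t 0)) := by
    intro h hh
    obtain ⟨_, hc, hm, he⟩ := hsol h (hAd h hh) γ₀ hmem
    refine ⟨hc.comp_continuous (by fun_prop) hmaxm, fun t => hm _ (hmaxm t), fun t ht => ?_⟩
    have e1 := he t ht
    rw [max_eq_left ht, e1]
    congr 1
    refine intervalIntegral.integral_congr fun u hu => ?_
    rw [Set.uIcc_of_le ht] at hu
    simp only [hf, RC.rhs, max_eq_left hu.1]
  have hceq : Set.EqOn c (fun x => c (max x 0)) (Set.Ici 0) := fun x hx => by
    simp only [max_eq_left (Set.mem_Ici.1 hx)]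
  have hcc : Continuous fun x => c (max x 0) :=
    hc_smooth.continuousOn.comp_continuous (by fun_prop) hmaxm
  have hJf : ∀ h, RC.Ad hmax h →
      J h γ₀ = RC.Jf δ abar (fun x => c (max x 0)) (fun t => sol h γ₀ (max t 0)) h := by
    intro h hh
    rw [hJ, RC.Jf]
    refine MeasureTheory.setIntegral_congr_fun measurableSet_Ioi fun t ht => ?_
    have ht' : (0:ℝ) ≤ t := le_of_lt ht
    simp only [max_eq_left ht', max_eq_left (hh.2 t).1]
  obtain ⟨hb, hbc, hbA, hbo, hbu⟩ := RC.core (S := fun h t => sol h γ₀ (max t 0))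
    (by positivity : (0:ℝ) ≤ 1 / σ₁ ^ 2) hlam (sq_nonneg σ₂) hγ₀.1
    (hγ₀.1.le.trans hγ₀.2) hhmax.le hδ habar hcc (hc_mono.monotoneOn.congr hceq)
    (hc_conv.congr hceq) hS
  have hvJ : J hb γ₀ = v γ₀ := by
    rw [hv γ₀ hmem]
    have hleast : IsLeast ((fun h => J h γ₀) '' {h : ℝ → ℝ | Adm h}) (J hb γ₀) := by
      refine ⟨⟨hb, hAd hb hbA, rfl⟩, ?_⟩
      rintro _ ⟨h, hh, rfl⟩
      have hh' : RC.Ad hmax h := (hAdm h).1 hh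
      simp only [hJf hb hbA, hJf h hh']
      exact hbo h hh'
    exact hleast.csInf_eq.symm
  refine ⟨hb, ⟨hbc.continuousOn, hAd hb hbA, hvJ⟩, fun h2 h2c h2A h2J => ?_⟩
  have hh2 : RC.Ad hmax h2 := (hAdm h2).1 h2A
  have hae := hbu h2 hh2 (by
    have : J h2 γ₀ = J hb γ₀ := h2J.trans hvJ.symm
    rw [hJf h2 hh2, hJf hb hbA] at this
    exact this.le)
  have ho : Set.EqOn h2 hb (Set.Ioi 0) :=
    MeasureTheory.Measure.eqOn_open_of_ae_eq hae isOpen_Ioi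
      (h2c.mono Set.Ioi_subset_Ici_self) hbc.continuousOn
  exact ho.of_subset_closure h2c hbc.continuousOn Set.Ioi_subset_Ici_self
    (closure_Ioi (0:ℝ)).ge
end

section
/- The value function v of the reduced deterministic control problem satisfies the Hamilton–Jacobi–Bellman equation: for every γ ∈ (0, γ_max), −δ·v(γ) + min_{h ∈ [0,h_max]} { f(γ,h)·v'(γ) + ā·γ + c(h) } = 0, where v' is the derivative of v (which exists and is continuous on (0,γ_max)). -/
open MeasureTheory Set Filter Topology

/-- The control problem, abstractly. -/
structure CtrlSetup (G H K δ : ℝ) (F g : ℝ → ℝ → ℝ) (sol : (ℝ → ℝ) → ℝ → ℝ → ℝ)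
    (v : ℝ → ℝ) : Prop where
  hH : 0 < H
  hK : 0 < K
  hδ : 0 < δ
  cF : Continuous (Function.uncurry F)
  cg : Continuous (Function.uncurry g)
  bF : ∀ x ∈ Icc 0 G, ∀ a ∈ Icc 0 H, |F x a| ≤ K
  bg : ∀ x ∈ Icc 0 G, ∀ a ∈ Icc 0 H, |g x a| ≤ K
  g0 : ∀ x ∈ Icc 0 G, ∀ a ∈ Icc 0 H, 0 ≤ g x a
  lF : ∀ x ∈ Icc 0 G, ∀ y ∈ Icc 0 G, ∀ a ∈ Icc 0 H, |F x a - F y a| ≤ K * |x - y|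
  lg : ∀ x ∈ Icc 0 G, ∀ y ∈ Icc 0 G, ∀ a ∈ Icc 0 H, |g x a - g y a| ≤ K * |x - y|
  s0 : ∀ h : ℝ → ℝ, (Measurable h ∧ ∀ t, h t ∈ Icc 0 H) → ∀ γ ∈ Icc 0 G, sol h γ 0 = γ
  sc : ∀ h : ℝ → ℝ, (Measurable h ∧ ∀ t, h t ∈ Icc 0 H) → ∀ γ ∈ Icc 0 G,
    ContinuousOn (sol h γ) (Ici 0)
  sm : ∀ h : ℝ → ℝ, (Measurable h ∧ ∀ t, h t ∈ Icc 0 H) → ∀ γ ∈ Icc 0 G,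
    ∀ t ∈ Ici (0:ℝ), sol h γ t ∈ Icc 0 G
  se : ∀ h : ℝ → ℝ, (Measurable h ∧ ∀ t, h t ∈ Icc 0 H) → ∀ γ ∈ Icc 0 G,
    ∀ t ∈ Ici (0:ℝ), sol h γ t = γ + ∫ s in (0:ℝ)..t, F (sol h γ s) (h s)
  hv : ∀ γ ∈ Icc 0 G, v γ = sInf ((fun h : ℝ → ℝ =>
    ∫ t in Ioi (0:ℝ), Real.exp (-δ * t) * g (sol h γ t) (h t)) ''
      {h | Measurable h ∧ ∀ t, h t ∈ Icc 0 H})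

theorem aux_meas {φ : ℝ → ℝ → ℝ} (hφ : Continuous (Function.uncurry φ)) {x h : ℝ → ℝ}
    (hx : ContinuousOn x (Ici 0)) (hh : Measurable h) :
    AEStronglyMeasurable (fun s => φ (x s) (h s)) (volume.restrict (Ici 0)) :=
  hφ.comp_aestronglyMeasurable
    ((hx.aestronglyMeasurable measurableSet_Ici).prodMk hh.aestronglyMeasurable)

theorem aux_int {φ : ℝ → ℝ → ℝ} (hφ : Continuous (Function.uncurry φ)) {x h : ℝ → ℝ}
    (hx : ContinuousOn x (Ici 0)) (hh : Measurable h) {K : ℝ}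
    (hb : ∀ t, 0 ≤ t → |φ (x t) (h t)| ≤ K) {a b : ℝ} (ha : 0 ≤ a) (hab : a ≤ b) :
    IntervalIntegrable (fun s => φ (x s) (h s)) volume a b := by
  rw [intervalIntegrable_iff_integrableOn_Ioc_of_le hab]
  have hs : Ioc a b ⊆ Ici 0 := fun t ht => ha.trans ht.1.le
  refine IntegrableOn.of_bound (C := K) (by simp) ?_ ?_
  · exact (aux_meas hφ hx hh).mono_measure (Measure.restrict_mono hs le_rfl)
  · filter_upwards [ae_restrict_mem measurableSet_Ioc] with t ht
    exact hb t (hs ht)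

theorem aux_cost {φ : ℝ → ℝ → ℝ} (hφ : Continuous (Function.uncurry φ)) {x h : ℝ → ℝ}
    (hx : ContinuousOn x (Ici 0)) (hh : Measurable h) {K δ : ℝ} (hδ : 0 < δ)
    (hb : ∀ t, 0 ≤ t → |φ (x t) (h t)| ≤ K) :
    IntegrableOn (fun s => Real.exp (-δ * s) * φ (x s) (h s)) (Ioi 0) := by
  have h1 : IntegrableOn (fun s => Real.exp (-δ * s)) (Ioi (0:ℝ)) := exp_neg_integrableOn_Ioi 0 hδ
  refine Integrable.mul_bdd (c := K) h1 ?_ ?_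
  · exact (aux_meas hφ hx hh).mono_measure (Measure.restrict_mono Ioi_subset_Ici_self le_rfl)
  · filter_upwards [ae_restrict_mem measurableSet_Ioi] with t ht
    exact hb t (le_of_lt ht)

theorem aux_gronwall {u : ℝ → ℝ} {K T : ℝ} (hu : ContinuousOn u (Icc 0 T))
    (h : ∀ t ∈ Icc 0 T, u t ≤ K * ∫ s in (0:ℝ)..t, u s) (hn : ∀ t ∈ Icc 0 T, 0 ≤ u t) :
    ∀ t ∈ Icc 0 T, u t = 0 := by
  intro t ht
  have hT : 0 ≤ T := ht.1.trans ht.2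
  have hii : IntervalIntegrable u volume 0 T := by
    apply ContinuousOn.intervalIntegrable; rwa [uIcc_of_le hT]
  have hc : ContinuousOn (fun t => ∫ s in (0:ℝ)..t, u s) (Icc 0 T) := by
    have := intervalIntegral.continuousOn_primitive_interval (f := u) (a := 0) (b := T)
      (μ := volume) (by rw [uIcc_of_le hT]; exact hu.integrableOn_Icc)
    rwa [uIcc_of_le hT] at this
  have hd : ∀ r ∈ Ico 0 T, HasDerivWithinAt (fun t => ∫ s in (0:ℝ)..t, u s) (u r) (Ici r) r := by
    intro r hr
    have hu' : ContinuousWithinAt u (Ioi r) r :=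
      (hu r ⟨hr.1, hr.2.le⟩).mono_of_mem_nhdsWithin
        (mem_of_superset (Ioo_mem_nhdsGT hr.2) (fun y hy => ⟨hr.1.trans hy.1.le, hy.2.le⟩))
    refine intervalIntegral.integral_hasDerivWithinAt_right ?_ ?_ hu'
    · exact hii.mono_set (by rw [uIcc_of_le hr.1, uIcc_of_le hT]; exact Icc_subset_Icc le_rfl hr.2.le)
    · refine ⟨Ioo r T, Ioo_mem_nhdsGT hr.2, ?_⟩
      exact (hu.mono (fun y hy => ⟨hr.1.trans hy.1.le, hy.2.le⟩)).aestronglyMeasurable measurableSet_Ioo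
  have key := le_gronwallBound_of_liminf_deriv_right_le (f := fun t => ∫ s in (0:ℝ)..t, u s)
    (f' := u) (δ := 0) (K := K) (ε := 0) (a := 0) (b := T) hc
    (fun r hr q hq => (hd r hr).liminf_right_slope_le hq) (by simp)
    (fun r hr => by simpa using h r ⟨hr.1, hr.2.le⟩)
  have hU : (∫ s in (0:ℝ)..t, u s) ≤ 0 := by
    have := key t ht
    simpa [gronwallBound_ε0] using this
  have hU' : 0 ≤ (∫ s in (0:ℝ)..t, u s) :=
    intervalIntegral.integral_nonneg ht.1 (fun s hs => hn s ⟨hs.1, hs.2.trans ht.2⟩)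
  have h0 := le_antisymm hU hU'
  have := h t ht
  rw [h0, mul_zero] at this
  exact le_antisymm this (hn t ht)

namespace CtrlSetup
variable {G H K δ : ℝ} {F g : ℝ → ℝ → ℝ} {sol : (ℝ → ℝ) → ℝ → ℝ → ℝ} {v : ℝ → ℝ}

theorem uniq (S : CtrlSetup G H K δ F g sol v) {x y h k : ℝ → ℝ} {a T : ℝ}
    (hx : ContinuousOn x (Ici 0)) (hy : ContinuousOn y (Ici 0))
    (mx : ∀ t ∈ Ici (0:ℝ), x t ∈ Icc 0 G) (my : ∀ t ∈ Ici (0:ℝ), y t ∈ Icc 0 G)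
    (hh : Measurable h ∧ ∀ t, h t ∈ Icc 0 H) (hk : Measurable k ∧ ∀ t, k t ∈ Icc 0 H)
    (ex : ∀ t ∈ Ici (0:ℝ), x t = a + ∫ s in (0:ℝ)..t, F (x s) (h s))
    (ey : ∀ t ∈ Ici (0:ℝ), y t = a + ∫ s in (0:ℝ)..t, F (y s) (k s))
    (hkT : ∀ t ∈ Ioc 0 T, h t = k t) : ∀ t ∈ Icc 0 T, x t = y t := by
  have hsub : Icc 0 T ⊆ Ici (0:ℝ) := fun t ht => ht.1
  have hcu : ContinuousOn (fun t => |x t - y t|) (Ici 0) := (hx.sub hy).abs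
  have := aux_gronwall (u := fun t => |x t - y t|) (K := K) (T := T)
    (hcu.mono hsub) ?_ (fun _ _ => abs_nonneg _)
  · intro t ht
    have := this t ht
    simpa [sub_eq_zero] using this
  · intro t ht
    have i1 := aux_int S.cF hx hh.1 (K := K) (fun s hs => S.bF _ (mx s hs) _ (hh.2 s)) le_rfl ht.1
    have i2 := aux_int S.cF hy hk.1 (K := K) (fun s hs => S.bF _ (my s hs) _ (hk.2 s)) le_rfl ht.1
    have e : x t - y t = ∫ s in (0:ℝ)..t, (F (x s) (h s) - F (y s) (k s)) := by
      rw [intervalIntegral.integral_sub i1 i2, ex t ht.1, ey t ht.1]; ring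
    show |x t - y t| ≤ _
    rw [e]
    show _ ≤ K * ∫ s in (0:ℝ)..t, |x s - y s|
    rw [← intervalIntegral.integral_const_mul]
    have hi : IntervalIntegrable (fun s => K * |x s - y s|) volume 0 t := by
      apply ContinuousOn.intervalIntegrable
      rw [uIcc_of_le ht.1]
      exact continuousOn_const.mul (hcu.mono (fun s hs => hs.1))
    rw [← Real.norm_eq_abs]
    refine intervalIntegral.norm_integral_le_of_norm_le ht.1 (Eventually.of_forall ?_) hi
    intro s hs
    have hs0 : (0:ℝ) ≤ s := hs.1.le
    rw [← hkT s ⟨hs.1, hs.2.trans ht.2⟩]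
    exact S.lF _ (mx s hs0) _ (my s hs0) _ (hh.2 s)

/-- Solutions only depend on the control on the elapsed time. -/
theorem causal (S : CtrlSetup G H K δ F g sol v) {h k : ℝ → ℝ} {γ T : ℝ} (hγ : γ ∈ Icc 0 G)
    (hh : Measurable h ∧ ∀ t, h t ∈ Icc 0 H) (hk : Measurable k ∧ ∀ t, k t ∈ Icc 0 H)
    (hkT : ∀ t ∈ Ioc 0 T, h t = k t) : ∀ t ∈ Icc 0 T, sol h γ t = sol k γ t :=
  S.uniq (S.sc h hh γ hγ) (S.sc k hk γ hγ) (S.sm h hh γ hγ) (S.sm k hk γ hγ) hh hk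
    (S.se h hh γ hγ) (S.se k hk γ hγ) hkT

theorem adm_shift {h : ℝ → ℝ} (hh : Measurable h ∧ ∀ t, h t ∈ Icc 0 H) (T : ℝ) :
    Measurable (fun s => h (s + T)) ∧ ∀ t, (fun s => h (s + T)) t ∈ Icc 0 H :=
  ⟨hh.1.comp (measurable_id.add_const T), fun _ => hh.2 _⟩

/-- Flow property. -/
theorem flow (S : CtrlSetup G H K δ F g sol v) {h k : ℝ → ℝ} {γ T : ℝ} (hγ : γ ∈ Icc 0 G)
    (hT : 0 ≤ T)
    (hh : Measurable h ∧ ∀ t, h t ∈ Icc 0 H) (hk : Measurable k ∧ ∀ t, k t ∈ Icc 0 H)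
    (hkT : ∀ t > 0, h (t + T) = k t) :
    ∀ t, 0 ≤ t → sol h γ (t + T) = sol k (sol h γ T) t := by
  intro t ht
  have hγT := S.sm h hh γ hγ T hT
  refine S.uniq (x := fun t => sol h γ (t + T)) (y := sol k (sol h γ T)) (a := sol h γ T) (T := t)
    ?_ (S.sc k hk _ hγT) ?_ (S.sm k hk _ hγT) (adm_shift hh T) hk ?_ (S.se k hk _ hγT)
    (fun s hs => hkT s hs.1) t ⟨ht, le_rfl⟩
  · exact (S.sc h hh γ hγ).comp (by fun_prop) (fun s hs => add_nonneg hs hT)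
  · exact fun s hs => S.sm h hh γ hγ _ (add_nonneg hs hT)
  · intro s hs
    have hs : 0 ≤ s := hs
    show sol h γ (s + T) = _
    rw [S.se h hh γ hγ (s + T) (add_nonneg hs hT), S.se h hh γ hγ T hT]
    rw [intervalIntegral.integral_comp_add_right (fun r => F (sol h γ r) (h r)) T, add_assoc, zero_add,
      intervalIntegral.integral_add_adjacent_intervals]
    · exact aux_int S.cF (S.sc h hh γ hγ) hh.1 (K := K)
        (fun r hr => S.bF _ (S.sm h hh γ hγ r hr) _ (hh.2 r)) le_rfl hT
    · exact aux_int S.cF (S.sc h hh γ hγ) hh.1 (K := K)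
        (fun r hr => S.bF _ (S.sm h hh γ hγ r hr) _ (hh.2 r)) hT (by linarith)

theorem J_split (S : CtrlSetup G H K δ F g sol v) {h k : ℝ → ℝ} {γ T : ℝ} (hγ : γ ∈ Icc 0 G)
    (hT : 0 ≤ T)
    (hh : Measurable h ∧ ∀ t, h t ∈ Icc 0 H) (hk : Measurable k ∧ ∀ t, k t ∈ Icc 0 H)
    (hkT : ∀ t > 0, h (t + T) = k t) :
    ∫ t in Ioi (0:ℝ), Real.exp (-δ * t) * g (sol h γ t) (h t) =
      (∫ t in (0:ℝ)..T, Real.exp (-δ * t) * g (sol h γ t) (h t)) +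
      Real.exp (-δ * T) * ∫ t in Ioi (0:ℝ), Real.exp (-δ * t) * g (sol k (sol h γ T) t) (k t) := by
  have hi := aux_cost S.cg (S.sc h hh γ hγ) hh.1 (K := K) S.hδ
        (fun r hr => S.bg _ (S.sm h hh γ hγ r hr) _ (hh.2 r))
  rw [← intervalIntegral.integral_interval_add_Ioi hi (hi.mono_set (Ioi_subset_Ioi hT))]
  congr 1
  rw [← integral_const_mul]
  have := (measurePreserving_add_right (volume : Measure ℝ) T).setIntegral_preimage_emb
    (measurableEmbedding_addRight T)
    (fun t => Real.exp (-δ * t) * g (sol h γ t) (h t)) (Ioi T)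
  simp only [preimage_add_const_Ioi, sub_self] at this
  rw [← this]
  refine setIntegral_congr_fun measurableSet_Ioi (fun s hs => ?_)
  have hs : 0 < s := hs
  rw [S.flow hγ hT hh hk hkT s hs.le, hkT s hs, mul_add, Real.exp_add]; ring

theorem v_le (S : CtrlSetup G H K δ F g sol v) {h : ℝ → ℝ} {γ : ℝ} (hγ : γ ∈ Icc 0 G)
    (hh : Measurable h ∧ ∀ t, h t ∈ Icc 0 H) :
    v γ ≤ ∫ t in Ioi (0:ℝ), Real.exp (-δ * t) * g (sol h γ t) (h t) := by
  rw [S.hv γ hγ]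
  refine csInf_le ⟨0, ?_⟩ ⟨h, hh, rfl⟩
  rintro _ ⟨k, hk, rfl⟩
  refine setIntegral_nonneg measurableSet_Ioi (fun t ht => ?_)
  exact mul_nonneg (Real.exp_pos _).le (S.g0 _ (S.sm k hk γ hγ t (mem_Ici.2 (le_of_lt (mem_Ioi.1 ht)))) _ (hk.2 t))

theorem le_v (S : CtrlSetup G H K δ F g sol v) {γ b : ℝ} (hγ : γ ∈ Icc 0 G)
    (hb : ∀ h : ℝ → ℝ, (Measurable h ∧ ∀ t, h t ∈ Icc 0 H) →
      b ≤ ∫ t in Ioi (0:ℝ), Real.exp (-δ * t) * g (sol h γ t) (h t)) : b ≤ v γ := by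
  rw [S.hv γ hγ]
  refine le_csInf ⟨_, fun _ => 0, ⟨measurable_const, fun _ => ⟨le_rfl, S.hH.le⟩⟩, rfl⟩ ?_
  rintro _ ⟨k, hk, rfl⟩
  exact hb k hk

theorem dpp (S : CtrlSetup G H K δ F g sol v) {h : ℝ → ℝ} {γ T : ℝ} (hγ : γ ∈ Icc 0 G)
    (hT : 0 ≤ T) (hh : Measurable h ∧ ∀ t, h t ∈ Icc 0 H) :
    v γ ≤ (∫ t in (0:ℝ)..T, Real.exp (-δ * t) * g (sol h γ t) (h t)) +
      Real.exp (-δ * T) * v (sol h γ T) := by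
  have hγT := S.sm h hh γ hγ T hT
  have hE := Real.exp_pos (-δ * T)
  rw [← sub_le_iff_le_add', ← div_le_iff₀' hE]
  refine S.le_v hγT (fun k hk => ?_)
  rw [div_le_iff₀' hE, sub_le_iff_le_add']
  let q : ℝ → ℝ := fun t => if t ≤ T then h t else k (t - T)
  have hq : Measurable q ∧ ∀ t, q t ∈ Icc 0 H := by
    refine ⟨Measurable.ite measurableSet_Iic hh.1 (hk.1.comp (measurable_id.sub_const T)), ?_⟩
    intro t
    by_cases ht : t ≤ T
    · simpa [q, ht] using hh.2 t
    · simpa [q, ht] using hk.2 (t - T)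
  have hqh : ∀ t ∈ Ioc 0 T, q t = h t := fun t ht => by simp [q, ht.2]
  have hqk : ∀ t > 0, q (t + T) = k t := fun t ht => by
    have : ¬ t ≤ 0 := not_le.2 ht
    simp [q, this]
  have hc := S.causal hγ hq hh hqh
  have h1 := S.v_le hγ hq
  rw [S.J_split hγ hT hq hk hqk, hc T ⟨hT, le_rfl⟩] at h1
  refine h1.trans_eq ?_
  congr 1
  rw [intervalIntegral.integral_of_le hT, intervalIntegral.integral_of_le hT]
  refine setIntegral_congr_fun measurableSet_Ioc (fun s hs => ?_)
  rw [hc s ⟨hs.1.le, hs.2⟩, hqh s hs]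

theorem J_ge (S : CtrlSetup G H K δ F g sol v) {h : ℝ → ℝ} {γ T : ℝ} (hγ : γ ∈ Icc 0 G)
    (hT : 0 ≤ T) (hh : Measurable h ∧ ∀ t, h t ∈ Icc 0 H) :
    (∫ t in (0:ℝ)..T, Real.exp (-δ * t) * g (sol h γ t) (h t)) +
      Real.exp (-δ * T) * v (sol h γ T) ≤
    ∫ t in Ioi (0:ℝ), Real.exp (-δ * t) * g (sol h γ t) (h t) := by
  rw [S.J_split hγ hT hh (adm_shift hh T) (fun _ _ => rfl)]
  gcongr
  exact S.v_le (S.sm h hh γ hγ T hT) (adm_shift hh T)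

end CtrlSetup

theorem aux_deriv_nonneg {ψ : ℝ → ℝ} {d : ℝ} (hd : HasDerivWithinAt ψ d (Ici 0) 0)
    (h : ∀ᶠ t in 𝓝[>] (0:ℝ), ψ 0 ≤ ψ t) : 0 ≤ d := by
  have h1 : HasDerivWithinAt ψ d (Ioi 0) 0 := hd.mono Ioi_subset_Ici_self
  rw [hasDerivWithinAt_iff_tendsto_slope' (by simp)] at h1
  refine ge_of_tendsto h1 ?_
  filter_upwards [h, self_mem_nhdsWithin] with t ht ht0
  rw [slope_def_field]
  have : (0:ℝ) < t := ht0
  exact div_nonneg (by linarith) (by linarith)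

theorem aux_deriv_prim {ψ : ℝ → ℝ} (hψ : ContinuousOn ψ (Ici 0)) :
    HasDerivWithinAt (fun t => ∫ s in (0:ℝ)..t, ψ s) (ψ 0) (Ici 0) 0 := by
  refine intervalIntegral.integral_hasDerivWithinAt_right (by simp) ?_
    ((hψ 0 (by simp)).mono Ioi_subset_Ici_self)
  exact ⟨Ioi 0, self_mem_nhdsWithin,
    (hψ.mono Ioi_subset_Ici_self).aestronglyMeasurable measurableSet_Ioi⟩

namespace CtrlSetup
variable {G H K δ : ℝ} {F g : ℝ → ℝ → ℝ} {sol : (ℝ → ℝ) → ℝ → ℝ → ℝ} {v : ℝ → ℝ}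

theorem hjb_sub (S : CtrlSetup G H K δ F g sol v) {γ p : ℝ} (hγ : γ ∈ Icc 0 G)
    (hp : HasDerivAt v p γ) {a : ℝ} (ha : a ∈ Icc 0 H) :
    δ * v γ ≤ F γ a * p + g γ a := by
  have hh : Measurable (fun _ : ℝ => a) ∧ ∀ t : ℝ, (fun _ : ℝ => a) t ∈ Icc 0 H :=
    ⟨measurable_const, fun _ => ha⟩
  have hxc := S.sc _ hh γ hγ
  have hx0 := S.s0 _ hh γ hγ
  have hse := S.se _ hh γ hγ
  have hdpp := fun T (hT : 0 ≤ T) => S.dpp hγ hT hh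
  generalize sol (fun _ : ℝ => a) γ = x at *
  have cFx : ContinuousOn (fun s => F (x s) a) (Ici 0) :=
    S.cF.comp_continuousOn (hxc.prodMk continuousOn_const)
  have cgx : ContinuousOn (fun s => Real.exp (-δ * s) * g (x s) a) (Ici 0) :=
    (by fun_prop : Continuous fun s : ℝ => Real.exp (-δ * s)).continuousOn.mul
      (S.cg.comp_continuousOn (hxc.prodMk continuousOn_const))
  have dx : HasDerivWithinAt x (F γ a) (Ici 0) 0 := by
    have := (aux_deriv_prim cFx).const_add γ
    rw [hx0] at this
    exact this.congr hse (hse 0 (by simp))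
  have d1 := aux_deriv_prim cgx
  have d2 : HasDerivWithinAt (fun t => v (x t)) (p * F γ a) (Ici 0) 0 :=
    HasDerivAt.comp_hasDerivWithinAt (0:ℝ) (by rw [hx0]; exact hp) dx
  have d3 : HasDerivWithinAt (fun t => Real.exp (-δ * t)) (-δ) (Ici 0) 0 := by
    have : HasDerivAt (fun t : ℝ => Real.exp (-δ * t)) (Real.exp (-δ * 0) * (-δ * 1)) 0 :=
      ((hasDerivAt_id (0:ℝ)).const_mul (-δ)).exp
    simpa using this.hasDerivWithinAt
  have := aux_deriv_nonneg (d1.add (d3.mul d2)) (by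
    filter_upwards [self_mem_nhdsWithin] with t ht
    simpa [hx0] using hdpp t (le_of_lt ht))
  simp [hx0] at this
  linarith

theorem hjb_super (S : CtrlSetup G H K δ F g sol v) {γ p : ℝ} (hγ : γ ∈ Icc 0 G)
    (hp : HasDerivAt v p γ) {m : ℝ} (hm : ∀ a ∈ Icc 0 H, m ≤ F γ a * p + g γ a) :
    m ≤ δ * v γ := by
  refine le_of_forall_pos_le_add (fun ε hε => ?_)
  have hK := S.hK
  have hη : 0 < ε / K := by positivity
  have hlo := (hasDerivAt_iff_isLittleO.1 hp).def hη
  obtain ⟨r, hr, hball⟩ := Metric.eventually_nhds_iff.1 hlo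
  have key : ∀ T : ℝ, 0 < T → K * T < r →
      v γ ≤ Real.exp (δ * T) * v γ - T * m + (1 + |p|) * K ^ 2 * T ^ 2 + ε * T := by
    intro T hT hTr
    suffices h : Real.exp (-δ * T) *
        (v γ + T * m - (1 + |p|) * K ^ 2 * T ^ 2 - ε * T) ≤ v γ by
      have h2 := mul_le_mul_of_nonneg_left h (Real.exp_pos (δ * T)).le
      rw [← mul_assoc, ← Real.exp_add] at h2
      simp at h2
      linarith
    refine S.le_v hγ (fun h hh => ?_)
    refine le_trans ?_ (S.J_ge hγ hT.le hh)
    have hxc := S.sc _ hh γ hγ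
    have hxm := S.sm _ hh γ hγ
    have hse := S.se _ hh γ hγ
    generalize sol h γ = x at *
    have iF := fun t (ht : (0:ℝ) ≤ t) => aux_int S.cF hxc hh.1 (K := K)
      (fun s hs => S.bF _ (hxm s hs) _ (hh.2 s)) le_rfl ht
    have ig := aux_int S.cg hxc hh.1 (K := K)
      (fun s hs => S.bg _ (hxm s hs) _ (hh.2 s)) le_rfl hT.le
    have ieg : IntervalIntegrable (fun s => Real.exp (-δ * s) * g (x s) (h s)) volume 0 T :=
      ig.continuousOn_mul (by fun_prop)
    have hdist : ∀ t, 0 ≤ t → |x t - γ| ≤ K * t := by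
      intro t ht
      rw [hse t ht, add_sub_cancel_left]
      have := intervalIntegral.norm_integral_le_of_norm_le_const (a := 0) (b := t) (C := K)
        (f := fun s => F (x s) (h s)) (fun s hs => by
          rw [uIoc_of_le ht] at hs
          exact S.bF _ (hxm s (mem_Ici.2 hs.1.le)) _ (hh.2 s))
      simpa [abs_of_nonneg ht] using this
    have hvT : v γ + p * (∫ s in (0:ℝ)..T, F (x s) (h s)) - ε * T ≤ v (x T) := by
      have hd := hdist T hT.le
      have := hball (y := x T) (by rw [Real.dist_eq]; linarith)
      simp only [Real.norm_eq_abs, smul_eq_mul] at this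
      have h3 : ε / K * |x T - γ| ≤ ε * T := by
        calc ε / K * |x T - γ| ≤ ε / K * (K * T) := by gcongr
          _ = ε * T := by field_simp
      have h4 := (abs_le.1 (this.trans h3)).1
      have h5 : x T - γ = ∫ s in (0:ℝ)..T, F (x s) (h s) := by
        rw [hse T hT.le]; ring
      rw [h5] at h4
      linarith
    have hge : Real.exp (-δ * T) * (∫ s in (0:ℝ)..T, g (x s) (h s)) ≤
        ∫ s in (0:ℝ)..T, Real.exp (-δ * s) * g (x s) (h s) := by
      rw [← intervalIntegral.integral_const_mul]
      refine intervalIntegral.integral_mono_on hT.le (ig.const_mul _) ieg (fun s hs => ?_)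
      have hδ := S.hδ
      refine mul_le_mul_of_nonneg_right (Real.exp_le_exp.2 ?_) (S.g0 _ (hxm s hs.1) _ (hh.2 s))
      nlinarith [hs.2]
    have hsum : T * m - (1 + |p|) * K ^ 2 * T ^ 2 ≤
        (∫ s in (0:ℝ)..T, g (x s) (h s)) + p * ∫ s in (0:ℝ)..T, F (x s) (h s) := by
      rw [← intervalIntegral.integral_const_mul,
        ← intervalIntegral.integral_add ig ((iF T hT.le).const_mul p)]
      have hcst : T * m - (1 + |p|) * K ^ 2 * T ^ 2 =
          ∫ _ in (0:ℝ)..T, (m - (1 + |p|) * K ^ 2 * T) := by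
        rw [intervalIntegral.integral_const, smul_eq_mul]; ring
      rw [hcst]
      refine intervalIntegral.integral_mono_on hT.le (by simp)
        (ig.add ((iF T hT.le).const_mul p)) (fun s hs => ?_)
      have hd : |x s - γ| ≤ K * T := (hdist s hs.1).trans (by nlinarith [hs.2])
      have e1 : |g (x s) (h s) - g γ (h s)| ≤ K * (K * T) :=
        (S.lg _ (hxm s hs.1) _ hγ _ (hh.2 s)).trans (by gcongr)
      have e2 : |F (x s) (h s) - F γ (h s)| ≤ K * (K * T) :=
        (S.lF _ (hxm s hs.1) _ hγ _ (hh.2 s)).trans (by gcongr)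
      have e3 : |p * (F (x s) (h s) - F γ (h s))| ≤ |p| * (K * (K * T)) := by
        rw [abs_mul]; gcongr
      have f1 := (abs_le.1 e1).1
      have f3 := (abs_le.1 e3).1
      have := hm _ (hh.2 s)
      nlinarith
    have hE := Real.exp_pos (-δ * T)
    have : Real.exp (-δ * T) * (v γ + T * m - (1 + |p|) * K ^ 2 * T ^ 2 - ε * T) ≤
        Real.exp (-δ * T) * ((∫ s in (0:ℝ)..T, g (x s) (h s)) + v (x T)) :=
      mul_le_mul_of_nonneg_left (by linarith) hE.le
    rw [mul_add] at this
    linarith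
  have hd : HasDerivAt (fun T : ℝ => Real.exp (δ * T) * v γ - T * m
      + (1 + |p|) * K ^ 2 * T ^ 2 + ε * T) (δ * v γ - m + ε) 0 := by
    have a1 : HasDerivAt (fun T : ℝ => Real.exp (δ * T) * v γ)
        (Real.exp (δ * 0) * (δ * 1) * v γ) 0 :=
      (((hasDerivAt_id (0:ℝ)).const_mul δ).exp).mul_const _
    have a2 : HasDerivAt (fun T : ℝ => T * m) (1 * m) 0 := (hasDerivAt_id (0:ℝ)).mul_const m
    have a3 := (hasDerivAt_pow 2 (0:ℝ)).const_mul ((1 + |p|) * K ^ 2)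
    have a4 : HasDerivAt (fun T : ℝ => ε * T) (ε * 1) 0 := (hasDerivAt_id (0:ℝ)).const_mul ε
    have := ((a1.sub a2).add a3).add a4
    exact this.congr_deriv (by simp)
  have := aux_deriv_nonneg hd.hasDerivWithinAt (by
    filter_upwards [Ioo_mem_nhdsGT (show (0:ℝ) < r / K by positivity)] with T hT
    have := key T hT.1 (by have := hT.2; rw [lt_div_iff₀ hK] at this; linarith)
    simpa using this)
  linarith

end CtrlSetup

/-- The value function v of the reduced problem satisfies the HJB
equation: for every γ ∈ (0, γ_max),
−δ·v(γ) + min_{h ∈ [0,h_max]} { f(γ,h)·v'(γ) + ā·γ + c(h) } = 0,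
where v' is the (continuous) derivative of v on (0,γ_max). -/
theorem stmt_13
    (σ₁ σ₂ lam δ abar γmax hmax : ℝ)
    (hσ₁ : 0 < σ₁) (hσ₂ : 0 ≤ σ₂) (hlam : 0 ≤ lam) (hδ : 0 < δ) (habar : 0 < abar)
    (f : ℝ → ℝ → ℝ)
    (hf : ∀ γ h : ℝ, f γ h = -(1 / σ₁ ^ 2 + h) * γ ^ 2 - 2 * lam * γ + σ₂ ^ 2)
    (γinf : ℝ)
    (hγinf : γinf = -lam * σ₁ ^ 2 + Real.sqrt (lam ^ 2 * σ₁ ^ 4 + σ₁ ^ 2 * σ₂ ^ 2))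
    (hγmax : γinf < γmax)
    (c c' : ℝ → ℝ)
    (hc_nonneg : ∀ x : ℝ, 0 ≤ x → 0 ≤ c x)
    (hc_conv : StrictConvexOn ℝ (Set.Ici 0) c)
    (hc_mono : StrictMonoOn c (Set.Ici 0))
    (hc_smooth : ContDiffOn ℝ 2 c (Set.Ici 0))
    (hc_deriv : ∀ x ∈ Set.Ici (0 : ℝ), HasDerivWithinAt c (c' x) (Set.Ici 0) x)
    (hhmax : 0 < hmax) (hc_hmax : c' hmax = γmax ^ 2 * (abar / δ))
    (Adm : (ℝ → ℝ) → Prop)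
    (hAdm : ∀ h : ℝ → ℝ, Adm h ↔ Measurable h ∧ ∀ t : ℝ, h t ∈ Set.Icc 0 hmax)
    (sol : (ℝ → ℝ) → ℝ → ℝ → ℝ)
    (hsol : ∀ h : ℝ → ℝ, Adm h → ∀ γ₀ ∈ Set.Icc (0 : ℝ) γmax,
      sol h γ₀ 0 = γ₀ ∧
      ContinuousOn (sol h γ₀) (Set.Ici 0) ∧
      (∀ t ∈ Set.Ici (0 : ℝ), sol h γ₀ t ∈ Set.Icc 0 γmax) ∧
      (∀ t ∈ Set.Ici (0 : ℝ),
        sol h γ₀ t = γ₀ + ∫ s in (0 : ℝ)..t, f (sol h γ₀ s) (h s)))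
    (J : (ℝ → ℝ) → ℝ → ℝ)
    (hJ : ∀ (h : ℝ → ℝ) (γ₀ : ℝ), J h γ₀ =
      ∫ t in Set.Ioi (0 : ℝ), Real.exp (-δ * t) * (abar * sol h γ₀ t + c (h t)))
    (v : ℝ → ℝ)
    (hv : ∀ γ₀ ∈ Set.Icc (0 : ℝ) γmax,
      v γ₀ = sInf ((fun h => J h γ₀) '' {h : ℝ → ℝ | Adm h}))
    (v' : ℝ → ℝ)
    (hv'_deriv : ∀ x ∈ Set.Ioo (0 : ℝ) γmax, HasDerivAt v (v' x) x)
    (hv'_cont : ContinuousOn v' (Set.Ioo 0 γmax)) :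
    ∀ γ ∈ Set.Ioo (0 : ℝ) γmax, ∃ m : ℝ,
      IsLeast ((fun h => f γ h * v' γ + abar * γ + c h) '' Set.Icc 0 hmax) m ∧
      -δ * v γ + m = 0 := by
  intro γ hγ
  set B : ℝ := 1 / σ₁ ^ 2 with hB
  have hB0 : 0 < B := by positivity
  have hγm : 0 < γmax := hγ.1.trans hγ.2
  have hcc : ContinuousOn c (Ici 0) := fun x hx => (hc_deriv x hx).continuousWithinAt
  have hc0 : Continuous (fun a : ℝ => c (max 0 a)) :=
    hcc.comp_continuous (by fun_prop) (fun a => mem_Ici.2 (le_max_left 0 a))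
  have hch : 0 ≤ c hmax := hc_nonneg _ hhmax.le
  have hcle : ∀ a ∈ Icc 0 hmax, c a ≤ c hmax := fun a ha =>
    hc_mono.monotoneOn ha.1 hhmax.le ha.2
  set g : ℝ → ℝ → ℝ := fun x a => abar * x + c (max 0 a) with hg
  set K1 : ℝ := (B + hmax) * γmax ^ 2 + 2 * lam * γmax + σ₂ ^ 2 with hK1
  set K2 : ℝ := (B + hmax) * (2 * γmax) + 2 * lam with hK2
  set K3 : ℝ := abar * γmax + c hmax with hK3
  have k1 : 0 ≤ K1 := by positivity
  have k2 : 0 ≤ K2 := by positivity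
  have k3 : 0 ≤ K3 := by positivity
  have hge : ∀ x, ∀ a ∈ Icc 0 hmax, g x a = abar * x + c a := fun x a ha => by
    simp only [hg]; rw [max_eq_right ha.1]
  have S : CtrlSetup γmax hmax (K1 + K2 + K3 + abar) δ f g sol v :=
  { hH := hhmax
    hK := by positivity
    hδ := hδ
    cF := by
      have : Function.uncurry f = fun q : ℝ × ℝ =>
          -(B + q.2) * q.1 ^ 2 - 2 * lam * q.1 + σ₂ ^ 2 := by
        ext ⟨x, a⟩; exact hf x a
      rw [this]; fun_prop
    cg := by
      show Continuous (fun q : ℝ × ℝ => abar * q.1 + c (max 0 q.2))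
      exact (continuous_const.mul continuous_fst).add (hc0.comp continuous_snd)
    bF := by
      intro x hx a ha
      rw [hf]
      have e1 : (B + a) * x ^ 2 ≤ (B + hmax) * γmax ^ 2 := by
        have := hx.1; have := hx.2; have := ha.1; have := ha.2
        gcongr
      have e2 : 2 * lam * x ≤ 2 * lam * γmax := by
        have := hx.2
        gcongr
      have e3 : 0 ≤ (B + a) * x ^ 2 := by have := ha.1; positivity
      have e4 : 0 ≤ 2 * lam * x := by have := hx.1; positivity
      have e5 : 0 ≤ σ₂ ^ 2 := by positivity
      rw [abs_le]
      constructor <;> linarith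
    bg := by
      intro x hx a ha
      rw [hge x a ha]
      have e1 : abar * x ≤ abar * γmax := by have := hx.2; gcongr
      have e2 := hcle a ha
      have e3 := hc_nonneg a ha.1
      have e4 : 0 ≤ abar * x := mul_nonneg habar.le hx.1
      rw [abs_le]
      constructor <;> linarith
    g0 := by
      intro x hx a ha
      rw [hge x a ha]
      exact add_nonneg (mul_nonneg habar.le hx.1) (hc_nonneg a ha.1)
    lF := by
      intro x hx y hy a ha
      rw [hf, hf]
      have e : -(B + a) * x ^ 2 - 2 * lam * x + σ₂ ^ 2 - (-(B + a) * y ^ 2 - 2 * lam * y + σ₂ ^ 2)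
          = -((B + a) * (x + y) + 2 * lam) * (x - y) := by ring
      rw [e, abs_mul, abs_neg]
      refine mul_le_mul_of_nonneg_right ?_ (abs_nonneg _)
      have h1 := hx.1
      have h2 := hy.1
      have h3 := ha.1
      rw [abs_of_nonneg (by positivity)]
      have : (B + a) * (x + y) ≤ (B + hmax) * (2 * γmax) :=
        mul_le_mul (by linarith [ha.2]) (by linarith [hx.2, hy.2]) (by positivity) (by positivity)
      linarith
    lg := by
      intro x hx y hy a ha
      have e : g x a - g y a = abar * (x - y) := by simp only [hg]; ring
      rw [e, abs_mul, abs_of_pos habar]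
      exact mul_le_mul_of_nonneg_right (by linarith) (abs_nonneg _)
    s0 := fun h hh x hx => (hsol h ((hAdm h).2 hh) x hx).1
    sc := fun h hh x hx => (hsol h ((hAdm h).2 hh) x hx).2.1
    sm := fun h hh x hx => (hsol h ((hAdm h).2 hh) x hx).2.2.1
    se := fun h hh x hx => (hsol h ((hAdm h).2 hh) x hx).2.2.2
    hv := by
      intro x hx
      rw [hv x hx]
      have hset : {h : ℝ → ℝ | Adm h} = {h | Measurable h ∧ ∀ t, h t ∈ Icc 0 hmax} := by
        ext h; exact hAdm h
      rw [hset]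
      congr 1
      refine image_congr (fun h hh => ?_)
      rw [hJ]
      refine integral_congr_ae (Eventually.of_forall (fun t => ?_))
      simp only
      rw [hge _ _ (hh.2 t)] }
  have hγ' : γ ∈ Icc 0 γmax := ⟨hγ.1.le, hγ.2.le⟩
  have hd := hv'_deriv γ hγ
  have hcont : ContinuousOn (fun h => f γ h * v' γ + abar * γ + c h) (Icc 0 hmax) := by
    have h1 : ContinuousOn c (Icc 0 hmax) := hcc.mono (fun a ha => ha.1)
    have h2 : Continuous (fun h => f γ h * v' γ + abar * γ) := by
      simp only [hf]; fun_prop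
    exact h2.continuousOn.add h1
  obtain ⟨a, ha, hmin⟩ := isCompact_Icc.exists_isMinOn ⟨0, le_rfl, hhmax.le⟩ hcont
  refine ⟨_, ⟨⟨a, ha, rfl⟩, ?_⟩, ?_⟩
  · rintro _ ⟨b, hb, rfl⟩
    exact hmin hb
  · have h1 := S.hjb_sub hγ' hd ha
    have h2 := S.hjb_super hγ' hd (m := f γ a * v' γ + abar * γ + c a) (fun b hb => by
      have := hmin hb
      rw [hge γ b hb]
      simp only [mem_setOf_eq] at this
      linarith)
    rw [hge γ a ha] at h1
    simp only
    linarith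
end

section
/- For every γ₀ ∈ [0, γ_max], the feedback ordinary differential equation γ'(t) = f(γ(t), H*(γ(t))), γ(0) = γ₀, admits a unique solution γ* : [0,∞) → [0, γ_max]; the control h*(t) := H*(γ*(t)) is continuous with values in [0, h_max]; and h* is optimal, i.e. J(h*; γ₀) = v(γ₀). -/
section Helpers14

open Set Filter Topology


theorem ode_core (F : ℝ → ℝ) (hF : Continuous F) (x0 z : ℝ) (hx : x0 < z)
    (hpos : ∀ x < z, 0 < F x) (hz : F z = 0) :
    ∃ g : ℝ → ℝ, g 0 = x0 ∧ ∀ t ∈ Ici (0:ℝ), g t ∈ Icc x0 z ∧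
      HasDerivWithinAt g (F (g t)) (Ici 0) t := by
  set T : ℝ → ℝ := fun x => ∫ s in x0..x, (F s)⁻¹ with hT
  have hcont : ContinuousOn (fun s => (F s)⁻¹) (Iio z) :=
    hF.continuousOn.inv₀ (fun x hx => (hpos x hx).ne')
  have hTd : ∀ x < z, HasDerivAt T (F x)⁻¹ x := by
    intro x hxz
    apply intervalIntegral.integral_hasDerivAt_right
    · apply ContinuousOn.intervalIntegrable
      apply hcont.mono
      intro y hy
      rcases hy with ⟨_, h2⟩
      exact lt_of_le_of_lt h2 (max_lt hx hxz)
    · exact hcont.stronglyMeasurableAtFilter isOpen_Iio x hxz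
    · exact hcont.continuousAt (Iio_mem_nhds hxz)
  have hTs : ∀ x < z, HasStrictDerivAt T (F x)⁻¹ x := by
    intro x hxz
    refine hasStrictDerivAt_of_hasDerivAt_of_continuousAt (f' := fun s => (F s)⁻¹) ?_
      (hcont.continuousAt (Iio_mem_nhds hxz))
    filter_upwards [Iio_mem_nhds hxz] with y hy using hTd y hy
  have hTc : ContinuousOn T (Iio z) := fun x hx => (hTd x hx).continuousAt.continuousWithinAt
  have hmvt : ∀ x y, x < y → y < z → ∃ c ∈ Ioo x y, (F c)⁻¹ * (y - x) = T y - T x := by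
    intro x y hxy hyz
    obtain ⟨c, hc, h⟩ := exists_hasDerivAt_eq_slope T (fun s => (F s)⁻¹) hxy
      (hTc.mono (fun w hw => lt_of_le_of_lt hw.2 hyz))
      (fun w hw => hTd w (hw.2.trans hyz))
    refine ⟨c, hc, ?_⟩
    rw [h, div_mul_cancel₀]
    linarith
  have hmono : StrictMonoOn T (Iio z) := by
    intro x hx y hy hxy
    obtain ⟨c, hc, h⟩ := hmvt x y hxy hy
    have : 0 < (F c)⁻¹ := inv_pos.2 (hpos c (hc.2.trans hy))
    have : 0 < (F c)⁻¹ * (y - x) := mul_pos this (by linarith)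
    linarith
  have hT0 : T x0 = 0 := by simp [hT]
  classical
  let g : ℝ → ℝ := fun t => if h : ∃ x, x < z ∧ T x = t then h.choose else z
  have hgT : ∀ x < z, g (T x) = x := by
    intro x hxz
    have h : ∃ y, y < z ∧ T y = T x := ⟨x, hxz, rfl⟩
    have : g (T x) = h.choose := dif_pos h
    rw [this]
    exact hmono.injOn h.choose_spec.1 hxz h.choose_spec.2
  have hgn : ∀ t, (¬ ∃ x, x < z ∧ T x = t) → g t = z := fun t h => dif_neg h
  refine ⟨g, by rw [← hT0]; exact hgT x0 hx, ?_⟩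
  intro t ht
  by_cases hS : ∃ x, x < z ∧ T x = t
  · obtain ⟨x, hxz, rfl⟩ := hS
    rw [hgT x hxz]
    refine ⟨⟨?_, hxz.le⟩, ?_⟩
    · rw [← hmono.le_iff_le hx hxz, hT0]; exact ht
    · have := (hTs x hxz).to_local_left_inverse (inv_ne_zero (hpos x hxz).ne') (g := g)
        (by filter_upwards [Iio_mem_nhds hxz] with y hy using hgT y hy)
      rw [inv_inv] at this
      exact this.hasDerivAt.hasDerivWithinAt
  · have hlt : ∀ x < z, T x < t := by
      intro x hxz
      by_contra hcon
      push Not at hcon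
      apply hS
      have hIVT := intermediate_value_uIcc (f := T) (a := x0) (b := x) (hTc.mono (by
        intro y hy
        exact lt_of_le_of_lt hy.2 (max_lt hx hxz)))
      have : t ∈ uIcc (T x0) (T x) := by
        rw [hT0, uIcc_of_le (le_trans ht hcon)]; exact ⟨ht, hcon⟩
      obtain ⟨y, hy, hyt⟩ := hIVT this
      exact ⟨y, lt_of_le_of_lt hy.2 (max_lt hx hxz), hyt⟩
    rw [hgn t hS, hz]
    refine ⟨⟨hx.le, le_rfl⟩, ?_⟩
    apply HasDerivAt.hasDerivWithinAt
    rw [hasDerivAt_iff_isLittleO, Asymptotics.isLittleO_iff]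
    intro ε hε
    have hev : ∀ᶠ y in 𝓝 z, F y < ε := by
      apply hF.continuousAt.eventually_lt_const
      rw [hz]; exact hε
    obtain ⟨a, ha, hab⟩ : ∃ a < z, ∀ y ∈ Ioo a z, F y < ε := by
      obtain ⟨l, u, hlu, hsub⟩ := (mem_nhds_iff_exists_Ioo_subset).1 hev
      exact ⟨l, hlu.1, fun y hy => hsub ⟨hy.1, hy.2.trans hlu.2⟩⟩
    filter_upwards [Ioi_mem_nhds (hlt a ha)] with s hs
    rw [hgn t hS]
    by_cases hs' : ∃ x, x < z ∧ T x = s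
    · obtain ⟨x, hxz, rfl⟩ := hs'
      rw [hgT x hxz]
      have hax : a < x := (hmono.lt_iff_lt ha hxz).1 hs
      have h1 : ∀ y, x < y → y < z → y ≤ x + ε * (t - T x) := by
        intro y hxy hyz
        obtain ⟨c, hc, h⟩ := hmvt x y hxy hyz
        have hFc := hpos c (hc.2.trans hyz)
        have hFc2 := hab c ⟨hax.trans hc.1, hc.2.trans hyz⟩
        have h3 : y - x = F c * (T y - T x) := by
          rw [← h]; field_simp
        have h4 : 0 < T y - T x := sub_pos.2 (hmono hxz hyz hxy)
        have h5 := hlt y hyz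
        nlinarith
      have h2 : z ≤ x + ε * (t - T x) := by
        apply le_of_forall_lt_imp_le_of_dense
        intro y hy
        rcases lt_or_ge x y with h | h
        · exact h1 y h hy
        · have := hlt x hxz
          nlinarith
      have := hlt x hxz
      simp only [smul_zero, sub_zero, Real.norm_eq_abs]
      rw [abs_of_neg (by linarith), abs_of_neg (by linarith)]
      linarith
    · rw [hgn s hs']
      simp
      positivity

theorem ode_up (F : ℝ → ℝ) (hF : Continuous F) (a b x0 : ℝ) (hx : x0 ∈ Icc a b)
    (h0 : 0 < F x0) (hb : F b ≤ 0) :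
    ∃ g : ℝ → ℝ, g 0 = x0 ∧ ∀ t ∈ Ici (0:ℝ), g t ∈ Icc a b ∧
      HasDerivWithinAt g (F (g t)) (Ici 0) t := by
  have hcl : IsClosed {x | x ∈ Icc x0 b ∧ F x ≤ 0} :=
    isClosed_Icc.inter (isClosed_le hF continuous_const)
  have hne : ({x | x ∈ Icc x0 b ∧ F x ≤ 0}).Nonempty := ⟨b, ⟨hx.2, le_rfl⟩, hb⟩
  have hbd : BddBelow {x | x ∈ Icc x0 b ∧ F x ≤ 0} := ⟨x0, fun y hy => hy.1.1⟩
  set z := sInf {x | x ∈ Icc x0 b ∧ F x ≤ 0} with hzdef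
  have hzm := hcl.csInf_mem hne hbd
  rw [← hzdef] at hzm
  have hpos : ∀ x ∈ Ico x0 z, 0 < F x := by
    intro x hxm
    by_contra hcon
    push Not at hcon
    have : z ≤ x := csInf_le hbd ⟨⟨hxm.1, hxm.2.le.trans hzm.1.2⟩, hcon⟩
    linarith [hxm.2]
  have hxz : x0 < z := by
    rcases hzm.1.1.lt_or_eq with h | h
    · exact h
    · have := hzm.2; rw [← h] at this; linarith
  have hz : F z = 0 := by
    apply le_antisymm hzm.2
    have : Tendsto F (𝓝[<] z) (𝓝 (F z)) := hF.continuousAt.mono_left nhdsWithin_le_nhds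
    apply ge_of_tendsto this
    filter_upwards [Ioo_mem_nhdsLT hxz] with y hy using (hpos y ⟨hy.1.le, hy.2⟩).le
  obtain ⟨g, hg0, hg⟩ := ode_core (fun x => F (max x x0)) (by fun_prop) x0 z hxz
    (fun x hx' => hpos _ ⟨le_max_right _ _, max_lt hx' hxz⟩) (by simp [max_eq_left hxz.le, hz])
  refine ⟨g, hg0, fun t ht => ?_⟩
  obtain ⟨h1, h2⟩ := hg t ht
  refine ⟨⟨hx.1.trans h1.1, h1.2.trans hzm.1.2⟩, ?_⟩
  simpa only [max_eq_left h1.1] using h2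

theorem ode_exists (F : ℝ → ℝ) (a b x0 : ℝ) (hF : ContinuousOn F (Icc a b)) (hx : x0 ∈ Icc a b)
    (ha : 0 ≤ F a) (hb : F b ≤ 0) :
    ∃ g : ℝ → ℝ, g 0 = x0 ∧ ∀ t ∈ Ici (0:ℝ), g t ∈ Icc a b ∧
      HasDerivWithinAt g (F (g t)) (Ici 0) t := by
  have hab : a ≤ b := hx.1.trans hx.2
  have key : ∃ g : ℝ → ℝ, g 0 = x0 ∧ ∀ t ∈ Ici (0:ℝ), g t ∈ Icc a b ∧
      HasDerivWithinAt g (IccExtend hab ((Icc a b).domRestrict F) (g t)) (Ici 0) t := by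
    set G := IccExtend hab ((Icc a b).domRestrict F) with hG
    have hGc : Continuous G := hF.domRestrict.Icc_extend'
    have hGe : ∀ x ∈ Icc a b, G x = F x := fun x hx => by
      rw [hG, IccExtend_of_mem _ _ hx]; rfl
    have hGa : 0 ≤ G a := by rwa [hGe a ⟨le_rfl, hab⟩]
    have hGb : G b ≤ 0 := by rwa [hGe b ⟨hab, le_rfl⟩]
    rcases lt_trichotomy (G x0) 0 with h | h | h
    · obtain ⟨g, hg0, hg⟩ := ode_up (fun x => - G (-x)) (by fun_prop) (-b) (-a) (-x0)
        ⟨by linarith [hx.2], by linarith [hx.1]⟩ (by simpa using h) (by simpa using hGa)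
      refine ⟨fun t => - g t, by simp [hg0], fun t ht => ?_⟩
      obtain ⟨h1, h2⟩ := hg t ht
      refine ⟨⟨by linarith [h1.2], by linarith [h1.1]⟩, ?_⟩
      have h3 := h2.neg
      rw [neg_neg] at h3
      exact h3
    · exact ⟨fun _ => x0, rfl, fun t ht => ⟨hx, by rw [h]; exact hasDerivWithinAt_const _ _ _⟩⟩
    · exact ode_up G hGc a b x0 hx h hGb
  obtain ⟨g, h0, hg⟩ := key
  refine ⟨g, h0, fun t ht => ⟨(hg t ht).1, ?_⟩⟩
  have := (hg t ht).2
  rwa [IccExtend_of_mem _ _ (hg t ht).1] at this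

theorem concave_deriv_cont (v v' : ℝ → ℝ) (M : ℝ) (hM : 0 < M)
    (hconc : ConcaveOn ℝ (Icc 0 M) v)
    (hd : ∀ x ∈ Icc (0:ℝ) M, HasDerivWithinAt v (v' x) (Icc 0 M) x)
    (hc : ContinuousOn v' (Ioo 0 M)) : ContinuousOn v' (Icc 0 M) := by
  have h1 : ∀ x ∈ Icc 0 M, ∀ y ∈ Icc 0 M, x < y → v y - v x ≤ v' x * (y - x) := by
    intro x hx y hy hxy
    have := hconc.slope_le_of_hasDerivWithinAt hx hy hxy (hd x hx)
    rw [slope_def_field, div_le_iff₀ (by linarith)] at this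
    exact this
  have h2 : ∀ x ∈ Icc 0 M, ∀ y ∈ Icc 0 M, x < y → v' y * (y - x) ≤ v y - v x := by
    intro x hx y hy hxy
    have := hconc.le_slope_of_hasDerivWithinAt hx hy hxy (hd y hy)
    rw [slope_def_field, le_div_iff₀ (by linarith)] at this
    exact this
  have hanti : ∀ x ∈ Icc 0 M, ∀ y ∈ Icc 0 M, x ≤ y → v' y ≤ v' x := by
    intro x hx y hy hxy
    rcases hxy.eq_or_lt with rfl | h
    · rfl
    · have a := h1 x hx y hy h
      have b := h2 x hx y hy h
      have : v' y * (y - x) ≤ v' x * (y - x) := b.trans a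
      exact le_of_mul_le_mul_right this (by linarith)
  intro x hx
  rcases hx.1.eq_or_lt with h0 | h0
  · subst h0
    rw [Metric.continuousWithinAt_iff]
    intro ε hε
    have hs := (hd 0 hx).isLittleO
    rw [Asymptotics.isLittleO_iff] at hs
    have hs := hs (show (0:ℝ) < ε/4 by linarith)
    rw [eventually_nhdsWithin_iff, Metric.eventually_nhds_iff] at hs
    obtain ⟨r, hr, hs⟩ := hs
    refine ⟨min (r/2) (M/2), by positivity, ?_⟩
    intro y hy hy2
    rw [Real.dist_eq, sub_zero] at hy2
    rw [abs_of_nonneg hy.1] at hy2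
    have hy3 := lt_of_lt_of_le hy2 (min_le_left _ _)
    have hy4 := lt_of_lt_of_le hy2 (min_le_right _ _)
    have hle := hanti 0 hx y hy hy.1
    rcases hy.1.eq_or_lt with h | h
    · subst h; simpa using hε
    have A := hs (y := y) (by rw [Real.dist_eq, sub_zero, abs_of_pos h]; linarith) hy
    have B := hs (y := 2*y) (by rw [Real.dist_eq, sub_zero, abs_of_pos (by linarith)]; linarith)
      ⟨by linarith, by linarith⟩
    simp only [sub_zero, smul_eq_mul, Real.norm_eq_abs] at A B
    rw [abs_of_pos h, abs_le] at A
    rw [abs_of_pos (show (0:ℝ) < 2*y by linarith), abs_le] at B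
    have D := h1 y hy (2*y) ⟨by linarith, by linarith⟩ (by linarith)
    rw [Real.dist_eq, abs_lt]
    constructor
    · have : (v' 0 - ε) * y < v' y * y := by nlinarith
      have := lt_of_mul_lt_mul_right this h.le
      linarith
    · linarith
  rcases hx.2.eq_or_lt with h1' | h1'
  · subst h1'
    rw [Metric.continuousWithinAt_iff]
    intro ε hε
    have hs := (hd x hx).isLittleO
    rw [Asymptotics.isLittleO_iff] at hs
    have hs := hs (show (0:ℝ) < ε/4 by linarith)
    rw [eventually_nhdsWithin_iff, Metric.eventually_nhds_iff] at hs
    obtain ⟨r, hr, hs⟩ := hs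
    refine ⟨min (r/2) (x/2), by positivity, ?_⟩
    intro y hy hy2
    rw [Real.dist_eq] at hy2
    rw [abs_of_nonpos (by linarith [hy.2])] at hy2
    have hy3 := lt_of_lt_of_le hy2 (min_le_left _ _)
    have hy4 := lt_of_lt_of_le hy2 (min_le_right _ _)
    have hle := hanti y hy x hx hy.2
    rcases hy.2.eq_or_lt with h | h
    · subst h; simpa using hε
    have A := hs (y := y) (by rw [Real.dist_eq, abs_of_neg (by linarith)]; linarith) hy
    have B := hs (y := 2*y-x) (by rw [Real.dist_eq, abs_of_neg (by linarith)]; linarith)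
      ⟨by linarith, by linarith⟩
    simp only [smul_eq_mul, Real.norm_eq_abs] at A B
    rw [abs_of_neg (show y - x < 0 by linarith), abs_le] at A
    rw [abs_of_neg (show 2*y - x - x < 0 by linarith), abs_le] at B
    have D := h2 (2*y-x) ⟨by linarith, by linarith⟩ y hy (by linarith)
    rw [Real.dist_eq, abs_lt]
    constructor
    · linarith
    · have : v' y * (x - y) < (v' x + ε) * (x - y) := by nlinarith
      have := lt_of_mul_lt_mul_right this (by linarith)
      linarith
  · exact (hc.continuousAt (Ioo_mem_nhds h0 h1')).continuousWithinAt

theorem feedback_cont (M hmax : ℝ) (hh : 0 < hmax) (c' w H : ℝ → ℝ)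
    (hc : ContinuousOn c' (Ici 0)) (hm : StrictMonoOn c' (Ici 0))
    (hw : ContinuousOn w (Icc 0 M))
    (hH : ∀ x ∈ Icc (0:ℝ) M, (w x < c' 0 → H x = 0) ∧
      (c' 0 ≤ w x → H x ∈ Icc (0:ℝ) hmax ∧ c' (H x) = w x)) :
    (∀ x ∈ Icc (0:ℝ) M, H x ∈ Icc 0 hmax) ∧ ContinuousOn H (Icc 0 M) := by
  have hr : ∀ x ∈ Icc (0:ℝ) M, H x ∈ Icc 0 hmax := by
    intro x hx
    rcases lt_or_ge (w x) (c' 0) with h | h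
    · rw [(hH x hx).1 h]; exact ⟨le_rfl, hh.le⟩
    · exact ((hH x hx).2 h).1
  refine ⟨hr, ?_⟩
  have he : ∀ x ∈ Icc (0:ℝ) M, c' (H x) = max (c' 0) (w x) := by
    intro x hx
    rcases lt_or_ge (w x) (c' 0) with h | h
    · rw [(hH x hx).1 h, max_eq_left h.le]
    · rw [((hH x hx).2 h).2, max_eq_right h]
  let e : Icc (0:ℝ) hmax → ℝ := fun y => c' y
  have hec : Continuous e := by
    have : ContinuousOn c' (Icc 0 hmax) := hc.mono (fun y hy => hy.1)
    exact this.domRestrict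
  have hei : Function.Injective e := by
    intro a b hab
    exact Subtype.ext (hm.injOn a.2.1 b.2.1 hab)
  have hemb := hec.isClosedEmbedding hei
  let K : Icc (0:ℝ) M → Icc (0:ℝ) hmax := fun x => ⟨H x, hr x x.2⟩
  have hK : Continuous K := by
    rw [hemb.isInducing.continuous_iff]
    have : e ∘ K = (Icc (0:ℝ) M).domRestrict (fun x => max (c' 0) (w x)) := by
      funext x
      exact he x x.2
    rw [this]
    apply ContinuousOn.domRestrict
    exact continuousOn_const.sup hw
  rw [continuousOn_iff_continuous_domRestrict]
  exact continuous_subtype_val.comp hK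

theorem feedback_min (c c' : ℝ → ℝ) (hconv : ConvexOn ℝ (Ici 0) c)
    (hd : ∀ x ∈ Ici (0 : ℝ), HasDerivWithinAt c (c' x) (Ici 0) x)
    (w H : ℝ) (h0 : w < c' 0 → H = 0) (h1 : c' 0 ≤ w → 0 ≤ H ∧ c' H = w)
    (h : ℝ) (hh : 0 ≤ h) : c H - H * w ≤ c h - h * w := by
  have tang : ∀ x, 0 ≤ x → ∀ y, 0 ≤ y → c x + c' x * (y - x) ≤ c y := by
    intro x hx y hy
    rcases lt_trichotomy x y with hxy | hxy | hxy
    · have := hconv.le_slope_of_hasDerivWithinAt hx hy hxy (hd x hx)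
      rw [slope_def_field, le_div_iff₀ (by linarith)] at this
      linarith
    · subst hxy; simp
    · have := hconv.slope_le_of_hasDerivWithinAt hy hx hxy (hd x hx)
      rw [slope_def_field, div_le_iff₀ (by linarith)] at this
      linarith
  rcases lt_or_ge w (c' 0) with hw | hw
  · rw [h0 hw]
    have := tang 0 le_rfl h hh
    nlinarith
  · obtain ⟨ha, hb⟩ := h1 hw
    have := tang H ha h hh
    rw [hb] at this
    linarith

theorem cprime_props (c c' : ℝ → ℝ) (hconv : StrictConvexOn ℝ (Ici 0) c)
    (hs : ContDiffOn ℝ 2 c (Ici 0))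
    (hd : ∀ x ∈ Ici (0 : ℝ), HasDerivWithinAt c (c' x) (Ici 0) x) :
    ContinuousOn c' (Ici 0) ∧ StrictMonoOn c' (Ici 0) := by
  have he : EqOn (derivWithin c (Ici 0)) c' (Ici 0) := fun x hx =>
    (hd x hx).derivWithin (uniqueDiffOn_Ici 0 x hx)
  constructor
  · exact (hs.continuousOn_derivWithin (uniqueDiffOn_Ici 0) (by norm_num)).congr he.symm
  · have := hconv.strictMonoOn_derivWithin (fun x hx => (hd x hx).differentiableWithinAt)
    exact this.congr he

/-- Riccati right-hand side. -/
def rf (s lam q : ℝ) (γ h : ℝ) : ℝ := -(s + h) * γ ^ 2 - 2 * lam * γ + q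

/-- normalised solution of the controlled integral equation -/
def IsSolN (s lam q M γ₀ : ℝ) (h X : ℝ → ℝ) : Prop :=
  Continuous X ∧ (∀ t, X t ∈ Icc 0 M) ∧
    ∀ t, 0 ≤ t → X t = γ₀ + ∫ r in (0:ℝ)..t, rf s lam q (X r) (h r)

/-- admissible control -/
def AdmN (hmax : ℝ) (h : ℝ → ℝ) : Prop := Measurable h ∧ ∀ t, h t ∈ Icc 0 hmax

/-- discounted cost -/
noncomputable def costN (δ abar : ℝ) (C h X : ℝ → ℝ) : ℝ :=
  ∫ t in Ioi (0:ℝ), Real.exp (-δ * t) * (abar * X t + C (h t))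

theorem ii_of_bdd (u : ℝ → ℝ) (hu : Measurable u) (B : ℝ) (hB : ∀ t, |u t| ≤ B) (a b : ℝ) :
    IntervalIntegrable u MeasureTheory.volume a b := by
  apply (intervalIntegrable_const (c := B)).mono_fun hu.aestronglyMeasurable
  filter_upwards with t
  rw [Real.norm_eq_abs, Real.norm_eq_abs]
  exact (hB t).trans (le_abs_self B)

theorem exp_int_of_bdd (δ : ℝ) (hδ : 0 < δ) (u : ℝ → ℝ) (hu : Measurable u) (B : ℝ)
    (hB : ∀ t, |u t| ≤ B) :
    MeasureTheory.IntegrableOn (fun t => Real.exp (-δ * t) * u t) (Ioi 0) := by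
  have h1 : MeasureTheory.IntegrableOn (fun t => Real.exp (-δ * t)) (Ioi (0:ℝ)) :=
    exp_neg_integrableOn_Ioi 0 hδ
  exact h1.mul_bdd hu.aestronglyMeasurable (c := B) (by filter_upwards with t using hB t)

theorem rf_bdd (s lam q M hmax : ℝ) (hs : 0 ≤ s) (hl : 0 ≤ lam) (hq : 0 ≤ q)
    (γ h : ℝ) (hγ : γ ∈ Icc 0 M) (hh : h ∈ Icc 0 hmax) :
    |rf s lam q γ h| ≤ (s + hmax) * M ^ 2 + 2 * lam * M + q := by
  obtain ⟨a, b⟩ := hγ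
  obtain ⟨c, d⟩ := hh
  have e0 : 0 ≤ s + hmax := by linarith
  have e1 : γ ^ 2 ≤ M ^ 2 := by gcongr
  have e2 : (s + h) * γ ^ 2 ≤ (s + hmax) * M ^ 2 := by gcongr
  have e3 : 2 * lam * γ ≤ 2 * lam * M := by gcongr
  have e4 : 0 ≤ (s + h) * γ ^ 2 := by positivity
  have e5 : 0 ≤ 2 * lam * γ := by positivity
  rw [abs_le, rf]
  constructor <;> linarith

theorem rf_lip (s lam q M hmax : ℝ) (hs : 0 ≤ s) (hl : 0 ≤ lam)
    (a b h : ℝ) (ha : a ∈ Icc 0 M) (hb : b ∈ Icc 0 M) (hh : h ∈ Icc 0 hmax) :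
    |rf s lam q a h - rf s lam q b h| ≤ ((s + hmax) * (2 * M) + 2 * lam) * |a - b| := by
  have : rf s lam q a h - rf s lam q b h = -((s + h) * (a + b) + 2 * lam) * (a - b) := by
    unfold rf; ring
  rw [this, abs_mul, abs_neg]
  obtain ⟨a1, a2⟩ := ha
  obtain ⟨b1, b2⟩ := hb
  obtain ⟨c, d⟩ := hh
  gcongr
  rw [abs_of_nonneg (by positivity)]
  have e0 : a + b ≤ 2 * M := by linarith
  gcongr
  linarith

theorem rf_meas (s lam q : ℝ) (X h : ℝ → ℝ) (hX : Continuous X) (hh : Measurable h) :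
    Measurable (fun t => rf s lam q (X t) (h t)) := by
  unfold rf
  have := hX.measurable
  fun_prop

theorem gron_zero (K : ℝ) (φ : ℝ → ℝ) (hc : Continuous φ)
    (hb : ∀ t, 0 ≤ t → |φ t| ≤ K * ∫ r in (0:ℝ)..t, |φ r|) : ∀ t, 0 ≤ t → φ t = 0 := by
  intro t ht
  have hd : ∀ x, HasDerivAt (fun t => ∫ r in (0:ℝ)..t, |φ r|) |φ x| x := fun x =>
    intervalIntegral.integral_hasDerivAt_right (hc.abs.intervalIntegrable _ _)
      hc.abs.aestronglyMeasurable.stronglyMeasurableAtFilter hc.abs.continuousAt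
  have hnn : ∀ x, 0 ≤ x → 0 ≤ ∫ r in (0:ℝ)..x, |φ r| := fun x hx =>
    intervalIntegral.integral_nonneg hx (fun _ _ => abs_nonneg _)
  have hz := eq_zero_of_abs_deriv_le_mul_abs_self_of_eq_zero_right (K := K) (a := 0) (b := t)
    (f := fun t => ∫ r in (0:ℝ)..t, |φ r|) (f' := fun x => |φ x|)
    (fun x _ => (hd x).continuousAt.continuousWithinAt)
    (fun x _ => (hd x).hasDerivWithinAt) (by simp)
    (fun x hx => by
      rw [Real.norm_eq_abs, Real.norm_eq_abs, abs_abs, abs_of_nonneg (hnn x hx.1)]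
      exact hb x hx.1) t ⟨ht, le_rfl⟩
  have := hb t ht
  rw [hz, mul_zero] at this
  exact abs_eq_zero.1 (le_antisymm this (abs_nonneg _))

theorem sol_unique (s lam q M hmax γ₀ : ℝ) (hs : 0 ≤ s) (hl : 0 ≤ lam) (hq : 0 ≤ q)
    (h X Y : ℝ → ℝ) (hh : AdmN hmax h) (hX : IsSolN s lam q M γ₀ h X)
    (hY : IsSolN s lam q M γ₀ h Y) : ∀ t, 0 ≤ t → X t = Y t := by
  intro t ht
  have := gron_zero ((s + hmax) * (2 * M) + 2 * lam) (fun t => X t - Y t)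
    (hX.1.sub hY.1) ?_ t ht
  · linarith
  intro t ht
  have iX := ii_of_bdd _ (rf_meas s lam q X h hX.1 hh.1) _
    (fun t => rf_bdd s lam q M hmax hs hl hq _ _ (hX.2.1 t) (hh.2 t)) 0 t
  have iY := ii_of_bdd _ (rf_meas s lam q Y h hY.1 hh.1) _
    (fun t => rf_bdd s lam q M hmax hs hl hq _ _ (hY.2.1 t) (hh.2 t)) 0 t
  have e : X t - Y t = ∫ r in (0:ℝ)..t, (rf s lam q (X r) (h r) - rf s lam q (Y r) (h r)) := by
    rw [intervalIntegral.integral_sub iX iY, hX.2.2 t ht, hY.2.2 t ht]; ring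
  rw [e, ← intervalIntegral.integral_const_mul]
  refine (intervalIntegral.abs_integral_le_integral_abs ht).trans ?_
  apply intervalIntegral.integral_mono_on ht (iX.sub iY).abs
  · exact ((hX.1.sub hY.1).abs.const_mul _).intervalIntegrable _ _
  · intro r _
    exact rf_lip s lam q M hmax hs hl _ _ _ (hX.2.1 r) (hY.2.1 r) (hh.2 r)

theorem sol_shift (s lam q M hmax γ₀ : ℝ) (hs : 0 ≤ s) (hl : 0 ≤ lam) (hq : 0 ≤ q)
    (h X : ℝ → ℝ) (hh : AdmN hmax h) (hX : IsSolN s lam q M γ₀ h X) (τ : ℝ) (hτ : 0 ≤ τ) :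
    IsSolN s lam q M (X τ) (fun t => h (t + τ)) (fun t => X (t + τ)) := by
  refine ⟨hX.1.comp (continuous_id.add continuous_const), fun t => hX.2.1 _, fun t ht => ?_⟩
  have i := fun a b => ii_of_bdd _ (rf_meas s lam q X h hX.1 hh.1) _
    (fun t => rf_bdd s lam q M hmax hs hl hq _ _ (hX.2.1 t) (hh.2 t)) a b
  have := intervalIntegral.integral_comp_add_right (a := 0) (b := t)
    (fun r => rf s lam q (X r) (h r)) τ
  rw [this]
  change X (t + τ) = _
  rw [hX.2.2 (t + τ) (by linarith), hX.2.2 τ hτ, zero_add, add_assoc,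
    intervalIntegral.integral_add_adjacent_intervals (i _ _) (i _ _)]

theorem run_bdd (abar M hmax : ℝ) (ha : 0 ≤ abar) (C h X : ℝ → ℝ) (hC : Continuous C)
    (hCn : ∀ x, 0 ≤ C x) (hh : AdmN hmax h) (hXc : Continuous X) (hX : ∀ t, X t ∈ Icc 0 M) :
    Measurable (fun t => abar * X t + C (h t)) ∧ (∀ t, 0 ≤ abar * X t + C (h t)) ∧
    ∃ B, ∀ t, |abar * X t + C (h t)| ≤ B := by
  have hnn : ∀ t, 0 ≤ abar * X t + C (h t) := fun t => by
    have := (hX t).1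
    have := hCn (h t)
    positivity
  refine ⟨(hXc.measurable.const_mul _).add (hC.measurable.comp hh.1), hnn, ?_⟩
  obtain ⟨B, hB⟩ := (isCompact_Icc (a := 0) (b := hmax)).bddAbove_image hC.continuousOn
  refine ⟨abar * M + B, fun t => ?_⟩
  rw [abs_of_nonneg (hnn t)]
  have h1 : C (h t) ≤ B := hB ⟨h t, hh.2 t, rfl⟩
  have h2 : abar * X t ≤ abar * M := by
    have := (hX t).2
    gcongr
  linarith

theorem cost_split (δ abar M hmax : ℝ) (hδ : 0 < δ) (ha : 0 ≤ abar) (C h X : ℝ → ℝ)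
    (hC : Continuous C)
    (hCn : ∀ x, 0 ≤ C x) (hh : AdmN hmax h) (hXc : Continuous X) (hX : ∀ t, X t ∈ Icc 0 M)
    (τ : ℝ) (hτ : 0 ≤ τ) :
    costN δ abar C h X = (∫ t in (0:ℝ)..τ, Real.exp (-δ * t) * (abar * X t + C (h t))) +
      Real.exp (-δ * τ) * costN δ abar C (fun t => h (t + τ)) (fun t => X (t + τ)) := by
  obtain ⟨hm, hnn, B, hB⟩ := run_bdd abar M hmax ha C h X hC hCn hh hXc hX
  have hint := exp_int_of_bdd δ hδ _ hm B hB
  have e1 : costN δ abar C (fun t => h (t + τ)) (fun t => X (t + τ)) =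
      ∫ t in Ioi τ, Real.exp (-δ * (t - τ)) * (abar * X t + C (h t)) := by
    unfold costN
    have := (MeasureTheory.measurePreserving_add_right MeasureTheory.volume τ).setIntegral_preimage_emb
      (measurableEmbedding_addRight τ)
      (fun t => Real.exp (-δ * (t - τ)) * (abar * X t + C (h t))) (Ioi τ)
    simpa using this
  rw [e1, ← MeasureTheory.integral_const_mul]
  have e2 : ∀ t, Real.exp (-δ * τ) * (Real.exp (-δ * (t - τ)) * (abar * X t + C (h t))) =
      Real.exp (-δ * t) * (abar * X t + C (h t)) := by
    intro t
    rw [← mul_assoc, ← Real.exp_add]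
    congr 2; ring
  simp only [e2]
  unfold costN
  rw [intervalIntegral.integral_of_le hτ, ← MeasureTheory.setIntegral_union
    (Set.Ioc_disjoint_Ioi le_rfl) measurableSet_Ioi
    (hint.mono_set Ioc_subset_Ioi_self) (hint.mono_set (Ioi_subset_Ioi hτ)),
    Ioc_union_Ioi_eq_Ioi hτ]

theorem supersol (s lam q M hmax δ abar : ℝ) (hs : 0 ≤ s) (hl : 0 ≤ lam) (hq : 0 ≤ q)
    (hδ : 0 < δ) (ha : 0 ≤ abar) (hM : 0 ≤ M) (hhm : 0 ≤ hmax)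
    (C : ℝ → ℝ) (hC : Continuous C) (hCn : ∀ x, 0 ≤ C x)
    (v : ℝ → ℝ) (x p P : ℝ)
    (hd : HasDerivWithinAt v p (Icc 0 M) x)
    (hP : ∀ h ∈ Icc 0 hmax, P ≤ abar * x + C h + p * rf s lam q x h)
    (hx : x ∈ Icc 0 M)
    (hdpp : ∀ τ > 0, ∀ ε > 0, ∃ h X, AdmN hmax h ∧ IsSolN s lam q M x h X ∧
      (∫ t in (0:ℝ)..τ, Real.exp (-δ * t) * (abar * X t + C (h t))) +
        Real.exp (-δ * τ) * v (X τ) ≤ v x + ε) :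
    P ≤ δ * v x := by
  set B := (s + hmax) * M ^ 2 + 2 * lam * M + q with hB
  have hB0 : 0 ≤ B := by positivity
  set K := (s + hmax) * (2 * M) + 2 * lam with hK
  have hK0 : 0 ≤ K := by positivity
  set L := abar + |p| * K with hL
  have hL0 : 0 ≤ L := by positivity
  have main : ∀ η > 0, P - η * B ≤ δ * v x + η := by
    intro η hη
    have hlo := hd.isLittleO
    rw [Asymptotics.isLittleO_iff] at hlo
    have hlo := hlo hη
    rw [eventually_nhdsWithin_iff, Metric.eventually_nhds_iff] at hlo
    obtain ⟨r, hr, hlo⟩ := hlo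
    have ineq : ∀ τ ∈ Ioo 0 (r / (B + 1)), P - L * B * τ - η * B ≤
        (τ⁻¹ • (Real.exp (δ * (0 + τ)) - Real.exp (δ * 0))) * v x + Real.exp (δ * τ) * η := by
      intro τ hτ
      obtain ⟨h, X, hh, hX, hle⟩ := hdpp τ hτ.1 (η * τ) (mul_pos hη hτ.1)
      have hτ0 := hτ.1
      have hm := rf_meas s lam q X h hX.1 hh.1
      have hb := fun t => rf_bdd s lam q M hmax hs hl hq _ _ (hX.2.1 t) (hh.2 t)
      have hi := ii_of_bdd _ hm _ hb 0 τ
      have hdisp : ∀ t, 0 ≤ t → |X t - x| ≤ B * t := by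
        intro t ht
        have e : X t - x = ∫ r in (0:ℝ)..t, rf s lam q (X r) (h r) := by
          rw [hX.2.2 t ht]; ring
        rw [e]
        have := intervalIntegral.norm_integral_le_of_norm_le_const (a := 0) (b := t) (C := B)
          (f := fun r => rf s lam q (X r) (h r)) (fun r _ => hb r)
        rwa [sub_zero, abs_of_nonneg ht] at this
      obtain ⟨rm, rnn, B', rb⟩ := run_bdd abar M hmax ha C h X hC hCn hh hX.1 hX.2.1
      have ri := ii_of_bdd _ rm _ rb 0 τ
      have h1 : τ * (P - L * B * τ) ≤ (∫ t in (0:ℝ)..τ, (abar * X t + C (h t))) +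
          p * (X τ - x) := by
        have e : X τ - x = ∫ r in (0:ℝ)..τ, rf s lam q (X r) (h r) := by
          rw [hX.2.2 τ hτ0.le]; ring
        rw [e, ← intervalIntegral.integral_const_mul, ← intervalIntegral.integral_add ri
          (hi.const_mul p)]
        have e2 : τ * (P - L * B * τ) = ∫ t in (0:ℝ)..τ, (P - L * B * τ) := by
          simp
          ring
        rw [e2]
        apply intervalIntegral.integral_mono_on hτ0.le intervalIntegrable_const
          (ri.add (hi.const_mul p))
        intro t ht
        have a1 := hP (h t) (hh.2 t)
        have a2 := rf_lip s lam q M hmax hs hl (X t) x (h t) (hX.2.1 t) hx (hh.2 t)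
        have a3 : |X t - x| ≤ B * τ := (hdisp t ht.1).trans (by gcongr; exact ht.2)
        have a4 : |p * (rf s lam q (X t) (h t) - rf s lam q x (h t))| ≤ |p| * (K * |X t - x|) := by
          rw [abs_mul]; gcongr
        have a5 := neg_le_of_abs_le a4
        have a6 := neg_le_of_abs_le (le_refl |X t - x|)
        have a7 : abar * (-|X t - x|) ≤ abar * (X t - x) := by gcongr
        have a8 : L * |X t - x| ≤ L * (B * τ) := by gcongr
        have a9 : L * |X t - x| = abar * |X t - x| + |p| * (K * |X t - x|) := by
          rw [hL]; ring
        linarith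
      have h2 : Real.exp (-δ * τ) * (∫ t in (0:ℝ)..τ, (abar * X t + C (h t))) ≤
          ∫ t in (0:ℝ)..τ, Real.exp (-δ * t) * (abar * X t + C (h t)) := by
        rw [← intervalIntegral.integral_const_mul]
        apply intervalIntegral.integral_mono_on hτ0.le (ri.const_mul _)
        · exact ri.continuousOn_mul (by fun_prop)
        · intro t ht
          have := rnn t
          have := ht.2
          gcongr ?_ * _
          apply Real.exp_le_exp.2
          nlinarith
      have h3 : v x + p * (X τ - x) - η * (B * τ) ≤ v (X τ) := by
        have hdist : |X τ - x| < r := by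
          refine (hdisp τ hτ0.le).trans_lt ?_
          have := (lt_div_iff₀ (by positivity)).1 hτ.2
          nlinarith
        have := hlo (y := X τ) hdist (hX.2.1 τ)
        rw [Real.norm_eq_abs, Real.norm_eq_abs, smul_eq_mul] at this
        have b1 := neg_le_of_abs_le this
        have b2 : η * |X τ - x| ≤ η * (B * τ) := by
          have := hdisp τ hτ0.le
          gcongr
        linarith
      have h4 : Real.exp (δ * τ) * Real.exp (-δ * τ) = 1 := by
        rw [← Real.exp_add]; simp
      have h5 : (∫ t in (0:ℝ)..τ, (abar * X t + C (h t))) + v (X τ) ≤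
          Real.exp (δ * τ) * (v x + η * τ) := by
        have c1 : Real.exp (-δ * τ) * ((∫ t in (0:ℝ)..τ, (abar * X t + C (h t))) + v (X τ)) ≤
          v x + η * τ := by
          rw [mul_add]; linarith
        have c2 := mul_le_mul_of_nonneg_left c1 (Real.exp_pos (δ * τ)).le
        rwa [← mul_assoc, h4, one_mul] at c2
      have h6 : τ * (P - L * B * τ - η * B) ≤
          (Real.exp (δ * τ) - 1) * v x + τ * (Real.exp (δ * τ) * η) := by
        linarith
      have h7 : P - L * B * τ - η * B ≤
          τ⁻¹ * ((Real.exp (δ * τ) - 1) * v x + τ * (Real.exp (δ * τ) * η)) := by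
        rw [← div_eq_inv_mul, le_div_iff₀ hτ0]
        linarith
      refine h7.trans (le_of_eq ?_)
      simp only [zero_add, mul_zero, Real.exp_zero, smul_eq_mul]
      field_simp
    have hder : HasDerivAt (fun y => Real.exp (δ * y)) (Real.exp (δ * 0) * (δ * 1)) 0 :=
      ((hasDerivAt_id (0:ℝ)).const_mul δ).exp
    have t1 := hder.tendsto_slope_zero_right
    have t2 : Tendsto (fun τ => Real.exp (δ * τ) * η) (𝓝[>] 0) (𝓝 (Real.exp (δ * 0) * η)) :=
      ((by fun_prop : Continuous (fun τ => Real.exp (δ * τ) * η)).tendsto 0).mono_left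
        nhdsWithin_le_nhds
    have t3 : Tendsto (fun τ => P - L * B * τ - η * B) (𝓝[>] 0) (𝓝 (P - L * B * 0 - η * B)) :=
      ((by fun_prop : Continuous (fun τ => P - L * B * τ - η * B)).tendsto 0).mono_left
        nhdsWithin_le_nhds
    have t4 := le_of_tendsto_of_tendsto t3 ((t1.mul_const (v x)).add t2) (by
      filter_upwards [Ioo_mem_nhdsGT (show 0 < r / (B + 1) by positivity)] with τ hτ
      exact ineq τ hτ)
    simpa using t4
  apply le_of_forall_pos_le_add
  intro ε hε
  have := main (ε / (B + 1)) (by positivity)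
  have e : ε / (B + 1) * B + ε / (B + 1) = ε := by field_simp
  linarith

theorem feedback_isSol (s lam q M γ₀ : ℝ) (H g : ℝ → ℝ) (hH : ContinuousOn H (Icc 0 M))
    (hg0 : g 0 = γ₀) (hg : ∀ t ∈ Ici (0:ℝ), g t ∈ Icc 0 M ∧
      HasDerivWithinAt g (rf s lam q (g t) (H (g t))) (Ici 0) t) :
    Continuous (fun t => H (g (max t 0))) ∧
    IsSolN s lam q M γ₀ (fun t => H (g (max t 0))) (fun t => g (max t 0)) := by
  have hgc : ContinuousOn g (Ici 0) := fun t ht => (hg t ht).2.continuousWithinAt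
  have hXc : Continuous (fun t => g (max t 0)) :=
    hgc.comp_continuous (by fun_prop) (fun t => le_max_right t 0)
  have hHc : Continuous (fun t => H (g (max t 0))) :=
    hH.comp_continuous hXc (fun t => (hg _ (le_max_right t 0)).1)
  refine ⟨hHc, hXc, fun t => (hg _ (le_max_right t 0)).1, fun t ht => ?_⟩
  have hc2 : Continuous (fun r => rf s lam q (g (max r 0)) (H (g (max r 0)))) := by
    unfold rf
    exact (((continuous_const.add hHc).neg.mul (hXc.pow 2)).sub
      (continuous_const.mul hXc)).add continuous_const
  rw [intervalIntegral.integral_eq_sub_of_hasDerivAt_of_le ht hXc.continuousOn ?_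
    (hc2.intervalIntegrable _ _)]
  · simp [hg0]
  · intro r hr
    have h1 := (hg r hr.1.le).2.hasDerivAt (Ici_mem_nhds hr.1)
    rw [max_eq_left hr.1.le]
    apply h1.congr_of_eventuallyEq
    filter_upwards [Ioi_mem_nhds hr.1] with y hy
    rw [max_eq_left (le_of_lt hy)]

theorem verif (s lam q M hmax δ abar γ₀ : ℝ)
    (hδ : 0 < δ) (ha : 0 ≤ abar)
    (C : ℝ → ℝ) (hC : Continuous C) (hCn : ∀ x, 0 ≤ C x)
    (v v' H g : ℝ → ℝ) (hH : ContinuousOn H (Icc 0 M)) (hHr : ∀ x ∈ Icc 0 M, H x ∈ Icc 0 hmax)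
    (hg0 : g 0 = γ₀) (hg : ∀ t ∈ Ici (0:ℝ), g t ∈ Icc 0 M ∧
      HasDerivWithinAt g (rf s lam q (g t) (H (g t))) (Ici 0) t)
    (hd : ∀ x ∈ Icc 0 M, HasDerivWithinAt v (v' x) (Icc 0 M) x)
    (hvn : ∀ x ∈ Icc 0 M, 0 ≤ v x)
    (hjb : ∀ x ∈ Icc 0 M, abar * x + C (H x) + v' x * rf s lam q x (H x) ≤ δ * v x) :
    costN δ abar C (fun t => H (g (max t 0))) (fun t => g (max t 0)) ≤ v γ₀ := by
  obtain ⟨hHc, hXc, hXm, -⟩ := feedback_isSol s lam q M γ₀ H g hH hg0 hg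
  have hadm : AdmN hmax (fun t => H (g (max t 0))) := ⟨hHc.measurable, fun t => hHr _ (hXm t)⟩
  obtain ⟨rm, rnn, B, rb⟩ := run_bdd abar M hmax ha C _ _ hC hCn hadm hXc hXm
  have hint := exp_int_of_bdd δ hδ _ rm B rb
  have hlim := MeasureTheory.intervalIntegral_tendsto_integral_Ioi 0 hint tendsto_id
  refine le_of_tendsto hlim ?_
  filter_upwards [eventually_ge_atTop (0:ℝ)] with T hT
  set I : ℝ → ℝ := fun t => ∫ r in (0:ℝ)..t, Real.exp (-δ * r) *
    (abar * g (max r 0) + C (H (g (max r 0)))) with hI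
  have hrc : Continuous (fun r => Real.exp (-δ * r) *
    (abar * g (max r 0) + C (H (g (max r 0))))) := by
    exact (Real.continuous_exp.comp (continuous_const.mul continuous_id)).mul
      ((continuous_const.mul hXc).add (hC.comp hHc))
  have hId : ∀ x, HasDerivAt I (Real.exp (-δ * x) *
    (abar * g (max x 0) + C (H (g (max x 0))))) x := fun x =>
    intervalIntegral.integral_hasDerivAt_right (hrc.intervalIntegrable _ _)
      hrc.aestronglyMeasurable.stronglyMeasurableAtFilter hrc.continuousAt
  have hψ : ∀ t ∈ Ici (0:ℝ), HasDerivWithinAt (fun t => Real.exp (-δ * t) * v (g t) + I t)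
      ((Real.exp (-δ * t) * (-δ * 1)) * v (g t) + Real.exp (-δ * t) *
        (v' (g t) * rf s lam q (g t) (H (g t))) +
        Real.exp (-δ * t) * (abar * g (max t 0) + C (H (g (max t 0))))) (Ici 0) t := by
    intro t ht
    have d1 : HasDerivAt (fun t => Real.exp (-δ * t)) (Real.exp (-δ * t) * (-δ * 1)) t :=
      ((hasDerivAt_id t).const_mul (-δ)).exp
    have d2 : HasDerivWithinAt (fun t => v (g t)) (v' (g t) * rf s lam q (g t) (H (g t))) (Ici 0) t :=
      (hd (g t) (hg t ht).1).comp t (hg t ht).2 (fun r hr => (hg r hr).1)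
    exact (d1.hasDerivWithinAt.mul d2).add (hId t).hasDerivWithinAt
  have hanti : AntitoneOn (fun t => Real.exp (-δ * t) * v (g t) + I t) (Ici 0) := by
    refine antitoneOn_of_hasDerivWithinAt_nonpos (convex_Ici 0)
      (fun t ht => (hψ t ht).continuousWithinAt)
      (fun t ht => (hψ t (interior_subset ht)).mono interior_subset) ?_
    intro t ht
    have ht' : 0 ≤ t := interior_subset ht
    rw [max_eq_left ht']
    have h1 := hjb (g t) (hg t ht').1
    have h2 := Real.exp_pos (-δ * t)
    nlinarith
  have h3 := hanti (mem_Ici.2 le_rfl) (mem_Ici.2 hT) hT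
  have h4 : I 0 = 0 := by simp [hI]
  simp only [h4, mul_zero, Real.exp_zero, one_mul, add_zero, hg0] at h3
  have h5 : 0 ≤ Real.exp (-δ * T) * v (g T) :=
    mul_nonneg (Real.exp_pos _).le (hvn _ (hg T hT).1)
  change I T ≤ v γ₀
  linarith

theorem isSol_deriv (s lam q M γ₀ : ℝ) (h X : ℝ → ℝ) (hc : Continuous h)
    (hX : IsSolN s lam q M γ₀ h X) :
    X 0 = γ₀ ∧ ∀ t, 0 < t → HasDerivAt X (rf s lam q (X t) (h t)) t := by
  constructor
  · simpa using hX.2.2 0 le_rfl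
  · intro t ht
    have hc2 : Continuous (fun r => rf s lam q (X r) (h r)) := by
      unfold rf
      exact (((continuous_const.add hc).neg.mul (hX.1.pow 2)).sub
        (continuous_const.mul hX.1)).add continuous_const
    have := (intervalIntegral.integral_hasDerivAt_right (hc2.intervalIntegrable 0 t)
      hc2.aestronglyMeasurable.stronglyMeasurableAtFilter hc2.continuousAt).const_add γ₀
    apply this.congr_of_eventuallyEq
    filter_upwards [Ioi_mem_nhds ht] with y hy
    exact hX.2.2 y (le_of_lt hy)

theorem sol_pos (s lam q M hmax : ℝ) (hs : 0 ≤ s) (hl : 0 ≤ lam) (hq : 0 ≤ q)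
    (h a : ℝ → ℝ) (ha : Continuous a) (hr : ∀ t, a t ∈ Icc 0 M) (hh : ∀ t, h t ∈ Icc 0 hmax)
    (hd : ∀ t, 0 < t → HasDerivAt a (rf s lam q (a t) (h t)) t) (h0 : 0 < a 0 ∨ 0 < q) :
    ∀ t, 0 < t → 0 < a t := by
  intro t ht
  rcases h0 with h0 | h0
  · set K := (s + hmax) * M + 2 * lam with hK
    have hE : ∀ t, 0 < t → HasDerivAt (fun t => Real.exp (K * t) * a t)
        ((Real.exp (K * t) * (K * 1)) * a t + Real.exp (K * t) * rf s lam q (a t) (h t)) t := by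
      intro t ht
      exact (((hasDerivAt_id t).const_mul K).exp).mul (hd t ht)
    have hmono : MonotoneOn (fun t => Real.exp (K * t) * a t) (Ici 0) := by
      refine monotoneOn_of_hasDerivWithinAt_nonneg (convex_Ici 0) (by fun_prop)
        (fun t ht => (hE t (by simpa using ht)).hasDerivWithinAt) ?_
      intro t _
      obtain ⟨a1, a2⟩ := hr t
      obtain ⟨b1, b2⟩ := hh t
      have e1 : 0 ≤ K * a t + rf s lam q (a t) (h t) := by
        have : K * a t + rf s lam q (a t) (h t) =
          a t * ((s + hmax) * M - (s + h t) * a t) + q := by rw [hK]; unfold rf; ring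
        rw [this]
        have e2 : (s + h t) * a t ≤ (s + hmax) * M := by
          have : 0 ≤ s + hmax := by linarith
          gcongr
        have : 0 ≤ a t * ((s + hmax) * M - (s + h t) * a t) := mul_nonneg a1 (by linarith)
        linarith
      have e3 := mul_nonneg (Real.exp_pos (K * t)).le e1
      linarith
    have h1 := hmono (mem_Ici.2 le_rfl) (mem_Ici.2 ht.le) ht.le
    simp only [mul_zero, Real.exp_zero, one_mul] at h1
    have h2 : 0 < Real.exp (K * t) * a t := lt_of_lt_of_le h0 h1
    exact (pos_iff_pos_of_mul_pos h2).1 (Real.exp_pos _)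
  · rcases (hr t).1.eq_or_lt with h1 | h1
    · exfalso
      have hmin : IsLocalMin a t := by
        filter_upwards with y
        rw [← h1]; exact (hr y).1
      have := hmin.hasDerivAt_eq_zero (hd t ht)
      rw [← h1, rf] at this
      simp at this
      linarith
    · exact h1

theorem nonpos_of (φ : ℝ → ℝ) (hc : ContinuousOn φ (Ici 0)) (h0 : φ 0 ≤ 0)
    (hd : ∀ t, 0 < t → 0 < φ t → ∃ d ≤ 0, HasDerivAt φ d t) : ∀ t, 0 ≤ t → φ t ≤ 0 := by
  intro t ht
  by_contra hcon
  push Not at hcon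
  have hcI : ContinuousOn φ (Icc 0 t) := hc.mono Icc_subset_Ici_self
  have hcl : IsClosed (Icc 0 t ∩ φ ⁻¹' Iic 0) :=
    hcI.preimage_isClosed_of_isClosed isClosed_Icc isClosed_Iic
  have hne : (Icc 0 t ∩ φ ⁻¹' Iic 0).Nonempty := ⟨0, ⟨le_rfl, ht⟩, h0⟩
  have hbd : BddAbove (Icc 0 t ∩ φ ⁻¹' Iic 0) := ⟨t, fun y hy => hy.1.2⟩
  have hm := hcl.csSup_mem hne hbd
  set u := sSup (Icc 0 t ∩ φ ⁻¹' Iic 0) with hu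
  have hpos : ∀ y ∈ Ioc u t, 0 < φ y := by
    intro y hy
    by_contra hy2
    push Not at hy2
    have : y ≤ u := le_csSup hbd ⟨⟨hm.1.1.trans hy.1.le, hy.2⟩, hy2⟩
    linarith [hy.1]
  have hanti : AntitoneOn φ (Icc u t) := by
    have key : ∀ y ∈ interior (Icc u t), ∃ d ≤ 0, HasDerivAt φ d y := by
      intro y hy
      rw [interior_Icc] at hy
      exact hd y (lt_of_le_of_lt hm.1.1 hy.1) (hpos y ⟨hy.1, hy.2.le⟩)
    apply antitoneOn_of_deriv_nonpos (convex_Icc u t) (hcI.mono (Icc_subset_Icc_left hm.1.1))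
    · intro y hy
      obtain ⟨d, _, hd'⟩ := key y hy
      exact hd'.differentiableAt.differentiableWithinAt
    · intro y hy
      obtain ⟨d, hd0, hd'⟩ := key y hy
      rw [hd'.deriv]; exact hd0
  have := hanti ⟨le_rfl, hm.1.2⟩ ⟨hm.1.2, le_rfl⟩ hm.1.2
  have h3 : φ u ≤ 0 := hm.2
  linarith

theorem harm_comp (s lam q : ℝ) (hs : 0 ≤ s) (hl : 0 ≤ lam) (hq : 0 ≤ q)
    (γ₀ : ℝ) (a b x h k : ℝ → ℝ) (ha : Continuous a) (hb : Continuous b) (hx : Continuous x)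
    (hh : ∀ t, 0 ≤ h t) (hk : ∀ t, 0 ≤ k t)
    (a0 : a 0 = γ₀) (b0 : b 0 = γ₀) (x0 : x 0 = γ₀) (hγ : 0 ≤ γ₀)
    (hap : ∀ t, 0 < t → 0 < a t) (hbp : ∀ t, 0 < t → 0 < b t)
    (had : ∀ t, 0 < t → HasDerivAt a (rf s lam q (a t) (h t)) t)
    (hbd : ∀ t, 0 < t → HasDerivAt b (rf s lam q (b t) (k t)) t)
    (hxd : ∀ t, 0 < t → HasDerivAt x (rf s lam q (x t) ((h t + k t) / 2)) t) :
    ∀ t, 0 ≤ t → x t ≤ (a t + b t) / 2 := by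
  have hm_le : ∀ t, 0 ≤ t → 2 * a t * b t / (a t + b t) ≤ (a t + b t) / 2 := by
    intro t ht
    rcases ht.eq_or_lt with rfl | ht
    · rw [a0, b0]
      rcases hγ.eq_or_lt with rfl | h
      · simp
      · apply le_of_eq; field_simp; ring
    · have := hap t ht
      have := hbp t ht
      rw [div_le_div_iff₀ (by positivity) (by norm_num)]
      nlinarith [sq_nonneg (a t - b t)]
  have hm_nn : ∀ t, 0 ≤ t → 0 ≤ 2 * a t * b t / (a t + b t) := by
    intro t ht
    rcases ht.eq_or_lt with rfl | ht
    · rw [a0, b0]; positivity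
    · have := hap t ht
      have := hbp t ht
      positivity
  have hm_c : ContinuousOn (fun t => 2 * a t * b t / (a t + b t)) (Ici 0) := by
    intro t ht
    by_cases hz : a t + b t = 0
    · have ht0 : t = 0 := by
        rcases (mem_Ici.1 ht).eq_or_lt with h | h
        · exact h.symm
        · have := hap t h
          have := hbp t h
          linarith
      subst ht0
      have e : 2 * a 0 * b 0 / (a 0 + b 0) = 0 := by rw [hz]; simp
      unfold ContinuousWithinAt
      change Tendsto _ _ (𝓝 (2 * a 0 * b 0 / (a 0 + b 0)))
      rw [e]
      have hab : Tendsto (fun t => (a t + b t) / 2) (𝓝[Ici 0] 0) (𝓝 0) := by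
        have : ContinuousWithinAt (fun t => (a t + b t) / 2) (Ici 0) 0 := by fun_prop
        replace this : Tendsto (fun t => (a t + b t) / 2) (𝓝[Ici 0] 0) (𝓝 ((a 0 + b 0) / 2)) := this
        rwa [hz, zero_div] at this
      refine tendsto_of_tendsto_of_tendsto_of_le_of_le' tendsto_const_nhds hab ?_ ?_
      · filter_upwards [self_mem_nhdsWithin] with y hy using hm_nn y hy
      · filter_upwards [self_mem_nhdsWithin] with y hy using hm_le y hy
    · apply ContinuousAt.continuousWithinAt
      exact ContinuousAt.div (by fun_prop) (by fun_prop) hz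
  have key := nonpos_of (fun t => x t - 2 * a t * b t / (a t + b t)) (hx.continuousOn.sub hm_c)
    (by
      simp only [a0, b0, x0]
      rcases hγ.eq_or_lt with rfl | h
      · simp
      · apply le_of_eq; field_simp; ring) ?_
  · intro t ht
    have h1 : x t - 2 * a t * b t / (a t + b t) ≤ 0 := key t ht
    have := hm_le t ht
    linarith
  intro t ht hpos
  have hat := hap t ht
  have hbt := hbp t ht
  have hne : a t + b t ≠ 0 := by positivity
  have dm := (((had t ht).const_mul 2).mul (hbd t ht)).div ((had t ht).add (hbd t ht)) hne
  refine ⟨_, ?_, (hxd t ht).sub dm⟩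
  set m := 2 * a t * b t / (a t + b t) with hm
  have hmn := hm_nn t ht.le
  rw [← hm] at hmn
  have e1 : ((2 * rf s lam q (a t) (h t) * b t + 2 * a t * rf s lam q (b t) (k t)) *
      (a t + b t) - 2 * a t * b t * (rf s lam q (a t) (h t) + rf s lam q (b t) (k t))) /
      (a t + b t) ^ 2 = rf s lam q m ((h t + k t) / 2) + q * ((a t - b t) / (a t + b t)) ^ 2 := by
    rw [hm]; unfold rf; field_simp; ring
  have e2 : 0 ≤ q * ((a t - b t) / (a t + b t)) ^ 2 := by positivity
  have e3 : rf s lam q (x t) ((h t + k t) / 2) - rf s lam q m ((h t + k t) / 2) =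
      -(((s + (h t + k t) / 2) * (x t + m) + 2 * lam) * (x t - m)) := by unfold rf; ring
  have e4 : 0 ≤ ((s + (h t + k t) / 2) * (x t + m) + 2 * lam) * (x t - m) := by
    have := hh t
    have := hk t
    have h1 : 0 ≤ x t - m := le_of_lt hpos
    have h2 : 0 ≤ x t + m := by linarith
    positivity
  have : rf s lam q (x t) ((h t + k t) / 2) - ((2 * rf s lam q (a t) (h t) * b t + 2 * a t * rf s lam q (b t) (k t)) *
      (a t + b t) - 2 * a t * b t * (rf s lam q (a t) (h t) + rf s lam q (b t) (k t))) /
      (a t + b t) ^ 2 ≤ 0 := by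
    rw [e1]; linarith
  exact this

theorem opt_unique (s lam q M hmax δ abar γ₀ V : ℝ) (hs : 0 ≤ s) (hl : 0 ≤ lam) (hq : 0 ≤ q)
    (hδ : 0 < δ) (habar : 0 ≤ abar) (hγ : 0 ≤ γ₀)
    (C : ℝ → ℝ) (hC : Continuous C) (hCn : ∀ x, 0 ≤ C x)
    (hCc : StrictConvexOn ℝ (Ici 0) C)
    (h k X Y : ℝ → ℝ) (hhc : Continuous h) (hkc : Continuous k)
    (hh : AdmN hmax h) (hk : AdmN hmax k)
    (hX : IsSolN s lam q M γ₀ h X) (hY : IsSolN s lam q M γ₀ k Y)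
    (hJX : costN δ abar C h X ≤ V) (hJY : costN δ abar C k Y ≤ V)
    (hV : ∀ u, AdmN hmax u → ∃ Z, IsSolN s lam q M γ₀ u Z ∧ V ≤ costN δ abar C u Z) :
    ∀ t, 0 ≤ t → X t = Y t := by
  obtain ⟨hX0, hXd⟩ := isSol_deriv s lam q M γ₀ h X hhc hX
  obtain ⟨hY0, hYd⟩ := isSol_deriv s lam q M γ₀ k Y hkc hY
  by_cases hz : 0 < γ₀ ∨ 0 < q
  · have hXp := sol_pos s lam q M hmax hs hl hq h X hX.1 hX.2.1 hh.2 hXd (by rwa [hX0])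
    have hYp := sol_pos s lam q M hmax hs hl hq k Y hY.1 hY.2.1 hk.2 hYd (by rwa [hY0])
    have huA : AdmN hmax (fun t => (h t + k t) / 2) := by
      refine ⟨(hh.1.add hk.1).div_const 2, fun t => ?_⟩
      obtain ⟨a1, a2⟩ := hh.2 t
      obtain ⟨b1, b2⟩ := hk.2 t
      constructor <;> linarith
    obtain ⟨Z, hZ, hVZ⟩ := hV _ huA
    obtain ⟨hZ0, hZd⟩ := isSol_deriv s lam q M γ₀ _ Z ((hhc.add hkc).div_const 2) hZ
    have hcomp := harm_comp s lam q hs hl hq γ₀ X Y Z h k hX.1 hY.1 hZ.1 (fun t => (hh.2 t).1)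
      (fun t => (hk.2 t).1) hX0 hY0 hZ0 hγ hXp hYp hXd hYd hZd
    obtain ⟨mX, nX, BX, bX⟩ := run_bdd abar M hmax habar C h X hC hCn hh hX.1 hX.2.1
    obtain ⟨mY, nY, BY, bY⟩ := run_bdd abar M hmax habar C k Y hC hCn hk hY.1 hY.2.1
    obtain ⟨mZ, nZ, BZ, bZ⟩ := run_bdd abar M hmax habar C _ Z hC hCn huA hZ.1 hZ.2.1
    have iX := exp_int_of_bdd δ hδ _ mX BX bX
    have iY := exp_int_of_bdd δ hδ _ mY BY bY
    have iZ := exp_int_of_bdd δ hδ _ mZ BZ bZ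
    set w : ℝ → ℝ := fun t => Real.exp (-δ * t) * (abar * X t + C (h t)) / 2 +
      Real.exp (-δ * t) * (abar * Y t + C (k t)) / 2 -
      Real.exp (-δ * t) * (abar * Z t + C ((h t + k t) / 2)) with hw
    have iw : MeasureTheory.IntegrableOn w (Ioi 0) := ((iX.div_const 2).add (iY.div_const 2)).sub iZ
    have ew : ∫ t in Ioi (0:ℝ), w t = costN δ abar C h X / 2 + costN δ abar C k Y / 2 -
        costN δ abar C (fun t => (h t + k t) / 2) Z := by
      have i12 : MeasureTheory.IntegrableOn
          (fun t => Real.exp (-δ * t) * (abar * X t + C (h t)) / 2 +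
            Real.exp (-δ * t) * (abar * Y t + C (k t)) / 2) (Ioi 0) :=
        (iX.div_const 2).add (iY.div_const 2)
      unfold costN
      simp only [hw]
      rw [MeasureTheory.integral_sub i12 iZ,
        MeasureTheory.integral_add (iX.div_const 2) (iY.div_const 2),
        MeasureTheory.integral_div, MeasureTheory.integral_div]
    have hconv : ∀ t, C ((h t + k t) / 2) ≤ (C (h t) + C (k t)) / 2 := by
      intro t
      have := hCc.convexOn.2 (hh.2 t).1 (hk.2 t).1 (show (0:ℝ) ≤ 1/2 by norm_num)
        (show (0:ℝ) ≤ 1/2 by norm_num) (by norm_num)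
      simp only [smul_eq_mul] at this
      rw [show 1 / 2 * h t + 1 / 2 * k t = (h t + k t) / 2 by ring] at this
      linarith
    have hsc : ∀ t, h t ≠ k t → C ((h t + k t) / 2) < (C (h t) + C (k t)) / 2 := by
      intro t hne
      have := hCc.2 (hh.2 t).1 (hk.2 t).1 hne (show (0:ℝ) < 1/2 by norm_num)
        (show (0:ℝ) < 1/2 by norm_num) (by norm_num)
      simp only [smul_eq_mul] at this
      rw [show 1 / 2 * h t + 1 / 2 * k t = (h t + k t) / 2 by ring] at this
      linarith
    have hweq : ∀ t, w t = Real.exp (-δ * t) * (abar * ((X t + Y t) / 2 - Z t) +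
        ((C (h t) + C (k t)) / 2 - C ((h t + k t) / 2))) := fun t => by rw [hw]; ring
    have hwnn : 0 ≤ᵐ[MeasureTheory.volume.restrict (Ioi 0)] w := by
      filter_upwards [MeasureTheory.ae_restrict_mem measurableSet_Ioi] with t ht
      have h1 := hcomp t (le_of_lt ht)
      have h2 := hconv t
      have h3 : 0 ≤ abar * ((X t + Y t) / 2 - Z t) := mul_nonneg habar (by linarith)
      rw [Pi.zero_apply, hweq]
      exact mul_nonneg (Real.exp_pos _).le (by linarith)
    have hw0 : ∫ t in Ioi (0:ℝ), w t = 0 := by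
      apply le_antisymm
      · rw [ew]; linarith
      · exact MeasureTheory.integral_nonneg_of_ae hwnn
    rw [MeasureTheory.integral_eq_zero_iff_of_nonneg_ae hwnn iw] at hw0
    have hae : ∀ᵐ t, t ∈ Ioi (0:ℝ) → h t = k t := by
      rw [← MeasureTheory.ae_restrict_iff' measurableSet_Ioi]
      filter_upwards [hw0, MeasureTheory.ae_restrict_mem measurableSet_Ioi] with t h0 ht
      by_contra hne
      have h1 := hcomp t (le_of_lt ht)
      have h2 := hsc t hne
      have h3 : 0 ≤ abar * ((X t + Y t) / 2 - Z t) := mul_nonneg habar (by linarith)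
      rw [Pi.zero_apply, hweq] at h0
      have : 0 < Real.exp (-δ * t) * (abar * ((X t + Y t) / 2 - Z t) +
        ((C (h t) + C (k t)) / 2 - C ((h t + k t) / 2))) :=
        mul_pos (Real.exp_pos _) (by linarith)
      linarith
    have hY' : IsSolN s lam q M γ₀ h Y := by
      refine ⟨hY.1, hY.2.1, fun t ht => ?_⟩
      rw [hY.2.2 t ht]
      congr 1
      apply intervalIntegral.integral_congr_ae
      filter_upwards [hae] with r hr hr2
      rw [uIoc_of_le ht] at hr2
      rw [hr hr2.1]
    exact sol_unique s lam q M hmax γ₀ hs hl hq h X Y hh hX hY'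
  · push Not at hz
    have hγ0 : γ₀ = 0 := le_antisymm hz.1 hγ
    have hq0 : q = 0 := le_antisymm hz.2 hq
    have zero : ∀ (u W : ℝ → ℝ), AdmN hmax u → IsSolN s lam q M γ₀ u W → W 0 = γ₀ →
        (∀ t, 0 < t → HasDerivAt W (rf s lam q (W t) (u t)) t) → ∀ t, 0 ≤ t → W t = 0 := by
      intro u W hu hW hW0 hWd t ht
      apply le_antisymm _ (hW.2.1 t).1
      refine nonpos_of W hW.1.continuousOn (by rw [hW0, hγ0]) ?_ t ht
      intro r hr _
      refine ⟨_, ?_, hWd r hr⟩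
      have := (hW.2.1 r).1
      have := (hu.2 r).1
      have h1 : 0 ≤ (s + u r) * W r ^ 2 := by positivity
      have h2 : 0 ≤ 2 * lam * W r := by positivity
      unfold rf; linarith
    intro t ht
    rw [zero h X hh hX hX0 hXd t ht, zero k Y hk hY hY0 hYd t ht]

end Helpers14


/-- For every γ₀ ∈ [0, γ_max], the feedback ODE
γ' = f(γ, H*(γ)), γ(0) = γ₀, admits a unique [0,γ_max]-valued solution γ*; the
feedback control h*(t) = H*(γ*(t)) is continuous with values in [0, h_max]; and h* is
optimal: J(h*; γ₀) = v(γ₀). Here H*(γ) = ĥ(γ²·v'(γ)) is the optimal feedback map. -/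
theorem stmt_14
    (σ₁ σ₂ lam δ abar γmax hmax : ℝ)
    (hσ₁ : 0 < σ₁) (hσ₂ : 0 ≤ σ₂) (hlam : 0 ≤ lam) (hδ : 0 < δ) (habar : 0 < abar)
    (f : ℝ → ℝ → ℝ)
    (hf : ∀ γ h : ℝ, f γ h = -(1 / σ₁ ^ 2 + h) * γ ^ 2 - 2 * lam * γ + σ₂ ^ 2)
    (γinf : ℝ)
    (hγinf : γinf = -lam * σ₁ ^ 2 + Real.sqrt (lam ^ 2 * σ₁ ^ 4 + σ₁ ^ 2 * σ₂ ^ 2))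
    (hγmax : γinf < γmax)
    (c c' : ℝ → ℝ)
    (hc_nonneg : ∀ x : ℝ, 0 ≤ x → 0 ≤ c x)
    (hc_conv : StrictConvexOn ℝ (Set.Ici 0) c)
    (hc_mono : StrictMonoOn c (Set.Ici 0))
    (hc_smooth : ContDiffOn ℝ 2 c (Set.Ici 0))
    (hc_deriv : ∀ x ∈ Set.Ici (0 : ℝ), HasDerivWithinAt c (c' x) (Set.Ici 0) x)
    (hhmax : 0 < hmax) (hc_hmax : c' hmax = γmax ^ 2 * (abar / δ))
    (Adm : (ℝ → ℝ) → Prop)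
    (hAdm : ∀ h : ℝ → ℝ, Adm h ↔ Measurable h ∧ ∀ t : ℝ, h t ∈ Set.Icc 0 hmax)
    (sol : (ℝ → ℝ) → ℝ → ℝ → ℝ)
    (hsol : ∀ h : ℝ → ℝ, Adm h → ∀ γ₀ ∈ Set.Icc (0 : ℝ) γmax,
      sol h γ₀ 0 = γ₀ ∧
      ContinuousOn (sol h γ₀) (Set.Ici 0) ∧
      (∀ t ∈ Set.Ici (0 : ℝ), sol h γ₀ t ∈ Set.Icc 0 γmax) ∧
      (∀ t ∈ Set.Ici (0 : ℝ),
        sol h γ₀ t = γ₀ + ∫ s in (0 : ℝ)..t, f (sol h γ₀ s) (h s)))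
    (J : (ℝ → ℝ) → ℝ → ℝ)
    (hJ : ∀ (h : ℝ → ℝ) (γ₀ : ℝ), J h γ₀ =
      ∫ t in Set.Ioi (0 : ℝ), Real.exp (-δ * t) * (abar * sol h γ₀ t + c (h t)))
    (v : ℝ → ℝ)
    (hv : ∀ γ₀ ∈ Set.Icc (0 : ℝ) γmax,
      v γ₀ = sInf ((fun h => J h γ₀) '' {h : ℝ → ℝ | Adm h}))
    (v' : ℝ → ℝ)
    (hv_conc : ConcaveOn ℝ (Set.Icc 0 γmax) v)
    (hv'_deriv : ∀ x ∈ Set.Ioo (0 : ℝ) γmax, HasDerivAt v (v' x) x)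
    (hv'_cont : ContinuousOn v' (Set.Ioo 0 γmax))
    (hv'_zero : HasDerivWithinAt v (v' 0) (Set.Icc 0 γmax) 0)
    (hv'_gmax : HasDerivWithinAt v (v' γmax) (Set.Icc 0 γmax) γmax)
    (Hstar : ℝ → ℝ)
    (hHstar : ∀ γ ∈ Set.Icc (0 : ℝ) γmax,
      (γ ^ 2 * v' γ < c' 0 → Hstar γ = 0) ∧
      (c' 0 ≤ γ ^ 2 * v' γ →
        Hstar γ ∈ Set.Icc (0 : ℝ) hmax ∧ c' (Hstar γ) = γ ^ 2 * v' γ))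
    (γ₀ : ℝ) (hγ₀ : γ₀ ∈ Set.Icc (0 : ℝ) γmax) :
    ∃ γstar : ℝ → ℝ,
      (γstar 0 = γ₀ ∧
        ∀ t ∈ Set.Ici (0 : ℝ), γstar t ∈ Set.Icc 0 γmax ∧
          HasDerivWithinAt γstar (f (γstar t) (Hstar (γstar t))) (Set.Ici 0) t) ∧
      (∀ g : ℝ → ℝ, g 0 = γ₀ →
        (∀ t ∈ Set.Ici (0 : ℝ), g t ∈ Set.Icc 0 γmax ∧
          HasDerivWithinAt g (f (g t) (Hstar (g t))) (Set.Ici 0) t) →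
        Set.EqOn g γstar (Set.Ici 0)) ∧
      (∃ hstar : ℝ → ℝ,
        (∀ t ∈ Set.Ici (0 : ℝ), hstar t = Hstar (γstar t)) ∧
        ContinuousOn hstar (Set.Ici 0) ∧ Adm hstar ∧
        J hstar γ₀ = v γ₀) := by

  set s : ℝ := 1 / σ₁ ^ 2 with hs_def
  set q : ℝ := σ₂ ^ 2 with hq_def
  have hs : 0 ≤ s := by positivity
  have hs0 : 0 < σ₁ ^ 2 := by positivity
  have hq : 0 ≤ q := by positivity
  have hfr : ∀ γ h, f γ h = rf s lam q γ h := fun γ h => hf γ h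
  have hroot : lam * σ₁ ^ 2 ≤ Real.sqrt (lam ^ 2 * σ₁ ^ 4 + σ₁ ^ 2 * σ₂ ^ 2) := by
    apply Real.le_sqrt_of_sq_le
    have : 0 ≤ σ₁ ^ 2 * σ₂ ^ 2 := by positivity
    nlinarith
  have hM : 0 < γmax := by
    have : 0 ≤ γinf := by rw [hγinf]; linarith
    linarith
  have hAN : ∀ h, Adm h ↔ AdmN hmax h := hAdm
  set C : ℝ → ℝ := fun x => c (max x 0) with hCdef
  have hCeq : ∀ x, 0 ≤ x → C x = c x := fun x hx => by simp only [hCdef]; rw [max_eq_left hx]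
  have hcc : ContinuousOn c (Set.Ici 0) := fun x hx => (hc_deriv x hx).continuousWithinAt
  have hC : Continuous C := hcc.comp_continuous (by fun_prop) (fun t => le_max_right t 0)
  have hCn : ∀ x, 0 ≤ C x := fun x => hc_nonneg _ (le_max_right x 0)
  have hCc : StrictConvexOn ℝ (Set.Ici 0) C := by
    refine ⟨hc_conv.1, fun x hx y hy hxy a b ha hb hab => ?_⟩
    have h1 : a • x + b • y ∈ Set.Ici (0:ℝ) := hc_conv.1 hx hy ha.le hb.le hab
    rw [hCeq x hx, hCeq y hy, hCeq _ h1]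
    exact hc_conv.2 hx hy hxy ha hb hab
  -- solutions in the integral form
  have hsolN : ∀ h, AdmN hmax h → ∀ x ∈ Set.Icc (0:ℝ) γmax,
      IsSolN s lam q γmax x h (fun t => sol h x (max t 0)) := by
    intro h hh x hx
    obtain ⟨h0, h1, h2, h3⟩ := hsol h ((hAN h).2 hh) x hx
    refine ⟨h1.comp_continuous (by fun_prop) (fun t => le_max_right t 0),
      fun t => h2 _ (le_max_right t 0), fun t ht => ?_⟩
    change sol h x (max t 0) = _
    rw [max_eq_left ht, h3 t ht]
    congr 1
    apply intervalIntegral.integral_congr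
    intro r hr
    rw [Set.uIcc_of_le ht] at hr
    change f (sol h x r) (h r) = rf s lam q (sol h x (max r 0)) (h r)
    rw [max_eq_left hr.1, hfr]
  have hJN : ∀ h, AdmN hmax h → ∀ x ∈ Set.Icc (0:ℝ) γmax, ∀ X, IsSolN s lam q γmax x h X →
      J h x = costN δ abar C h X := by
    intro h hh x hx X hX
    rw [hJ, costN]
    apply MeasureTheory.setIntegral_congr_fun measurableSet_Ioi
    intro t ht
    have ht' : (0:ℝ) ≤ t := le_of_lt ht
    have h1 := sol_unique s lam q γmax hmax x hs hlam hq h _ X hh (hsolN h hh x hx) hX t ht'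
    simp only [max_eq_left ht'] at h1
    change Real.exp (-δ * t) * (abar * sol h x t + c (h t)) =
      Real.exp (-δ * t) * (abar * X t + C (h t))
    rw [h1, hCeq _ (hh.2 t).1]
  have hcost_nn : ∀ h X, (∀ t, X t ∈ Set.Icc 0 γmax) → 0 ≤ costN δ abar C h X := by
    intro h X hX
    apply MeasureTheory.integral_nonneg
    intro t
    have h1 := (hX t).1
    have h2 := hCn (h t)
    change 0 ≤ Real.exp (-δ * t) * (abar * X t + C (h t))
    positivity
  have hJnn : ∀ x ∈ Set.Icc (0:ℝ) γmax, ∀ y ∈ (fun h => J h x) '' {h : ℝ → ℝ | Adm h}, 0 ≤ y := by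
    rintro x hx y ⟨h, hh, rfl⟩
    have hh' := (hAN h).1 hh
    change 0 ≤ J h x
    rw [hJN h hh' x hx _ (hsolN h hh' x hx)]
    exact hcost_nn _ _ (hsolN h hh' x hx).2.1
  have hvn : ∀ x ∈ Set.Icc (0:ℝ) γmax, 0 ≤ v x := fun x hx => by
    rw [hv x hx]; exact Real.sInf_nonneg (hJnn x hx)
  have hvle : ∀ x ∈ Set.Icc (0:ℝ) γmax, ∀ h X, AdmN hmax h → IsSolN s lam q γmax x h X →
      v x ≤ costN δ abar C h X := by
    intro x hx h X hh hX
    rw [hv x hx, ← hJN h hh x hx X hX]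
    exact csInf_le ⟨0, hJnn x hx⟩ ⟨h, (hAN h).2 hh, rfl⟩
  have hd : ∀ x ∈ Set.Icc (0:ℝ) γmax, HasDerivWithinAt v (v' x) (Set.Icc 0 γmax) x := by
    intro x hx
    rcases hx.1.eq_or_lt with h | h
    · rw [← h]; exact hv'_zero
    rcases hx.2.eq_or_lt with h2 | h2
    · rw [h2]; exact hv'_gmax
    · exact (hv'_deriv x ⟨h, h2⟩).hasDerivWithinAt
  have hv'c := concave_deriv_cont v v' γmax hM hv_conc hd hv'_cont
  obtain ⟨hc'c, hc'm⟩ := cprime_props c c' hc_conv hc_smooth hc_deriv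
  obtain ⟨hHr, hHc⟩ := feedback_cont γmax hmax hhmax c' (fun x => x ^ 2 * v' x) Hstar hc'c hc'm
    ((continuousOn_pow 2).mul hv'c) hHstar
  -- dynamic programming inequality and the HJB inequality
  have hjb : ∀ x ∈ Set.Icc (0:ℝ) γmax,
      abar * x + C (Hstar x) + v' x * rf s lam q x (Hstar x) ≤ δ * v x := by
    intro x hx
    refine supersol s lam q γmax hmax δ abar hs hlam hq hδ habar.le hM.le hhmax.le C hC hCn v x
      (v' x) _ (hd x hx) ?_ hx ?_
    · intro h hh
      have := feedback_min c c' hc_conv.convexOn hc_deriv (x ^ 2 * v' x) (Hstar x) (hHstar x hx).1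
        (fun hle => ⟨((hHstar x hx).2 hle).1.1, ((hHstar x hx).2 hle).2⟩) h hh.1
      rw [hCeq h hh.1, hCeq _ (hHr x hx).1]
      unfold rf
      linarith
    · intro τ hτ ε hε
      have hne : ((fun h => J h x) '' {h : ℝ → ℝ | Adm h}).Nonempty :=
        ⟨_, fun _ => 0, (hAN _).2 ⟨measurable_const, fun _ => ⟨le_rfl, hhmax.le⟩⟩, rfl⟩
      obtain ⟨y, ⟨h, hh, rfl⟩, hy⟩ := Real.lt_sInf_add_pos hne hε
      rw [← hv x hx] at hy
      have hh' := (hAN h).1 hh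
      have hX := hsolN h hh' x hx
      refine ⟨h, _, hh', hX, ?_⟩
      have e1 := cost_split δ abar γmax hmax hδ habar.le C h _ hC hCn hh' hX.1 hX.2.1 τ hτ.le
      have hsh := sol_shift s lam q γmax hmax x hs hlam hq h _ hh' hX τ hτ.le
      have e2 := hvle _ (hX.2.1 τ) _ _
        (⟨hh'.1.comp (measurable_id.add_const τ), fun t => hh'.2 _⟩ :
          AdmN hmax (fun t => h (t + τ))) hsh
      have e3 := mul_le_mul_of_nonneg_left e2 (Real.exp_pos (-δ * τ)).le
      have e4 : J h x < v x + ε := hy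
      rw [hJN h hh' x hx _ hX] at e4
      linarith
  -- every feedback solution is optimal
  have hopt : ∀ g : ℝ → ℝ, g 0 = γ₀ → (∀ t ∈ Set.Ici (0 : ℝ), g t ∈ Set.Icc 0 γmax ∧
      HasDerivWithinAt g (f (g t) (Hstar (g t))) (Set.Ici 0) t) →
      Continuous (fun t => Hstar (g (max t 0))) ∧
      AdmN hmax (fun t => Hstar (g (max t 0))) ∧
      IsSolN s lam q γmax γ₀ (fun t => Hstar (g (max t 0))) (fun t => g (max t 0)) ∧
      costN δ abar C (fun t => Hstar (g (max t 0))) (fun t => g (max t 0)) ≤ v γ₀ := by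
    intro g hg0 hg
    have hg' : ∀ t ∈ Set.Ici (0 : ℝ), g t ∈ Set.Icc 0 γmax ∧
        HasDerivWithinAt g (rf s lam q (g t) (Hstar (g t))) (Set.Ici 0) t := by
      intro t ht
      rw [← hfr]; exact hg t ht
    obtain ⟨a1, a2⟩ := feedback_isSol s lam q γmax γ₀ Hstar g hHc hg0 hg'
    exact ⟨a1, ⟨a1.measurable, fun t => hHr _ (a2.2.1 t)⟩, a2,
      verif s lam q γmax hmax δ abar γ₀ hδ habar.le C hC hCn v v' Hstar g hHc hHr hg0 hg' hd hvn hjb⟩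
  -- existence
  have hFc : ContinuousOn (fun γ => f γ (Hstar γ)) (Set.Icc 0 γmax) := by
    simp only [hfr]
    unfold rf
    fun_prop
  have hF0 : 0 ≤ (fun γ => f γ (Hstar γ)) 0 := by
    simp only [hfr]
    unfold rf
    nlinarith
  have hFM : (fun γ => f γ (Hstar γ)) γmax ≤ 0 := by
    simp only [hfr]
    unfold rf
    have h1 := (hHr γmax ⟨hM.le, le_rfl⟩).1
    have h2 : Real.sqrt (lam ^ 2 * σ₁ ^ 4 + σ₁ ^ 2 * σ₂ ^ 2) ≤ γmax + lam * σ₁ ^ 2 := by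
      rw [hγinf] at hγmax; linarith
    rw [Real.sqrt_le_left (by positivity)] at h2
    have h3 : 0 ≤ Hstar γmax * γmax ^ 2 := by positivity
    have h4 : σ₁ ^ 2 * σ₂ ^ 2 ≤ γmax ^ 2 + 2 * lam * γmax * σ₁ ^ 2 := by nlinarith
    have h5 : σ₂ ^ 2 ≤ s * γmax ^ 2 + 2 * lam * γmax := by
      have h6 : s * γmax ^ 2 + 2 * lam * γmax = (γmax ^ 2 + 2 * lam * γmax * σ₁ ^ 2) / σ₁ ^ 2 := by
        rw [hs_def]; field_simp
      rw [h6, le_div_iff₀ hs0]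
      linarith
    linarith
  obtain ⟨g, hg0, hg⟩ := ode_exists (fun γ => f γ (Hstar γ)) 0 γmax γ₀ hFc hγ₀ hF0 hFM
  obtain ⟨g1, g2, g3, g4⟩ := hopt g hg0 hg
  refine ⟨g, ⟨hg0, hg⟩, ?_, fun t => Hstar (g (max t 0)), ?_, g1.continuousOn, (hAN _).2 g2, ?_⟩
  · intro k hk0 hk t ht
    obtain ⟨k1, k2, k3, k4⟩ := hopt k hk0 hk
    have := opt_unique s lam q γmax hmax δ abar γ₀ (v γ₀) hs hlam hq hδ habar.le hγ₀.1 C hC hCn hCc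
      _ _ _ _ k1 g1 k2 g2 k3 g3 k4 g4
      (fun u hu => ⟨_, hsolN u hu γ₀ hγ₀, hvle γ₀ hγ₀ _ _ hu (hsolN u hu γ₀ hγ₀)⟩) t ht
    simpa only [max_eq_left (Set.mem_Ici.1 ht)] using this
  · intro t ht
    simp only [max_eq_left (Set.mem_Ici.1 ht)]
  · rw [hJN _ g2 γ₀ hγ₀ _ g3]
    exact le_antisymm g4 (hvle γ₀ hγ₀ _ _ g2 g3)
end
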